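/- arXiv:1101.3352 — 2 statements merged into one kernel-verified Lean document; each statement's English description precedes it below -/
import Mathlib

section
/- There exists a universal constant C > 0 with the following property: for every n ≥ 1, if X is a random vector in ℝⁿ with log-concave density f satisfying ‖f‖_∞ ≥ 1, and Z is uniformly distributed on the centered Euclidean ball D of volume one and independent of X, then there exists an affine volume-preserving map u : ℝⁿ → ℝⁿ such that N(u(X) + Z) ≤ C. -/
open MeasureTheory ProbabilityTheory Real Pointwise

/-- A nonnegative function on ℝⁿ is log-concave if
`f(tx + (1-t)y) ≥ f(x)^t f(y)^(1-t)` for all `x, y` and `t ∈ [0,1]`. -/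
def IsLogConcave {n : ℕ} (f : EuclideanSpace ℝ (Fin n) → ℝ) : Prop :=
  (∀ x, 0 ≤ f x) ∧
  ∀ x y : EuclideanSpace ℝ (Fin n), ∀ t : ℝ, 0 ≤ t → t ≤ 1 →
    f x ^ t * f y ^ (1 - t) ≤ f (t • x + (1 - t) • y)

/-- Differential (Shannon) entropy of a measure on ℝⁿ,
computed from its density w.r.t. Lebesgue measure: `h(μ) = -∫ p log p`. -/
noncomputable def dEnt {n : ℕ} (μ : Measure (EuclideanSpace ℝ (Fin n))) : ℝ :=
  -∫ x, ((μ.rnDeriv volume x).toReal) * Real.log ((μ.rnDeriv volume x).toReal)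

/-- Entropy power `N(μ) = exp(2 h(μ) / n)`. -/
noncomputable def entPow {n : ℕ} (μ : Measure (EuclideanSpace ℝ (Fin n))) : ℝ :=
  Real.exp (2 * dEnt μ / n)

set_option linter.unusedSectionVars false

namespace MEll

section BM
variable {E : Type*} [NormedAddCommGroup E] [InnerProductSpace ℝ E] [FiniteDimensional ℝ E]
  [MeasurableSpace E] [BorelSpace E]

/-- A strongly monotone Lipschitz map is surjective. -/
theorem surj_of_strongMono (G : E → E) (m L : ℝ) (hm : 0 < m)
    (hmono : ∀ x y, m * ‖x - y‖ ^ 2 ≤ inner ℝ (G x - G y) (x - y))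
    (hlip : ∀ x y, ‖G x - G y‖ ≤ L * ‖x - y‖) : Function.Surjective G := by
  intro v
  obtain ⟨M, hM, hML, hMm⟩ : ∃ M : ℝ, 0 < M ∧ L ≤ M ∧ m ≤ M :=
    ⟨max L m, lt_max_of_lt_right hm, le_max_left _ _, le_max_right _ _⟩
  have hlip' : ∀ x y, ‖G x - G y‖ ≤ M * ‖x - y‖ := fun x y =>
    (hlip x y).trans (mul_le_mul_of_nonneg_right hML (norm_nonneg _))
  set s := m / M ^ 2 with hs
  have hs0 : 0 < s := by positivity
  set q := Real.sqrt (1 - m ^ 2 / M ^ 2) with hq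
  have hq1 : q < 1 := by
    rw [hq, Real.sqrt_lt' one_pos]
    have : 0 < m ^ 2 / M ^ 2 := by positivity
    linarith
  have hq0 : 0 ≤ 1 - m ^ 2 / M ^ 2 := by
    have : m ^ 2 / M ^ 2 ≤ 1 := by
      rw [div_le_one (by positivity)]
      exact pow_le_pow_left₀ hm.le hMm 2
    linarith
  let S : E → E := fun x => x - s • (G x - v)
  have hS : ∀ x y, ‖S x - S y‖ ≤ q * ‖x - y‖ := by
    intro x y
    have h1 : S x - S y = (x - y) - s • (G x - G y) := by
      simp only [S]; module
    have h2 : ‖S x - S y‖ ^ 2 ≤ (q * ‖x - y‖) ^ 2 := by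
      rw [h1, norm_sub_sq_real, mul_pow, hq, Real.sq_sqrt hq0, norm_smul, inner_smul_right, mul_pow,
        real_inner_comm]
      have h3 := hmono x y
      have h4 : ‖G x - G y‖ ^ 2 ≤ M ^ 2 * ‖x - y‖ ^ 2 := by
        rw [← mul_pow]; exact pow_le_pow_left₀ (norm_nonneg _) (hlip' x y) 2
      have h5 : ‖s‖ ^ 2 * ‖G x - G y‖ ^ 2 ≤ s ^ 2 * (M ^ 2 * ‖x - y‖ ^ 2) := by
        rw [Real.norm_eq_abs, sq_abs]
        exact mul_le_mul_of_nonneg_left h4 (sq_nonneg _)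
      have h6 : s * (m * ‖x - y‖ ^ 2) ≤ s * inner ℝ (G x - G y) (x - y) :=
        mul_le_mul_of_nonneg_left h3 hs0.le
      have h7 : s ^ 2 * (M ^ 2 * ‖x - y‖ ^ 2) = m ^ 2 / M ^ 2 * ‖x - y‖ ^ 2 := by
        rw [hs]; field_simp
      have h8 : s * (m * ‖x - y‖ ^ 2) = m ^ 2 / M ^ 2 * ‖x - y‖ ^ 2 := by
        rw [hs]; field_simp
      nlinarith
    exact (pow_le_pow_iff_left₀ (norm_nonneg _) (by positivity) two_ne_zero).1 h2
  have hc : ContractingWith ⟨q, Real.sqrt_nonneg _⟩ S := by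
    refine ⟨by exact_mod_cast hq1, LipschitzWith.of_dist_le_mul fun x y => ?_⟩
    rw [dist_eq_norm, dist_eq_norm]; exact hS x y
  have hfix := hc.fixedPoint_isFixedPt
  refine ⟨hc.fixedPoint, ?_⟩
  have h9 : s • (G hc.fixedPoint - v) = 0 := by
    have : hc.fixedPoint - s • (G hc.fixedPoint - v) = hc.fixedPoint := hfix
    simpa using this
  rcases smul_eq_zero.1 h9 with h | h
  · exact absurd h hs0.ne'
  · exact sub_eq_zero.1 h

/-- Data of a strongly monotone Lipschitz differentiable odd map. -/
structure GoodMap (T : E → E) (B : E → E →L[ℝ] E) (δ Λ : ℝ) : Prop where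
  hδ : 0 < δ
  deriv : ∀ x, HasFDerivAt T (B x) x
  mono : ∀ x y, δ * ‖x - y‖ ^ 2 ≤ inner ℝ (T x - T y) (x - y)
  lip : ∀ x y, ‖T x - T y‖ ≤ Λ * ‖x - y‖
  odd : ∀ x, T (-x) = - T x

variable {T : E → E} {B : E → E →L[ℝ] E} {δ Λ : ℝ}

theorem GoodMap.measB (h : GoodMap T B δ Λ) : Measurable B := by
  have : B = fderiv ℝ T := by
    ext1 x; exact ((h.deriv x).fderiv).symm
  rw [this]; exact measurable_fderiv ℝ T

theorem GoodMap.cont (h : GoodMap T B δ Λ) : Continuous T :=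
  continuous_iff_continuousAt.2 fun x => (h.deriv x).continuousAt

/-- density of the reference measure -/
noncomputable def dens (B : E → E →L[ℝ] E) (p : E × E) : ENNReal :=
  ENNReal.ofReal |(B p.1 + B p.2).det|

theorem GoodMap.meas_dens (h : GoodMap T B δ Λ) : Measurable (dens B) := by
  unfold dens
  have h1 : Measurable fun p : E × E => B p.1 + B p.2 :=
    (h.measB.comp measurable_fst).add (h.measB.comp measurable_snd)
  have h2 : Measurable fun A : E →L[ℝ] E => A.det := ContinuousLinearMap.continuous_det.measurable
  have h3 := h2.comp h1
  exact ENNReal.measurable_ofReal.comp (measurable_norm.comp h3)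

theorem GoodMap.lintegral (h : GoodMap T B δ Λ) (α β : ℝ) (hα : 0 < α) (hβ : 0 < β)
    (hab : α * β = 1) (H : E × E → ENNReal) (hH : Measurable H) :
    ∫⁻ p : E × E, dens B p * H (α • p.1 + β • p.2, α • T p.1 - β • T p.2) = ∫⁻ p, H p := by
  have hTm : Measurable T := h.cont.measurable
  set n := Module.finrank ℝ E
  have hmeas1 : Measurable fun p : E × E => (α • p.1 + β • p.2, α • T p.1 - β • T p.2) := by
    fun_prop
  have hg : Measurable fun p : E × E => dens B p * H (α • p.1 + β • p.2, α • T p.1 - β • T p.2) :=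
    h.meas_dens.mul (hH.comp hmeas1)
  rw [Measure.volume_eq_prod, lintegral_prod _ hg.aemeasurable]
  -- inner substitution
  have hsub : ∀ (x : E) (g : E → ENNReal), Measurable g →
      ∫⁻ x', g x' = ENNReal.ofReal (α ^ n) * ∫⁻ u, g (α • (u - α • x)) := by
    intro x g hgm
    have e1 : ∫⁻ u, g (α • (u - α • x)) = ∫⁻ u, g (α • u) :=
      lintegral_sub_right_eq_self (fun u => g (α • u)) (α • x)
    have e2 : ∫⁻ u, g (α • u) = ENNReal.ofReal |(α ^ n)⁻¹| * ∫⁻ x', g x' := by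
      have e3 := Measure.map_addHaar_smul (volume : Measure E) hα.ne'
      rw [← lintegral_map (μ := volume) hgm (measurable_const_smul α), e3, lintegral_smul_measure]
      rfl
    rw [e1, e2, ← mul_assoc, ← ENNReal.ofReal_mul (by positivity), abs_of_pos (by positivity),
      mul_inv_cancel₀ (by positivity), ENNReal.ofReal_one, one_mul]
  have hstep : ∀ x : E, ∫⁻ x', dens B (x, x') * H (α • x + β • x', α • T x - β • T x')
      = ENNReal.ofReal (α ^ n) * ∫⁻ u, dens B (x, α • (u - α • x)) *
        H (u, α • T x - β • T (α • (u - α • x))) := by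
    intro x
    rw [hsub x (fun x' => dens B (x, x') * H (α • x + β • x', α • T x - β • T x'))
      (hg.comp measurable_prodMk_left)]
    congr 1
    refine lintegral_congr fun u => ?_
    have : α • x + β • (α • (u - α • x)) = u := by
      rw [smul_smul, mul_comm β α, hab, one_smul]; abel
    simp only [this]
  simp only [hstep]
  have hg2 : Measurable fun p : E × E => dens B (p.1, α • (p.2 - α • p.1)) *
        H (p.2, α • T p.1 - β • T (α • (p.2 - α • p.1))) := by
    refine Measurable.mul (h.meas_dens.comp (by fun_prop)) (hH.comp (by fun_prop))
  rw [lintegral_const_mul _ hg2.lintegral_prod_right', lintegral_lintegral_swap hg2.aemeasurable,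
    ← lintegral_const_mul _ hg2.lintegral_prod_left', lintegral_prod _ hH.aemeasurable]
  refine lintegral_congr fun u => ?_
  set G : E → E := fun x => α • T x - β • T (α • (u - α • x)) with hG
  have hGd : ∀ x, HasFDerivAt G (α • (B x + B (α • (u - α • x)))) x := by
    intro x
    have d1 : HasFDerivAt (fun x => α • (u - α • x)) (α • (-(α • ContinuousLinearMap.id ℝ E))) x :=
      (((hasFDerivAt_id x).const_smul α).const_sub u).const_smul α
    have d2 := ((h.deriv x).const_smul α).sub
      (((h.deriv (α • (u - α • x))).comp x d1).const_smul β)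
    refine d2.congr_fderiv ?_
    ext1 y
    change α • B x y - β • B (α • (u - α • x)) (α • -(α • y))
      = α • (B x y + B (α • (u - α • x)) y)
    simp only [map_smul, map_neg, smul_add, smul_neg, sub_neg_eq_add]
    congr 1
    simp only [smul_smul]
    congr 1
    calc β * (α * α) = (α * β) * α := by ring
      _ = α := by rw [hab, one_mul]
  have hGm : ∀ x y, δ * α * ‖x - y‖ ^ 2 ≤ inner ℝ (G x - G y) (x - y) := by
    intro x y
    have a1 := h.mono x y
    have a2 := h.mono (α • (u - α • x)) (α • (u - α • y))
    have a3 : α • (u - α • x) - α • (u - α • y) = (-(α * α)) • (x - y) := by module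
    rw [a3, inner_smul_right] at a2
    have a4 : inner ℝ (G x - G y) (x - y) = α * inner ℝ (T x - T y) (x - y)
        - β * inner ℝ (T (α • (u - α • x)) - T (α • (u - α • y))) (x - y) := by
      rw [← real_inner_smul_left, ← real_inner_smul_left, ← inner_sub_left]
      congr 1
      simp only [hG]; module
    rw [a4]
    have a5 : 0 ≤ -(α * α) * inner ℝ (T (α • (u - α • x)) - T (α • (u - α • y))) (x - y) :=
      le_trans (by have := h.hδ; positivity) a2
    have a6 : inner ℝ (T (α • (u - α • x)) - T (α • (u - α • y))) (x - y) ≤ 0 := by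
      by_contra hc
      push Not at hc
      have : 0 < α * α * inner ℝ (T (α • (u - α • x)) - T (α • (u - α • y))) (x - y) := by positivity
      linarith
    have a7 : β * inner ℝ (T (α • (u - α • x)) - T (α • (u - α • y))) (x - y) ≤ 0 :=
      mul_nonpos_of_nonneg_of_nonpos hβ.le a6
    have a8 := mul_le_mul_of_nonneg_left a1 hα.le
    linarith
  have hGl : ∀ x y, ‖G x - G y‖ ≤ (α * Λ + β * (Λ * (α * α))) * ‖x - y‖ := by
    intro x y
    have a0 : G x - G y = α • (T x - T y) - β • (T (α • (u - α • x)) - T (α • (u - α • y))) := by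
      simp only [hG]; module
    have a1 := h.lip x y
    have a2 := h.lip (α • (u - α • x)) (α • (u - α • y))
    have a3 : α • (u - α • x) - α • (u - α • y) = (-(α * α)) • (x - y) := by module
    rw [a3, norm_smul, norm_neg, Real.norm_eq_abs, abs_of_pos (by positivity)] at a2
    rw [a0]
    refine (norm_sub_le _ _).trans ?_
    rw [norm_smul, norm_smul, Real.norm_eq_abs, Real.norm_eq_abs, abs_of_pos hα, abs_of_pos hβ]
    have a4 := mul_le_mul_of_nonneg_left a1 hα.le
    have a5 := mul_le_mul_of_nonneg_left a2 hβ.le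
    linarith
  have hpos : 0 < δ * α := mul_pos h.hδ hα
  have hsurj := surj_of_strongMono G (δ * α) _ hpos hGm hGl
  have hinj : Function.Injective G := by
    intro x y hxy
    have := hGm x y
    rw [hxy, sub_self, inner_zero_left] at this
    have h0 : ‖x - y‖ ^ 2 ≤ 0 := by
      by_contra hc
      push Not at hc
      have := mul_pos hpos hc
      linarith
    have : ‖x - y‖ = 0 := by nlinarith [norm_nonneg (x - y)]
    exact sub_eq_zero.1 (norm_eq_zero.1 this)
  have key := lintegral_image_eq_lintegral_abs_det_fderiv_mul (volume : Measure E)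
    MeasurableSet.univ (fun x _ => (hGd x).hasFDerivWithinAt) hinj.injOn (fun v => H (u, v))
  rw [Set.image_univ, hsurj.range_eq, Measure.restrict_univ] at key
  rw [key, ← lintegral_const_mul]
  · refine lintegral_congr fun x => ?_
    rw [← mul_assoc]
    congr 1
    have : (α • (B x + B (α • (u - α • x)))).det = α ^ n * (B x + B (α • (u - α • x))).det := by
      simp only [ContinuousLinearMap.det, ContinuousLinearMap.toLinearMap_smul]
      rw [LinearMap.det_smul]
    rw [this, abs_mul, abs_of_pos (by positivity : 0 < α ^ n),
      ENNReal.ofReal_mul (by positivity)]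
    rfl
  · exact hg2.comp measurable_prodMk_right

end BM
end MEll

set_option linter.unusedSectionVars false

namespace MEll

section BM2
variable {E : Type*} [NormedAddCommGroup E] [InnerProductSpace ℝ E] [FiniteDimensional ℝ E]
  [MeasurableSpace E] [BorelSpace E]
variable {T : E → E} {B : E → E →L[ℝ] E} {δ Λ : ℝ}

noncomputable def nuM (B : E → E →L[ℝ] E) : Measure (E × E) :=
  (volume : Measure (E × E)).withDensity (dens B)

theorem GoodMap.lintegral_nu (h : GoodMap T B δ Λ) (α β : ℝ) (hα : 0 < α) (hβ : 0 < β)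
    (hab : α * β = 1) (H : E × E → ENNReal) (hH : Measurable H) :
    ∫⁻ p : E × E, H (α • p.1 + β • p.2, α • T p.1 - β • T p.2) ∂(nuM B) = ∫⁻ p, H p := by
  have hTm : Measurable T := h.cont.measurable
  rw [nuM, lintegral_withDensity_eq_lintegral_mul _ h.meas_dens]
  · exact h.lintegral α β hα hβ hab H hH
  · exact hH.comp (by fun_prop)

theorem GoodMap.map_nu (h : GoodMap T B δ Λ) (α β : ℝ) (hα : 0 < α) (hβ : 0 < β)
    (hab : α * β = 1) :
    Measure.map (fun p : E × E => (α • p.1 + β • p.2, α • T p.1 - β • T p.2)) (nuM B)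
      = volume := by
  have hTm : Measurable T := h.cont.measurable
  refine Measure.ext_of_lintegral _ fun H hH => ?_
  rw [lintegral_map hH (by fun_prop)]
  exact h.lintegral_nu α β hα hβ hab H hH

/-- size functional -/
noncomputable def szF (T : E → E) (x : E) : ℝ := ‖x‖ ^ 2 + ‖T x‖ ^ 2

theorem szF_nonneg (x : E) : 0 ≤ szF T x := by unfold szF; positivity

theorem GoodMap.zero (h : GoodMap T B δ Λ) : T 0 = 0 := by
  have := h.odd 0
  rw [neg_zero] at this
  have h2 : (2 : ℝ) • T 0 = 0 := by rw [two_smul]; exact eq_neg_iff_add_eq_zero.1 this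
  exact (smul_eq_zero.1 h2).resolve_left two_ne_zero

theorem GoodMap.inner_ge (h : GoodMap T B δ Λ) (x : E) : δ * ‖x‖ ^ 2 ≤ inner ℝ x (T x) := by
  have := h.mono x 0
  rw [h.zero, sub_zero, sub_zero, real_inner_comm] at this
  exact this

theorem GoodMap.norm_le (h : GoodMap T B δ Λ) (x : E) : ‖T x‖ ≤ Λ * ‖x‖ := by
  have := h.lip x 0
  rwa [h.zero, sub_zero, sub_zero] at this

theorem GoodMap.sz_le (h : GoodMap T B δ Λ) (x : E) : szF T x ≤ (1 + Λ ^ 2) * ‖x‖ ^ 2 := by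
  have h1 := pow_le_pow_left₀ (norm_nonneg _) (h.norm_le x) 2
  rw [mul_pow] at h1
  unfold szF; linarith

theorem GoodMap.sz_inner (h : GoodMap T B δ Λ) (x : E) :
    δ / (1 + Λ ^ 2) * szF T x ≤ inner ℝ x (T x) := by
  refine le_trans ?_ (h.inner_ge x)
  rw [div_mul_eq_mul_div, div_le_iff₀ (by positivity)]
  have := mul_le_mul_of_nonneg_left (h.sz_le x) h.hδ.le
  linarith

theorem inner_abs_le_sz (x : E) : |inner ℝ x (T x)| ≤ szF T x := by
  have h1 := abs_real_inner_le_norm x (T x)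
  have : 2 * (‖x‖ * ‖T x‖) ≤ ‖x‖ ^ 2 + ‖T x‖ ^ 2 := by nlinarith [sq_nonneg (‖x‖ - ‖T x‖)]
  have h3 := mul_nonneg (norm_nonneg x) (norm_nonneg (T x))
  unfold szF; linarith

theorem GoodMap.coer (h : GoodMap T B δ Λ) (x x' : E) :
    δ ^ 2 / (1 + Λ ^ 2) ^ 2 * (szF T x + szF T x') ≤ ‖x + x'‖ ^ 2 + ‖T x - T x'‖ ^ 2 := by
  have hδ := h.hδ
  set u := x + x' with hu
  set v := T x - T x' with hv
  have h1 : inner ℝ v x = inner ℝ x (T x) + inner ℝ x' (T x') - inner ℝ (T x') u := by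
    rw [hv, hu, inner_sub_left, inner_add_right, real_inner_comm x (T x), real_inner_comm x' (T x')]
    ring
  have h2 := h.inner_ge x
  have h3 := h.inner_ge x'
  have h4 : inner ℝ v x ≤ ‖v‖ * ‖x‖ := real_inner_le_norm _ _
  have h5 : inner ℝ (T x') u ≤ ‖T x'‖ * ‖u‖ := real_inner_le_norm _ _
  have h6 : ‖T x'‖ * ‖u‖ ≤ Λ * ‖x'‖ * ‖u‖ :=
    mul_le_mul_of_nonneg_right (h.norm_le x') (norm_nonneg _)
  have h7 : δ * (‖x‖ ^ 2 + ‖x'‖ ^ 2) ≤ ‖v‖ * ‖x‖ + Λ * ‖x'‖ * ‖u‖ := by linarith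
  have h8 : δ ^ 2 * (‖x‖ ^ 2 + ‖x'‖ ^ 2) ≤ ‖v‖ ^ 2 + Λ ^ 2 * ‖u‖ ^ 2 := by
    have := mul_le_mul_of_nonneg_left h7 hδ.le
    nlinarith [sq_nonneg (‖v‖ - δ * ‖x‖), sq_nonneg (Λ * ‖u‖ - δ * ‖x'‖)]
  have h9 := h.sz_le x
  have h10 := h.sz_le x'
  rw [div_mul_eq_mul_div, div_le_iff₀ (by positivity)]
  have h11 : δ ^ 2 * (szF T x + szF T x') ≤ δ ^ 2 * ((1 + Λ ^ 2) * (‖x‖ ^ 2 + ‖x'‖ ^ 2)) :=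
    mul_le_mul_of_nonneg_left (by linarith) (sq_nonneg _)
  have h12 : (1 + Λ ^ 2) * (δ ^ 2 * (‖x‖ ^ 2 + ‖x'‖ ^ 2))
      ≤ (1 + Λ ^ 2) * (‖v‖ ^ 2 + Λ ^ 2 * ‖u‖ ^ 2) :=
    mul_le_mul_of_nonneg_left h8 (by positivity)
  have h13 : (1 + Λ ^ 2) * (‖v‖ ^ 2 + Λ ^ 2 * ‖u‖ ^ 2)
      ≤ (1 + Λ ^ 2) * ((1 + Λ ^ 2) * (‖u‖ ^ 2 + ‖v‖ ^ 2)) := by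
    refine mul_le_mul_of_nonneg_left ?_ (by positivity)
    nlinarith [mul_nonneg (sq_nonneg Λ) (sq_nonneg ‖v‖), sq_nonneg ‖u‖]
  nlinarith

/-- The complex phase. -/
noncomputable def phs (T : E → E) (ε : ℝ) (ζ : ℂ) (p : E × E) : ℂ :=
  ζ * (Complex.I * (inner ℝ p.1 (T p.1) : ℝ) - ((ε * szF T p.1 : ℝ) : ℂ))
  - ζ⁻¹ * (Complex.I * (inner ℝ p.2 (T p.2) : ℝ) + ((ε * szF T p.2 : ℝ) : ℂ))
  + Complex.I * ((inner ℝ p.2 (T p.1) - inner ℝ p.1 (T p.2) : ℝ) : ℂ)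
  - ((2 * ε * (inner ℝ p.1 p.2 - inner ℝ (T p.1) (T p.2)) : ℝ) : ℂ)

/-- the real weight -/
noncomputable def wgt (ε : ℝ) (q : E × E) : ℂ :=
  Complex.exp (Complex.I * (inner ℝ q.1 q.2 : ℝ) - ((ε * (‖q.1‖ ^ 2 + ‖q.2‖ ^ 2) : ℝ) : ℂ))

theorem phs_real (ε : ℝ) (t : ℝ) (ht : 0 < t) (p : E × E) :
    Complex.exp (phs T ε ((t ^ 2 : ℝ) : ℂ) p)
      = wgt ε (t • p.1 + t⁻¹ • p.2, t • T p.1 - t⁻¹ • T p.2) := by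
  have htc : (t : ℂ) ≠ 0 := by exact_mod_cast ht.ne'
  have e1 : inner ℝ (t • p.1 + t⁻¹ • p.2) (t • T p.1 - t⁻¹ • T p.2)
      = t ^ 2 * inner ℝ p.1 (T p.1) - (t ^ 2)⁻¹ * inner ℝ p.2 (T p.2)
        + (inner ℝ p.2 (T p.1) - inner ℝ p.1 (T p.2)) := by
    simp only [inner_add_left, inner_sub_right, real_inner_smul_left, real_inner_smul_right]
    field_simp; ring
  have e2 : ‖t • p.1 + t⁻¹ • p.2‖ ^ 2 + ‖t • T p.1 - t⁻¹ • T p.2‖ ^ 2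
      = t ^ 2 * szF T p.1 + (t ^ 2)⁻¹ * szF T p.2
        + 2 * (inner ℝ p.1 p.2 - inner ℝ (T p.1) (T p.2)) := by
    rw [norm_add_sq_real, norm_sub_sq_real]
    simp only [norm_smul, real_inner_smul_left, real_inner_smul_right, szF, mul_pow,
      Real.norm_eq_abs, sq_abs]
    field_simp; ring
  unfold wgt phs
  simp only [e1, e2]
  congr 1
  push_cast
  field_simp
  ring

theorem phs_re_seg (h : GoodMap T B δ Λ) (ε : ℝ) (hε : 0 < ε) (hε2 : ε ≤ δ / (1 + Λ ^ 2))
    (τ : ℝ) (h0 : 0 ≤ τ) (h1 : τ ≤ 1) (p : E × E) :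
    (phs T ε ((1 - τ : ℝ) + (τ : ℝ) * Complex.I) p).re
      ≤ -(ε * (δ ^ 2 / (1 + Λ ^ 2) ^ 2)) * (szF T p.1 + szF T p.2) := by
  have hc := h.coer p.1 p.2
  have ha : ε * szF T p.1 ≤ inner ℝ p.1 (T p.1) :=
    (mul_le_mul_of_nonneg_right hε2 (szF_nonneg _)).trans (h.sz_inner _)
  have hb : ε * szF T p.2 ≤ inner ℝ p.2 (T p.2) :=
    (mul_le_mul_of_nonneg_right hε2 (szF_nonneg _)).trans (h.sz_inner _)
  have hP' := szF_nonneg (T := T) p.2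
  have e2 : ‖p.1 + p.2‖ ^ 2 + ‖T p.1 - T p.2‖ ^ 2
      = szF T p.1 + szF T p.2 + 2 * (inner ℝ p.1 p.2 - inner ℝ (T p.1) (T p.2)) := by
    rw [norm_add_sq_real, norm_sub_sq_real]
    simp only [szF]; ring
  set m := (1 - τ) ^ 2 + τ ^ 2 with hm
  have hmpos : 0 < m := by nlinarith [sq_nonneg (2 * τ - 1)]
  have hre : (phs T ε ((1 - τ : ℝ) + (τ : ℝ) * Complex.I) p).re
      = - τ * inner ℝ p.1 (T p.1) - (1 - τ) * (ε * szF T p.1)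
        - (τ / m * inner ℝ p.2 (T p.2) + (1 - τ) / m * (ε * szF T p.2))
        - 2 * ε * (inner ℝ p.1 p.2 - inner ℝ (T p.1) (T p.2)) := by
    unfold phs
    have hn : Complex.normSq ((1 - τ : ℝ) + (τ : ℝ) * Complex.I) = m := by
      rw [Complex.normSq_apply]; simp [hm]; ring
    simp only [Complex.sub_re, Complex.add_re, Complex.mul_re, Complex.inv_re, Complex.inv_im, hn,
      Complex.ofReal_re, Complex.ofReal_im, Complex.I_re, Complex.I_im, Complex.sub_im,
      Complex.add_im, Complex.mul_im]
    ring
  rw [hre]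
  have k1 : τ * (ε * szF T p.1) ≤ τ * inner ℝ p.1 (T p.1) := mul_le_mul_of_nonneg_left ha h0
  have k2 : τ / m * (ε * szF T p.2) ≤ τ / m * inner ℝ p.2 (T p.2) :=
    mul_le_mul_of_nonneg_left hb (by positivity)
  have k3 : ε * szF T p.2 ≤ τ / m * (ε * szF T p.2) + (1 - τ) / m * (ε * szF T p.2) := by
    have : 1 ≤ τ / m + (1 - τ) / m := by
      rw [← add_div, le_div_iff₀ hmpos]; nlinarith
    have h3 := mul_le_mul_of_nonneg_right this (mul_nonneg hε.le hP')
    linarith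
  have k4 := mul_le_mul_of_nonneg_left hc hε.le
  rw [e2] at k4
  linarith

theorem phs_diff (ε : ℝ) (hε : 0 < ε) (hε1 : ε ≤ 1) (ζ ζ' : ℂ) (h1 : 1 / 2 ≤ ‖ζ‖)
    (h2 : 1 / 2 ≤ ‖ζ'‖) (p : E × E) :
    ‖phs T ε ζ p - phs T ε ζ' p‖ ≤ 8 * ‖ζ - ζ'‖ * (szF T p.1 + szF T p.2) := by
  have hz : ζ ≠ 0 := by rintro rfl; norm_num at h1
  have hz' : ζ' ≠ 0 := by rintro rfl; norm_num at h2
  have hA := szF_nonneg (T := T) p.1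
  have hB := szF_nonneg (T := T) p.2
  have e : phs T ε ζ p - phs T ε ζ' p
      = (ζ - ζ') * (Complex.I * (inner ℝ p.1 (T p.1) : ℝ) - ((ε * szF T p.1 : ℝ) : ℂ))
      + (ζ - ζ') * (ζ⁻¹ * ζ'⁻¹) *
        (Complex.I * (inner ℝ p.2 (T p.2) : ℝ) + ((ε * szF T p.2 : ℝ) : ℂ)) := by
    have : ζ⁻¹ - ζ'⁻¹ = -((ζ - ζ') * (ζ⁻¹ * ζ'⁻¹)) := by field_simp; ring
    unfold phs
    linear_combination (-(Complex.I * (inner ℝ p.2 (T p.2) : ℝ) + ((ε * szF T p.2 : ℝ) : ℂ))) * this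
  have n1 : ‖Complex.I * (inner ℝ p.1 (T p.1) : ℝ) - ((ε * szF T p.1 : ℝ) : ℂ)‖ ≤ 2 * szF T p.1 := by
    refine (norm_sub_le _ _).trans ?_
    rw [norm_mul, Complex.norm_I, one_mul, Complex.norm_real, Complex.norm_real, Real.norm_eq_abs,
      Real.norm_eq_abs, abs_of_nonneg (mul_nonneg hε.le hA)]
    have := inner_abs_le_sz (T := T) p.1
    nlinarith
  have n2 : ‖Complex.I * (inner ℝ p.2 (T p.2) : ℝ) + ((ε * szF T p.2 : ℝ) : ℂ)‖ ≤ 2 * szF T p.2 := by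
    refine (norm_add_le _ _).trans ?_
    rw [norm_mul, Complex.norm_I, one_mul, Complex.norm_real, Complex.norm_real, Real.norm_eq_abs,
      Real.norm_eq_abs, abs_of_nonneg (mul_nonneg hε.le hB)]
    have := inner_abs_le_sz (T := T) p.2
    nlinarith
  have i1 : ‖ζ⁻¹ * ζ'⁻¹‖ ≤ 4 := by
    rw [norm_mul, norm_inv, norm_inv]
    have a1 : ‖ζ‖⁻¹ ≤ 2 := by
      rw [inv_le_comm₀ (by linarith) (by norm_num)]; linarith
    have a2 : ‖ζ'‖⁻¹ ≤ 2 := by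
      rw [inv_le_comm₀ (by linarith) (by norm_num)]; linarith
    calc ‖ζ‖⁻¹ * ‖ζ'‖⁻¹ ≤ 2 * 2 := mul_le_mul a1 a2 (by positivity) (by norm_num)
      _ = 4 := by norm_num
  rw [e]
  refine (norm_add_le _ _).trans ?_
  rw [norm_mul, norm_mul, norm_mul]
  have j1 : ‖ζ - ζ'‖ * ‖Complex.I * (inner ℝ p.1 (T p.1) : ℝ) - ((ε * szF T p.1 : ℝ) : ℂ)‖
     ≤ ‖ζ - ζ'‖ * (2 * szF T p.1) := mul_le_mul_of_nonneg_left n1 (norm_nonneg _)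
  have j2 : ‖ζ - ζ'‖ * ‖ζ⁻¹ * ζ'⁻¹‖ * ‖Complex.I * (inner ℝ p.2 (T p.2) : ℝ) + ((ε * szF T p.2 : ℝ) : ℂ)‖
     ≤ ‖ζ - ζ'‖ * 4 * (2 * szF T p.2) :=
    mul_le_mul (mul_le_mul_of_nonneg_left i1 (norm_nonneg _)) n2 (norm_nonneg _) (by positivity)
  have j3 := mul_nonneg (norm_nonneg (ζ - ζ')) hA
  linarith

end BM2
end MEll

set_option linter.unusedSectionVars false

namespace MEll

section BM3
variable {E : Type*} [NormedAddCommGroup E] [InnerProductSpace ℝ E] [FiniteDimensional ℝ E]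
  [MeasurableSpace E] [BorelSpace E]
variable {T : E → E} {B : E → E →L[ℝ] E} {δ Λ : ℝ}

theorem integrable_gauss (c : ℝ) (hc : 0 < c) :
    Integrable (fun x : E => Real.exp (-c * ‖x‖ ^ 2)) := by
  have h := GaussianFourier.integrable_cexp_neg_mul_sq_norm_add (V := E) (b := (c : ℂ))
    (by simpa using hc) 0 0
  have h2 := h.norm
  refine h2.congr (Filter.Eventually.of_forall fun x => ?_)
  simp only [Complex.norm_exp]
  congr 1
  simp [← Complex.ofReal_pow]

theorem integrable_gauss2 (c : ℝ) (hc : 0 < c) :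
    Integrable (fun q : E × E => Real.exp (-c * (‖q.1‖ ^ 2 + ‖q.2‖ ^ 2))) := by
  have h := (integrable_gauss (E := E) c hc).mul_prod (integrable_gauss (E := E) c hc)
  rw [Measure.volume_eq_prod]
  refine h.congr (Filter.Eventually.of_forall fun x => ?_)
  simp only [← Real.exp_add]
  congr 1; ring

theorem GoodMap.integrable_sz (h : GoodMap T B δ Λ) (c : ℝ) (hc : 0 < c) :
    Integrable (fun p : E × E => Real.exp (-c * (szF T p.1 + szF T p.2))) (nuM B) := by
  have hTm : Measurable T := h.cont.measurable
  have hTc := h.cont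
  have hm := h.map_nu 1 1 one_pos one_pos (one_mul 1)
  have h1 := integrable_gauss2 (E := E) (c / 2) (by positivity)
  rw [← hm] at h1
  have h2 := (integrable_map_measure h1.aestronglyMeasurable (by fun_prop)).1 h1
  refine h2.mono (by unfold szF; fun_prop) (Filter.Eventually.of_forall fun p => ?_)
  simp only [Function.comp, Real.norm_eq_abs, abs_of_pos (Real.exp_pos _), one_smul]
  apply Real.exp_le_exp.2
  have a1 : ‖p.1 + p.2‖ ^ 2 ≤ 2 * (‖p.1‖ ^ 2 + ‖p.2‖ ^ 2) := by
    have := parallelogram_law_with_norm ℝ p.1 p.2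
    nlinarith [sq_nonneg ‖p.1 - p.2‖]
  have a2 : ‖T p.1 - T p.2‖ ^ 2 ≤ 2 * (‖T p.1‖ ^ 2 + ‖T p.2‖ ^ 2) := by
    have := parallelogram_law_with_norm ℝ (T p.1) (T p.2)
    nlinarith [sq_nonneg ‖T p.1 + T p.2‖]
  have a3 : ‖p.1 + p.2‖ ^ 2 + ‖T p.1 - T p.2‖ ^ 2 ≤ 2 * (szF T p.1 + szF T p.2) := by
    unfold szF; linarith
  have := mul_le_mul_of_nonneg_left a3 (by positivity : 0 ≤ c / 2)
  linarith

theorem phs_cont (hT : Continuous T) (ε : ℝ) (ζ : ℂ) : Continuous (phs T ε ζ) := by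
  unfold phs szF; fun_prop

theorem continuation (h : GoodMap T B δ Λ) (ε : ℝ) (hε : 0 < ε) (hε1 : ε ≤ 1)
    (hε2 : ε ≤ δ / (1 + Λ ^ 2)) :
    ∫ p, Complex.exp (phs T ε Complex.I p) ∂(nuM B) = ∫ q : E × E, wgt ε q := by
  have hTc := h.cont
  have hTm : Measurable T := h.cont.measurable
  have hδ := h.hδ
  set c0 := ε * (δ ^ 2 / (1 + Λ ^ 2) ^ 2) with hc0
  have hc0pos : 0 < c0 := by positivity
  set η := min (1 / 5) (c0 / 16) with hη
  have hηpos : 0 < η := by positivity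
  have hη1 : η ≤ 1 / 5 := min_le_left _ _
  have hη2 : η ≤ c0 / 16 := min_le_right _ _
  set seg : Set ℂ := segment ℝ 1 Complex.I with hseg
  set U : Set ℂ := Metric.thickening η seg with hU
  have hUopen : IsOpen U := Metric.isOpen_thickening
  have hUconv : Convex ℝ U := (convex_segment _ _).thickening _
  have hsegU : seg ⊆ U := Metric.self_subset_thickening hηpos _
  -- points of the segment
  have hsegpt : ∀ z ∈ seg, ∃ τ : ℝ, 0 ≤ τ ∧ τ ≤ 1 ∧ z = (1 - τ : ℝ) + (τ : ℝ) * Complex.I := by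
    rintro z ⟨a, b, ha, hb, hab, rfl⟩
    refine ⟨b, hb, by linarith, ?_⟩
    rw [← hab]; simp
  have hU1 : ∀ ζ ∈ U, 1 / 2 ≤ ‖ζ‖ ∧ ∀ p : E × E,
      (phs T ε ζ p).re ≤ -(c0 / 2) * (szF T p.1 + szF T p.2) := by
    intro ζ hζ
    obtain ⟨z, hz, hd⟩ := Metric.mem_thickening_iff.1 hζ
    obtain ⟨τ, h0, h1, rfl⟩ := hsegpt z hz
    rw [dist_eq_norm] at hd
    have hzn : 7 / 10 ≤ ‖((1 - τ : ℝ) + (τ : ℝ) * Complex.I : ℂ)‖ := by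
      have e1 : ‖((1 - τ : ℝ) + (τ : ℝ) * Complex.I : ℂ)‖ ^ 2 = (1 - τ) ^ 2 + τ ^ 2 := by
        rw [← Complex.normSq_eq_norm_sq, Complex.normSq_add_mul_I]
      by_contra hc
      push Not at hc
      have := pow_lt_pow_left₀ hc (norm_nonneg _) two_ne_zero
      nlinarith [sq_nonneg (2 * τ - 1)]
    have hzn2 : 1 / 2 ≤ ‖ζ‖ := by
      have := norm_sub_norm_le ((1 - τ : ℝ) + (τ : ℝ) * Complex.I : ℂ) ζ
      rw [norm_sub_rev] at this
      linarith
    refine ⟨hzn2, fun p => ?_⟩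
    have k1 := phs_re_seg h ε hε hε2 τ h0 h1 p
    have k2 := phs_diff (T := T) ε hε hε1 ζ
      ((1 - τ : ℝ) + (τ : ℝ) * Complex.I : ℂ) hzn2 (by linarith) p
    have k3 := (Complex.abs_re_le_norm _).trans k2
    rw [Complex.sub_re] at k3
    have k4 := (abs_le.1 k3).2
    have k5 : 0 ≤ szF T p.1 + szF T p.2 := add_nonneg (szF_nonneg _) (szF_nonneg _)
    have k6 : 8 * ‖ζ - ((1 - τ : ℝ) + (τ : ℝ) * Complex.I)‖ ≤ c0 / 2 := by linarith
    have k7 := mul_le_mul_of_nonneg_right k6 k5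
    linarith
  -- derivative
  let dph : ℂ → E × E → ℂ := fun ζ p =>
    (Complex.I * (inner ℝ p.1 (T p.1) : ℝ) - ((ε * szF T p.1 : ℝ) : ℂ))
    - (-(ζ ^ 2)⁻¹) * (Complex.I * (inner ℝ p.2 (T p.2) : ℝ) + ((ε * szF T p.2 : ℝ) : ℂ))
  have hdph : ∀ ζ : ℂ, ζ ≠ 0 → ∀ p, HasDerivAt (fun ζ => phs T ε ζ p) (dph ζ p) ζ := by
    intro ζ hζ p
    have d1 := (hasDerivAt_id ζ).mul_const
      (Complex.I * (inner ℝ p.1 (T p.1) : ℝ) - ((ε * szF T p.1 : ℝ) : ℂ))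
    have d2 := (hasDerivAt_inv hζ).mul_const
      (Complex.I * (inner ℝ p.2 (T p.2) : ℝ) + ((ε * szF T p.2 : ℝ) : ℂ))
    have d3 := ((d1.sub d2).add_const
      (Complex.I * ((inner ℝ p.2 (T p.1) - inner ℝ p.1 (T p.2) : ℝ) : ℂ))).sub_const
      ((2 * ε * (inner ℝ p.1 p.2 - inner ℝ (T p.1) (T p.2)) : ℝ) : ℂ)
    refine (d3.congr_deriv ?_)
    simp only [dph, one_mul]
  have hdbound : ∀ ζ ∈ U, ∀ p, ‖dph ζ p‖ ≤ 8 * (szF T p.1 + szF T p.2) := by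
    intro ζ hζ p
    have hn := (hU1 ζ hζ).1
    have hA := szF_nonneg (T := T) p.1
    have hB := szF_nonneg (T := T) p.2
    have n1 : ‖Complex.I * (inner ℝ p.1 (T p.1) : ℝ) - ((ε * szF T p.1 : ℝ) : ℂ)‖
        ≤ 2 * szF T p.1 := by
      refine (norm_sub_le _ _).trans ?_
      rw [norm_mul, Complex.norm_I, one_mul, Complex.norm_real, Complex.norm_real,
        Real.norm_eq_abs, Real.norm_eq_abs, abs_of_nonneg (mul_nonneg hε.le hA)]
      have := inner_abs_le_sz (T := T) p.1
      nlinarith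
    have n2 : ‖Complex.I * (inner ℝ p.2 (T p.2) : ℝ) + ((ε * szF T p.2 : ℝ) : ℂ)‖
        ≤ 2 * szF T p.2 := by
      refine (norm_add_le _ _).trans ?_
      rw [norm_mul, Complex.norm_I, one_mul, Complex.norm_real, Complex.norm_real,
        Real.norm_eq_abs, Real.norm_eq_abs, abs_of_nonneg (mul_nonneg hε.le hB)]
      have := inner_abs_le_sz (T := T) p.2
      nlinarith
    have i1 : ‖-(ζ ^ 2)⁻¹‖ ≤ 4 := by
      rw [norm_neg, norm_inv, norm_pow]
      rw [inv_le_comm₀ (by positivity) (by norm_num)]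
      nlinarith
    refine (norm_sub_le _ _).trans ?_
    rw [norm_mul]
    have j2 := mul_le_mul i1 n2 (norm_nonneg _) (by norm_num)
    linarith
  have hexpb : ∀ ζ ∈ U, ∀ p, ‖Complex.exp (phs T ε ζ p)‖
      ≤ Real.exp (-(c0 / 2) * (szF T p.1 + szF T p.2)) := by
    intro ζ hζ p
    rw [Complex.norm_exp]
    exact Real.exp_le_exp.2 ((hU1 ζ hζ).2 p)
  have hIntg : ∀ ζ ∈ U, Integrable (fun p => Complex.exp (phs T ε ζ p)) (nuM B) := by
    intro ζ hζ
    refine (h.integrable_sz (c0 / 2) (by positivity)).mono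
      ((Complex.continuous_exp.comp (phs_cont hTc ε ζ)).aestronglyMeasurable)
      (Filter.Eventually.of_forall fun p => ?_)
    rw [Real.norm_eq_abs, abs_of_pos (Real.exp_pos _)]
    exact hexpb ζ hζ p
  set J : ℂ → ℂ := fun ζ => ∫ p, Complex.exp (phs T ε ζ p) ∂(nuM B) with hJ
  have hJd : DifferentiableOn ℂ J U := by
    intro ζ hζ
    have hder : ∀ ξ ∈ U, ∀ p, HasDerivAt (fun ξ => Complex.exp (phs T ε ξ p))
        (Complex.exp (phs T ε ξ p) * dph ξ p) ξ := by
      intro ξ hξ p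
      have hne : ξ ≠ 0 := by
        rintro rfl
        have := (hU1 0 hξ).1
        norm_num at this
      exact (hdph ξ hne p).cexp
    have := hasDerivAt_integral_of_dominated_loc_of_deriv_le (μ := nuM B)
      (F := fun ξ p => Complex.exp (phs T ε ξ p)) (x₀ := ζ) (s := U)
      (bound := fun p => 32 / c0 * Real.exp (-(c0 / 4) * (szF T p.1 + szF T p.2)))
      (F' := fun ξ p => Complex.exp (phs T ε ξ p) * dph ξ p)
      (hUopen.mem_nhds hζ)
      (Filter.Eventually.of_forall fun ξ =>
        (Complex.continuous_exp.comp (phs_cont hTc ε ξ)).aestronglyMeasurable)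
      (hIntg ζ hζ)
      (by
        have : Continuous (dph ζ) := by simp only [dph]; unfold szF; fun_prop
        exact ((Complex.continuous_exp.comp (phs_cont hTc ε ζ)).mul this).aestronglyMeasurable)
      (Filter.Eventually.of_forall fun p ξ hξ => by
        rw [norm_mul]
        have b1 := hexpb ξ hξ p
        have b2 := hdbound ξ hξ p
        have k5 : 0 ≤ szF T p.1 + szF T p.2 := add_nonneg (szF_nonneg _) (szF_nonneg _)
        set Q := szF T p.1 + szF T p.2
        have b3 : 8 * Q ≤ 32 / c0 * Real.exp (c0 / 4 * Q) := by
          have := Real.add_one_le_exp (c0 / 4 * Q)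
          have e : 8 * Q = 32 / c0 * (c0 / 4 * Q) := by field_simp; ring
          rw [e]
          exact mul_le_mul_of_nonneg_left (by linarith) (by positivity)
        calc _ ≤ Real.exp (-(c0 / 2) * Q) * (32 / c0 * Real.exp (c0 / 4 * Q)) :=
              mul_le_mul b1 (b2.trans b3) (norm_nonneg _) (Real.exp_pos _).le
          _ = 32 / c0 * (Real.exp (-(c0 / 2) * Q) * Real.exp (c0 / 4 * Q)) := by ring
          _ = _ := by rw [← Real.exp_add]; congr 2; ring)
      ((h.integrable_sz (c0 / 4) (by positivity)).const_mul _)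
      (Filter.Eventually.of_forall fun p ξ hξ => hder ξ hξ p)
    exact this.2.differentiableAt.differentiableWithinAt
  have hJa : AnalyticOnNhd ℂ J U := hJd.analyticOnNhd hUopen
  have h1U : (1 : ℂ) ∈ U := hsegU (left_mem_segment ℝ _ _)
  have hIU : Complex.I ∈ U := hsegU (right_mem_segment ℝ _ _)
  have hJreal : ∀ t : ℝ, 0 < t → J ((t ^ 2 : ℝ) : ℂ) = ∫ q : E × E, wgt ε q := by
    intro t ht
    have hm := h.map_nu t t⁻¹ ht (by positivity) (mul_inv_cancel₀ ht.ne')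
    simp only [hJ, phs_real ε t ht]
    rw [← hm]
    rw [integral_map (by fun_prop)]
    refine Continuous.aestronglyMeasurable ?_
    unfold wgt; fun_prop
  have hfreq : ∃ᶠ z in nhdsWithin (1 : ℂ) {1}ᶜ, J z = (fun _ => ∫ q : E × E, wgt ε q) z := by
    have ht : Filter.Tendsto (fun k : ℕ => (((1 + 1 / ((k : ℝ) + 1)) ^ 2 : ℝ) : ℂ)) Filter.atTop
        (nhdsWithin (1 : ℂ) {1}ᶜ) := by
      refine tendsto_nhdsWithin_iff.2 ⟨?_, Filter.Eventually.of_forall fun k => ?_⟩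
      · have h1 : Filter.Tendsto (fun k : ℕ => ((1 + 1 / ((k : ℝ) + 1)) ^ 2 : ℝ)) Filter.atTop
            (nhds 1) := by
          have := (tendsto_one_div_add_atTop_nhds_zero_nat (𝕜 := ℝ)).const_add 1
          simpa using this.pow 2
        exact (Complex.continuous_ofReal.tendsto' 1 1 (by simp)).comp h1
      · simp only [Set.mem_compl_iff, Set.mem_singleton_iff]
        intro hc
        have hc' : ((1 + 1 / ((k : ℝ) + 1)) ^ 2 : ℝ) = 1 := by exact_mod_cast hc
        have : (0 : ℝ) < 1 / ((k : ℝ) + 1) := by positivity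
        nlinarith
    refine ht.frequently (Filter.Eventually.frequently (Filter.Eventually.of_forall fun k => ?_))
    exact hJreal _ (by positivity)
  exact hJa.eqOn_of_preconnected_of_frequently_eq analyticOnNhd_const hUconv.isPreconnected h1U
    hfreq hIU

theorem integral_wgt (ε : ℝ) (hε : 0 < ε) (hε1 : ε ≤ 1 / 2) :
    (4 : ℝ) ^ Module.finrank ℝ E ≤ ‖∫ q : E × E, wgt ε q‖ := by
  set n := Module.finrank ℝ E
  have hIntg : Integrable (fun q : E × E => wgt ε q) := by
    refine (integrable_gauss2 (E := E) ε hε).mono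
      (Continuous.aestronglyMeasurable (by unfold wgt; fun_prop))
      (Filter.Eventually.of_forall fun p => ?_)
    rw [Real.norm_eq_abs, abs_of_pos (Real.exp_pos _)]
    unfold wgt
    rw [Complex.norm_exp]
    refine Real.exp_le_exp.2 (le_of_eq ?_)
    simp [← Complex.ofReal_pow]
  rw [Measure.volume_eq_prod] at hIntg ⊢
  rw [integral_prod _ hIntg]
  have e1 : ∀ u : E, ∫ v : E, wgt ε (u, v)
      = (π / ε : ℂ) ^ (n / 2 : ℂ) * Complex.exp (-((ε + 1 / (4 * ε) : ℝ) : ℂ) * ‖u‖ ^ 2) := by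
    intro u
    have := GaussianFourier.integral_cexp_neg_mul_sq_norm_add (V := E) (b := (ε : ℂ))
      (by simpa using hε) Complex.I u
    have e2 : ∀ v : E, wgt ε (u, v) = Complex.exp (-(ε * ‖u‖ ^ 2 : ℂ))
       * Complex.exp (-(ε : ℂ) * ‖v‖ ^ 2 + Complex.I * (inner ℝ u v : ℝ)) := by
      intro v
      unfold wgt
      rw [← Complex.exp_add]
      congr 1
      push_cast; ring
    simp only [e2]
    rw [integral_const_mul, this, mul_left_comm, ← Complex.exp_add]
    congr 2
    have hε' : (ε : ℂ) ≠ 0 := by exact_mod_cast hε.ne'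
    push_cast
    rw [Complex.I_sq]
    field_simp
    ring
  simp only [e1]
  rw [integral_const_mul, GaussianFourier.integral_cexp_neg_mul_sq_norm
    (by rw [Complex.ofReal_re]; positivity), norm_mul]
  have hn : ∀ s : ℝ, 0 < s → ‖((s : ℂ)) ^ (n / 2 : ℂ)‖ = Real.sqrt s ^ n := by
    intro s hs
    rw [Complex.norm_cpow_eq_rpow_re_of_pos hs, Real.sqrt_eq_rpow, ← Real.rpow_natCast,
      ← Real.rpow_mul hs.le]
    congr 1
    have : ((n : ℂ) / 2) = (((n : ℝ) / 2 : ℝ) : ℂ) := by push_cast; rfl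
    rw [this, Complex.ofReal_re]; ring
  have f1 := hn (π / ε) (by positivity)
  have f2 := hn (π / (ε + 1 / (4 * ε))) (by positivity)
  push_cast at f1 f2 ⊢
  rw [f1, f2, ← mul_pow, ← Real.sqrt_mul (by positivity)]
  refine pow_le_pow_left₀ (by norm_num) ?_ _
  apply Real.le_sqrt_of_sq_le
  have e3 : π / ε * (π / (ε + 1 / (4 * ε))) = 4 * π ^ 2 / (4 * ε ^ 2 + 1) := by
    field_simp
  rw [e3, le_div_iff₀ (by positivity)]
  nlinarith [Real.pi_gt_three]

theorem bm_ineq (h : GoodMap T B δ Λ) (ε : ℝ) (hε : 0 < ε) (hε1 : ε ≤ 1 / 2)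
    (hε2 : ε ≤ δ / (1 + Λ ^ 2)) :
    ENNReal.ofReal ((4 : ℝ) ^ Module.finrank ℝ E) ≤
      ∫⁻ p : E × E, ENNReal.ofReal (Real.exp (-(inner ℝ p.1 (T p.1)) - inner ℝ p.2 (T p.2)
        - 2 * ε * (inner ℝ p.1 p.2 - inner ℝ (T p.1) (T p.2)))) ∂(nuM B) := by
  have h1 := continuation h ε hε (by linarith) hε2
  have h2 := integral_wgt (E := E) ε hε hε1
  rw [← h1] at h2
  refine (ENNReal.ofReal_le_ofReal h2).trans ?_
  rw [ofReal_norm_eq_enorm]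
  refine (enorm_integral_le_lintegral_enorm _).trans (lintegral_mono fun p => ?_)
  rw [← ofReal_norm_eq_enorm, Complex.norm_exp]
  refine ENNReal.ofReal_le_ofReal (Real.exp_le_exp.2 (le_of_eq ?_))
  unfold phs
  simp
  ring

end BM3
end MEll

set_option linter.unusedSectionVars false

namespace MEll

section LL
variable {E : Type*} [NormedAddCommGroup E] [InnerProductSpace ℝ E] [FiniteDimensional ℝ E]
  [MeasurableSpace E] [BorelSpace E]

/-- A symmetric convex body. -/
structure SymBody (K : Set E) : Prop where
  cpt : IsCompact K
  conv : Convex ℝ K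
  symm : ∀ x ∈ K, -x ∈ K
  pos : 0 < volume K

/-- tilted probability on `K` -/
noncomputable def tlt (K : Set E) (y : E) : Measure E :=
  (volume.restrict K).tilted (fun x => inner ℝ x y)

/-- Laplace transform -/
noncomputable def Zf (K : Set E) (y : E) : ℝ := ∫ x in K, exp (inner ℝ x y)

/-- log-Laplace transform -/
noncomputable def Ff (K : Set E) (y : E) : ℝ := Real.log (Zf K y / (volume K).toReal)

/-- barycenter of the tilted measure -/
noncomputable def bar (K : Set E) (y : E) : E := ∫ x, x ∂tlt K y

/-- covariance of the tilted measure -/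
noncomputable def cov (K : Set E) (y : E) : E →L[ℝ] E :=
  (∫ x, (innerSL ℝ x).smulRight x ∂tlt K y) - (innerSL ℝ (bar K y)).smulRight (bar K y)

variable {K : Set E}

namespace SymBody

theorem fin (h : SymBody K) : volume K ≠ ⊤ := h.cpt.measure_lt_top.ne

theorem volpos (h : SymBody K) : 0 < (volume K).toReal := ENNReal.toReal_pos h.pos.ne' h.fin

theorem ms (h : SymBody K) : MeasurableSet K := h.cpt.measurableSet

theorem intOn (h : SymBody K) {G : Type*} [NormedAddCommGroup G] {g : E → G} (hg : Continuous g) :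
    Integrable g (volume.restrict K) := hg.continuousOn.integrableOn_compact h.cpt

theorem intExp (h : SymBody K) (y : E) :
    Integrable (fun x => exp (inner ℝ x y)) (volume.restrict K) := h.intOn (by fun_prop)

theorem intT (h : SymBody K) {G : Type*} [NormedAddCommGroup G] [NormedSpace ℝ G] {g : E → G}
    (hg : Continuous g) (y : E) : Integrable g (tlt K y) := by
  rw [tlt, integrable_tilted_iff (h.intExp y)]
  exact h.intOn (by fun_prop)

theorem prob (h : SymBody K) (y : E) : IsProbabilityMeasure (tlt K y) := by
  have : NeZero (volume.restrict K) := ⟨by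
    rw [Ne, Measure.restrict_eq_zero]; exact h.pos.ne'⟩
  exact isProbabilityMeasure_tilted (h.intExp y)

theorem aeK (h : SymBody K) (y : E) : ∀ᵐ x ∂tlt K y, x ∈ K :=
  (tilted_absolutelyContinuous _ _).ae_le (ae_restrict_mem h.ms)

theorem Zpos (h : SymBody K) (y : E) : 0 < Zf K y := by
  have : NeZero (volume.restrict K) := ⟨by
    rw [Ne, Measure.restrict_eq_zero]; exact h.pos.ne'⟩
  exact integral_exp_pos (h.intExp y)

theorem bar_mem (h : SymBody K) (y : E) : bar K y ∈ K := by
  have := h.prob y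
  exact h.conv.integral_mem h.cpt.isClosed (h.aeK y) (h.intT continuous_id y)

theorem hasFDeriv (h : SymBody K) {G : Type*} [NormedAddCommGroup G] [NormedSpace ℝ G]
    {g : E → G} (hg : Continuous g) (y : E) :
    HasFDerivAt (fun y => ∫ x in K, exp (inner ℝ x y) • g x)
      (∫ x in K, exp (inner ℝ x y) • (innerSL ℝ x).smulRight (g x)) y := by
  refine hasFDerivAt_integral_of_dominated_of_fderiv_le (Metric.ball_mem_nhds y one_pos)
    (bound := fun x => exp (‖x‖ * (‖y‖ + 1)) * (‖x‖ * ‖g x‖))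
    (F' := fun y x => exp (inner ℝ x y) • (innerSL ℝ x).smulRight (g x))
    (Filter.Eventually.of_forall fun z => ?_) ?_ ?_ ?_ ?_ ?_
  · exact (h.intOn (g := fun x => exp (inner ℝ x z) • g x) (by fun_prop)).aestronglyMeasurable
  · exact h.intOn (by fun_prop)
  · refine (h.intOn (g := fun x => exp (inner ℝ x y) • (innerSL ℝ x).smulRight (g x))
      ?_).aestronglyMeasurable
    have hc : Continuous fun x : E => exp (inner ℝ x y) := by fun_prop
    exact hc.smul <| ((ContinuousLinearMap.smulRightL ℝ E G).continuous.comp (innerSL ℝ).continuous).clm_apply hg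
  · refine Filter.Eventually.of_forall fun x z hz => ?_
    rw [norm_smul, Real.norm_eq_abs, abs_of_pos (exp_pos _), ContinuousLinearMap.norm_smulRight_apply,
      innerSL_apply_norm]
    refine mul_le_mul_of_nonneg_right (exp_le_exp.2 ?_) (by positivity)
    refine (real_inner_le_norm _ _).trans (mul_le_mul_of_nonneg_left ?_ (norm_nonneg _))
    have := norm_sub_norm_le z y
    rw [Metric.mem_ball, dist_eq_norm] at hz
    linarith
  · exact h.intOn (by fun_prop)
  · refine Filter.Eventually.of_forall fun x z hz => ?_
    have h1 : HasFDerivAt (fun z : E => inner ℝ x z) (innerSL ℝ x) z := (innerSL ℝ x).hasFDerivAt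
    convert! h1.exp.smul_const (g x) using 1
    ext w
    simp [smul_smul]

theorem cont_rank1 : Continuous (fun x : E => (innerSL ℝ x).smulRight x) :=
  ((ContinuousLinearMap.smulRightL ℝ E E).continuous.comp (innerSL ℝ).continuous).clm_apply
    continuous_id

theorem bar_eq (y : E) : bar K y = (Zf K y)⁻¹ • ∫ x in K, exp (inner ℝ x y) • x := by
  rw [bar, tlt, integral_tilted, ← integral_smul]
  congr 1
  ext1 x
  rw [smul_smul]
  congr 1
  change _ / Zf K y = _
  rw [div_eq_inv_mul]

theorem hasDeriv_bar (h : SymBody K) (y : E) : HasFDerivAt (bar K) (cov K y) y := by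
  have h1 := h.hasFDeriv (g := fun x => x) continuous_id y
  have h2 := h.hasFDeriv (g := fun _ => (1 : ℝ)) continuous_const y
  have hZ : (fun y => ∫ x in K, exp (inner ℝ x y) • (1 : ℝ)) = Zf K := by
    ext y; simp [Zf]
  rw [hZ] at h2
  have h3 := ((hasDerivAt_inv (h.Zpos y).ne').comp_hasFDerivAt y h2).smul h1
  have hb : bar K = fun y => (Zf K y)⁻¹ • ∫ x in K, exp (inner ℝ x y) • x := by
    ext1 y; exact bar_eq y
  rw [hb]
  refine h3.congr_fderiv ?_
  have e1 : ∫ x, (innerSL ℝ x).smulRight x ∂tlt K y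
      = (Zf K y)⁻¹ • ∫ x in K, exp (inner ℝ x y) • (innerSL ℝ x).smulRight x := by
    rw [tlt, integral_tilted, ← integral_smul]
    congr 1
    ext1 x
    rw [smul_smul]
    congr 1
    change _ / Zf K y = _
    rw [div_eq_inv_mul]
  have e2 : ∀ w, (∫ x in K, exp (inner ℝ x y) • (innerSL ℝ x).smulRight (1 : ℝ)) w
      = Zf K y * inner ℝ (bar K y) w := by
    intro w
    rw [ContinuousLinearMap.integral_apply, bar_eq, inner_smul_left, real_inner_comm,
      ← integral_inner, conj_trivial, mul_inv_cancel_left₀ (h.Zpos y).ne']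
    · refine integral_congr_ae (Filter.Eventually.of_forall fun x => ?_)
      simp [inner_smul_right, real_inner_comm]
    · exact h.intOn (by fun_prop)
    · have hc : Continuous fun x : E => exp (inner ℝ x y) := by fun_prop
      exact h.intOn <| hc.smul <| ((ContinuousLinearMap.smulRightL ℝ E ℝ).continuous.comp
        (innerSL ℝ).continuous).clm_apply continuous_const
  rw [cov, e1]
  ext w
  have hz := (h.Zpos y).ne'
  simp only [_root_.add_apply, _root_.sub_apply,
    _root_.smul_apply, ContinuousLinearMap.smulRight_apply, innerSL_apply_apply,
    e2]
  rw [sub_eq_add_neg]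
  congr 1
  have : bar K y = (Zf K y)⁻¹ • ∫ x in K, exp (inner ℝ x y) • x := bar_eq y
  rw [← neg_smul]
  nth_rewrite 3 [this]
  rw [smul_smul]
  congr 1
  simp
  field_simp

theorem inner_bar (h : SymBody K) (y w : E) :
    inner ℝ (bar K y) w = ∫ x, inner ℝ x w ∂tlt K y := by
  rw [bar, real_inner_comm, ← integral_inner (h.intT (g := fun x => x) continuous_id y)]
  simp [real_inner_comm]

theorem inner_cov (h : SymBody K) (y v w : E) :
    inner ℝ (cov K y v) w = ∫ x, inner ℝ (x - bar K y) v * inner ℝ (x - bar K y) w ∂tlt K y := by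
  have := h.prob y
  have e1 : inner ℝ (cov K y v) w = (∫ x, inner ℝ x v * inner ℝ x w ∂tlt K y)
      - inner ℝ (bar K y) v * inner ℝ (bar K y) w := by
    rw [cov, _root_.sub_apply, inner_sub_left,
      ContinuousLinearMap.integral_apply (h.intT cont_rank1 y), real_inner_comm,
      ← integral_inner]
    · simp [inner_smul_left, inner_smul_right, real_inner_comm]
    · exact h.intT (by simpa using cont_rank1.clm_apply continuous_const) y
  have e2 : ∀ x, inner ℝ (x - bar K y) v * inner ℝ (x - bar K y) w
      = inner ℝ x v * inner ℝ x w - inner ℝ (bar K y) v * inner ℝ x w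
        - inner ℝ (bar K y) w * inner ℝ x v + inner ℝ (bar K y) v * inner ℝ (bar K y) w := by
    intro x; simp only [inner_sub_left]; ring
  simp only [e2]
  rw [integral_add, integral_sub, integral_sub, integral_const_mul, integral_const_mul,
    ← h.inner_bar, ← h.inner_bar, e1]
  · simp; ring
  all_goals exact h.intT (by fun_prop) y

theorem cov_symm (h : SymBody K) (y v w : E) :
    inner ℝ (cov K y v) w = inner ℝ v (cov K y w) := by
  rw [real_inner_comm _ v, h.inner_cov, h.inner_cov]
  simp only [mul_comm]

theorem cov_pos (h : SymBody K) (y w : E) (hw : w ≠ 0) : 0 < inner ℝ (cov K y w) w := by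
  rw [h.inner_cov]
  have hnn : 0 ≤ ∫ x, inner ℝ (x - bar K y) w * inner ℝ (x - bar K y) w ∂tlt K y :=
    integral_nonneg fun x => mul_self_nonneg _
  refine hnn.lt_of_ne fun h0 => ?_
  have h1 := (integral_eq_zero_iff_of_nonneg (fun x => mul_self_nonneg _)
    (h.intT (g := fun x => inner ℝ (x - bar K y) w * inner ℝ (x - bar K y) w)
      (by fun_prop) y)).1 h0.symm
  have h2 := (absolutelyContinuous_tilted (h.intExp y)).ae_le h1
  let S : AffineSubspace ℝ E := AffineSubspace.mk' (bar K y) (LinearMap.ker (innerSL ℝ w).toLinearMap)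
  have hS : volume (S : Set E) = 0 := by
    refine Measure.addHaar_affineSubspace volume S fun ht => hw ?_
    have : w + bar K y ∈ S := by rw [ht]; trivial
    rw [AffineSubspace.mem_mk'] at this
    simpa using this
  have h3 : volume.restrict K (S : Set E)ᶜ = 0 := by
    rw [← mem_ae_iff]
    filter_upwards [h2] with x hx
    have : inner ℝ (x - bar K y) w = 0 := by simpa using hx
    change x ∈ S
    rw [AffineSubspace.mem_mk']
    simpa [real_inner_comm] using this
  have h4 : volume.restrict K Set.univ = 0 := by
    refine le_antisymm ?_ zero_le
    calc volume.restrict K Set.univ ≤ volume.restrict K (S : Set E) + volume.restrict K (S : Set E)ᶜ := by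
          rw [← Set.union_compl_self (S : Set E)]; exact measure_union_le _ _
      _ ≤ 0 := by rw [h3, add_zero, ← hS]; exact Measure.restrict_apply_le _ _
  rw [Measure.restrict_apply_univ] at h4
  exact h.pos.ne' h4

theorem bdd (h : SymBody K) : ∃ R, 0 < R ∧ ∀ x ∈ K, ‖x‖ ≤ R := by
  obtain ⟨R, hR⟩ := h.cpt.isBounded.exists_norm_le
  exact ⟨max R 1, by positivity, fun x hx => (hR x hx).trans (le_max_left _ _)⟩

theorem bar_lip (h : SymBody K) {R : ℝ} (hR : ∀ x ∈ K, ‖x‖ ≤ R) (x y : E) :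
    ‖bar K x - bar K y‖ ≤ (2 * R ^ 2) * ‖x - y‖ := by
  refine convex_univ.norm_image_sub_le_of_norm_hasFDerivWithin_le
    (fun z _ => (h.hasDeriv_bar z).hasFDerivWithinAt) (fun z _ => ?_) trivial trivial
  have := h.prob z
  rw [cov]
  refine (norm_sub_le _ _).trans ?_
  have h1 : ‖(innerSL ℝ (bar K z)).smulRight (bar K z)‖ ≤ R ^ 2 := by
    rw [ContinuousLinearMap.norm_smulRight_apply, innerSL_apply_norm, ← sq]
    exact pow_le_pow_left₀ (norm_nonneg _) (hR _ (h.bar_mem z)) 2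
  have h2 : ‖∫ x, (innerSL ℝ x).smulRight x ∂tlt K z‖ ≤ R ^ 2 := by
    have := norm_integral_le_of_norm_le_const (μ := tlt K z)
      (f := fun x => (innerSL ℝ x).smulRight x) (C := R ^ 2) (by
        filter_upwards [h.aeK z] with x hx
        rw [ContinuousLinearMap.norm_smulRight_apply, innerSL_apply_norm, ← sq]
        exact pow_le_pow_left₀ (norm_nonneg _) (hR _ hx) 2)
    simpa using this
  linarith

theorem bar_smono (h : SymBody K) (x y : E) (hxy : x ≠ y) :
    0 < inner ℝ (bar K x - bar K y) (x - y) := by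
  have hd : ∀ t : ℝ, HasDerivAt (fun t : ℝ => inner ℝ (bar K (y + t • (x - y))) (x - y))
      (inner ℝ (cov K (y + t • (x - y)) (x - y)) (x - y)) t := by
    intro t
    have h1 : HasDerivAt (fun t : ℝ => y + t • (x - y)) (x - y) t := by
      simpa using ((hasDerivAt_id t).smul_const (x - y)).const_add y
    have h2 := (h.hasDeriv_bar (y + t • (x - y))).comp_hasDerivAt t h1
    simpa using h2.inner ℝ (hasDerivAt_const t (x - y))
  have hm : StrictMono (fun t : ℝ => inner ℝ (bar K (y + t • (x - y))) (x - y)) :=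
    strictMono_of_deriv_pos fun t => by
      rw [(hd t).deriv]; exact h.cov_pos _ _ (sub_ne_zero.2 hxy)
  have := hm (zero_lt_one' ℝ)
  simp only [zero_smul, add_zero, one_smul, add_sub_cancel] at this
  rw [inner_sub_left]; linarith

theorem bar_mono (h : SymBody K) (x y : E) :
    0 ≤ inner ℝ (bar K x - bar K y) (x - y) := by
  by_cases hxy : x = y
  · simp [hxy]
  · exact (h.bar_smono x y hxy).le

theorem bar_inj (h : SymBody K) : Function.Injective (bar K) := by
  intro x y hxy
  by_contra hc
  have := h.bar_smono x y hc
  rw [hxy] at this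
  simp at this

theorem neg_eq (h : SymBody K) : -K = K := by
  ext x
  constructor
  · intro hx; simpa using h.symm _ hx
  · intro hx; exact h.symm _ hx

theorem int_neg (h : SymBody K) {G : Type*} [NormedAddCommGroup G] [NormedSpace ℝ G] (g : E → G) :
    ∫ x in K, g (-x) = ∫ x in K, g x := by
  have hp : MeasurePreserving (fun x : E => -x) volume volume := Measure.measurePreserving_neg _
  have := hp.setIntegral_preimage_emb (MeasurableEquiv.neg E).measurableEmbedding g K
  rw [← this]
  congr 2
  exact h.neg_eq.symm

theorem Z_even (h : SymBody K) (y : E) : Zf K (-y) = Zf K y := by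
  rw [Zf, Zf, ← h.int_neg]
  simp

theorem F_even (h : SymBody K) (y : E) : Ff K (-y) = Ff K y := by
  rw [Ff, Ff, h.Z_even]

theorem bar_odd (h : SymBody K) (y : E) : bar K (-y) = - bar K y := by
  rw [bar_eq, bar_eq, h.Z_even, ← h.int_neg, ← smul_neg, ← integral_neg]
  simp

theorem bar_zero (h : SymBody K) : bar K 0 = 0 := by
  have := h.bar_odd 0
  rw [neg_zero] at this
  have h2 : (2 : ℝ) • bar K 0 = 0 := by
    rw [two_smul]; nth_rewrite 1 [this]; simp
  simpa using h2

theorem F_zero (h : SymBody K) : Ff K 0 = 0 := by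
  simp [Ff, Zf, Measure.real, h.volpos.ne']

theorem exp_F (h : SymBody K) (y : E) : exp (Ff K y) = Zf K y / (volume K).toReal := by
  rw [Ff, exp_log (div_pos (h.Zpos y) h.volpos)]

theorem F_diff (h : SymBody K) (x y : E) :
    exp (Ff K y - Ff K x) = ∫ z, exp (inner ℝ z (y - x)) ∂tlt K x := by
  rw [tlt, integral_exp_tilted, exp_sub, h.exp_F, h.exp_F, div_div_div_cancel_right₀ h.volpos.ne']
  congr 1
  simp [Zf, inner_sub_right]

theorem F_sub (h : SymBody K) (x y : E) :
    Ff K x + inner ℝ (bar K x) (y - x) ≤ Ff K y := by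
  have := h.prob x
  suffices hs : exp (inner ℝ (bar K x) (y - x)) ≤ exp (Ff K y - Ff K x) by
    have := exp_le_exp.1 hs; linarith
  rw [h.F_diff]
  set m := inner ℝ (bar K x) (y - x) with hm
  have h1 : ∫ z, (exp m * (1 - m) + exp m * inner ℝ z (y - x)) ∂tlt K x = exp m := by
    rw [integral_add, integral_const_mul (exp m) (fun z => inner ℝ z (y - x)), ← h.inner_bar, ← hm]
    · simp; ring
    all_goals exact h.intT (by fun_prop) x
  rw [← h1]
  refine integral_mono (h.intT (by fun_prop) x) (h.intT (by fun_prop) x) fun z => ?_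
  have := add_one_le_exp (inner ℝ z (y - x) - m)
  have h3 : exp (inner ℝ z (y - x)) = exp m * exp (inner ℝ z (y - x) - m) := by
    rw [← exp_add]; congr 1; ring
  change _ ≤ exp (inner ℝ z (y - x))
  rw [h3]
  nlinarith [exp_pos m]

theorem F_le (h : SymBody K) (x : E) : Ff K x ≤ inner ℝ x (bar K x) := by
  have := h.F_sub x 0
  rw [h.F_zero, zero_sub, inner_neg_right, real_inner_comm] at this
  linarith

theorem F_nonneg (h : SymBody K) (x : E) : 0 ≤ Ff K x := by
  have := h.F_sub 0 x
  rw [h.F_zero, h.bar_zero] at this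
  simpa using this

theorem F_mid (h : SymBody K) (x y : E) :
    2 * Ff K ((1 / 2 : ℝ) • (x + y)) ≤ Ff K x + Ff K y := by
  have h1 := h.F_sub ((1 / 2 : ℝ) • (x + y)) x
  have h2 := h.F_sub ((1 / 2 : ℝ) • (x + y)) y
  have : y - (1 / 2 : ℝ) • (x + y) = - (x - (1 / 2 : ℝ) • (x + y)) := by module
  rw [this, inner_neg_right] at h2
  linarith

theorem F_cont (h : SymBody K) : Continuous (Ff K) := by
  have h2 : Continuous (Zf K) := by
    have : Zf K = fun y => ∫ x in K, exp (inner ℝ x y) • (1 : ℝ) := by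
      ext y; simp [Zf]
    rw [this]
    exact continuous_iff_continuousAt.2 fun y =>
      (h.hasFDeriv (g := fun _ => (1 : ℝ)) continuous_const y).continuousAt
  exact (h2.div_const _).log fun y => (div_pos (h.Zpos y) h.volpos).ne'

end SymBody
end LL
end MEll

set_option linter.unusedSectionVars false

namespace MEll

section P2
variable {E : Type*} [NormedAddCommGroup E] [InnerProductSpace ℝ E] [FiniteDimensional ℝ E]
  [MeasurableSpace E] [BorelSpace E]

theorem lintegral_smul_half (g : E → ENNReal) (hg : Measurable g) :
    ∫⁻ x, g ((1 / 2 : ℝ) • x) = ENNReal.ofReal (2 ^ Module.finrank ℝ E) * ∫⁻ x, g x := by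
  have h := Measure.map_addHaar_smul (volume : Measure E) (r := (1 / 2 : ℝ)) (by norm_num)
  rw [← lintegral_map (f := g) (g := fun x => (1 / 2 : ℝ) • x) hg (by fun_prop), h,
    lintegral_smul_measure, smul_eq_mul]
  congr 2
  rw [abs_of_pos (by positivity)]
  simp

variable {K : Set E}

namespace SymBody

theorem goodMap (h : SymBody K) {R : ℝ} (hR : ∀ x ∈ K, ‖x‖ ≤ R) {δ : ℝ} (hδ : 0 < δ) :
    GoodMap (fun x => bar K x + δ • x) (fun x => cov K x + δ • ContinuousLinearMap.id ℝ E) δ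
      (2 * R ^ 2 + δ) where
  hδ := hδ
  deriv x := (h.hasDeriv_bar x).add ((hasFDerivAt_id x).const_smul δ)
  mono x y := by
    have e : bar K x + δ • x - (bar K y + δ • y) = (bar K x - bar K y) + δ • (x - y) := by module
    rw [e, inner_add_left, real_inner_smul_left, real_inner_self_eq_norm_sq]
    have := h.bar_mono x y
    linarith
  lip x y := by
    have e : bar K x + δ • x - (bar K y + δ • y) = (bar K x - bar K y) + δ • (x - y) := by module
    rw [e]
    refine (norm_add_le _ _).trans ?_
    rw [norm_smul, Real.norm_eq_abs, abs_of_pos hδ, add_mul]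
    have := h.bar_lip hR x y
    linarith
  odd x := by
    rw [h.bar_odd]; module

theorem zero_mem (h : SymBody K) : (0 : E) ∈ K := by
  have := h.bar_mem 0
  rwa [h.bar_zero] at this

theorem two_smul_mem (h : SymBody K) (x y : E) (hx : x ∈ K) (hy : y ∈ K) :
    x - y ∈ (2 : ℝ) • K := by
  refine ⟨(1 / 2 : ℝ) • x + (1 / 2 : ℝ) • (-y), h.conv hx (h.symm y hy) (by norm_num) (by norm_num)
    (by norm_num), ?_⟩
  change (2 : ℝ) • ((1 / 2 : ℝ) • x + (1 / 2 : ℝ) • (-y)) = _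
  module

theorem infDist_lower (h : SymBody K) {R : ℝ} (hR : ∀ x ∈ K, ‖x‖ ≤ R) (v : E) :
    ‖v‖ ^ 2 / 2 - 4 * R ^ 2 ≤ Metric.infDist v ((2 : ℝ) • K) ^ 2 := by
  have h0 := Metric.infDist_nonneg (x := v) (s := (2 : ℝ) • K)
  have hR0 : 0 ≤ R := (norm_nonneg _).trans (hR 0 h.zero_mem)
  have h1 : ‖v‖ - 2 * R ≤ Metric.infDist v ((2 : ℝ) • K) := by
    refine (Metric.le_infDist ⟨(2 : ℝ) • (0 : E), Set.smul_mem_smul_set h.zero_mem⟩).2 ?_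
    rintro _ ⟨z, hz, rfl⟩
    change _ ≤ dist v ((2 : ℝ) • z)
    rw [dist_eq_norm]
    have := norm_sub_norm_le v ((2 : ℝ) • z)
    rw [norm_smul] at this
    have := hR z hz
    norm_num at *
    linarith
  rcases le_total ‖v‖ (2 * R) with h2 | h2
  · have := norm_nonneg v
    nlinarith
  · have : (‖v‖ - 2 * R) ^ 2 ≤ Metric.infDist v ((2 : ℝ) • K) ^ 2 :=
      pow_le_pow_left₀ (by linarith) h1 2
    nlinarith [sq_nonneg (‖v‖ - 4 * R)]

theorem vol_two (_ : SymBody K) :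
    volume ((2 : ℝ) • K) = ENNReal.ofReal (2 ^ Module.finrank ℝ E) * volume K := by
  rw [Measure.addHaar_smul, abs_of_pos (by positivity)]

theorem exists_delta (h : SymBody K) : ∃ δ : ℝ, 0 < δ ∧ δ ≤ 1 ∧
    ∫⁻ v, ENNReal.ofReal (exp (-(Metric.infDist v ((2 : ℝ) • K) ^ 2 / (4 * δ))))
      ≤ 2 * (ENNReal.ofReal (2 ^ Module.finrank ℝ E) * volume K) := by
  obtain ⟨R, hR0, hR⟩ := h.bdd
  have hcl : IsClosed ((2 : ℝ) • K) := (h.cpt.smul (2 : ℝ)).isClosed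
  have hne : ((2 : ℝ) • K).Nonempty := ⟨(2 : ℝ) • (0 : E), Set.smul_mem_smul_set h.zero_mem⟩
  have hlim : Filter.Tendsto (fun k : ℕ => ∫⁻ v, ENNReal.ofReal
      (exp (-(Metric.infDist v ((2 : ℝ) • K) ^ 2 / (4 * (1 / ((k : ℝ) + 1))))))) Filter.atTop
      (nhds (∫⁻ v, ((2 : ℝ) • K).indicator 1 v)) := by
    refine tendsto_lintegral_of_dominated_convergence
      (fun v => ENNReal.ofReal (exp (-(Metric.infDist v ((2 : ℝ) • K) ^ 2 / 4)))) ?_ ?_ ?_ ?_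
    · intro k
      refine ENNReal.measurable_ofReal.comp (Continuous.measurable ?_)
      have := Metric.continuous_infDist_pt ((2 : ℝ) • K)
      fun_prop
    · intro k
      refine Filter.Eventually.of_forall fun v => ENNReal.ofReal_le_ofReal (exp_le_exp.2 ?_)
      rw [neg_le_neg_iff]
      refine div_le_div_of_nonneg_left (sq_nonneg _) (by positivity) ?_
      have : 1 / ((k : ℝ) + 1) ≤ 1 := by
        rw [div_le_one (by positivity)]; linarith [k.cast_nonneg (α := ℝ)]
      linarith
    · have hi : Integrable (fun v : E => exp (R ^ 2) * exp (-(1 / 8) * ‖v‖ ^ 2)) :=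
        (integrable_gauss (E := E) (1 / 8) (by norm_num)).const_mul _
      refine (lt_of_le_of_lt (lintegral_mono fun v => ENNReal.ofReal_le_ofReal ?_)
        hi.lintegral_lt_top).ne
      rw [← exp_add]
      refine exp_le_exp.2 ?_
      have := h.infDist_lower hR v
      linarith
    · refine Filter.Eventually.of_forall fun v => ?_
      by_cases hv : v ∈ (2 : ℝ) • K
      · rw [Set.indicator_of_mem hv, Metric.infDist_zero_of_mem hv]
        simp
      · rw [Set.indicator_of_notMem hv]
        have hp : 0 < Metric.infDist v ((2 : ℝ) • K) := (hcl.notMem_iff_infDist_pos hne).1 hv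
        rw [show (0 : ENNReal) = ENNReal.ofReal 0 by simp]
        refine (ENNReal.continuous_ofReal.tendsto 0).comp ?_
        refine tendsto_exp_neg_atTop_nhds_zero.comp ?_
        have e : ∀ k : ℕ, Metric.infDist v ((2 : ℝ) • K) ^ 2 / (4 * (1 / ((k : ℝ) + 1)))
          = Metric.infDist v ((2 : ℝ) • K) ^ 2 / 4 * ((k : ℝ) + 1) := by
          intro k; field_simp
        simp only [e]
        exact Filter.Tendsto.const_mul_atTop (by positivity)
          (Filter.tendsto_atTop_add_const_right _ _ tendsto_natCast_atTop_atTop)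
  rw [lintegral_indicator_one hcl.measurableSet, h.vol_two] at hlim
  set V := ENNReal.ofReal (2 ^ Module.finrank ℝ E) * volume K with hV
  have hV0 : V ≠ 0 := mul_ne_zero (by simp) h.pos.ne'
  have hVt : V ≠ ⊤ := ENNReal.mul_ne_top ENNReal.ofReal_ne_top h.fin
  have hlt : V < 2 * V := by
    rw [two_mul]; exact ENNReal.lt_add_right hVt hV0
  obtain ⟨k, hk⟩ := ((tendsto_order.1 hlim).2 _ hlt).exists
  refine ⟨1 / ((k : ℝ) + 1), by positivity, ?_, hk.le⟩
  rw [div_le_one (by positivity)]; linarith [k.cast_nonneg (α := ℝ)]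

theorem exponent_bound (h : SymBody K) {R δ ε : ℝ} (hR : ∀ x ∈ K, ‖x‖ ≤ R) (hδ : 0 < δ)
    (hδ1 : δ ≤ 1) (hε : 0 < ε) (hε3 : ε ≤ δ / 6) (hε4 : ε * (4 * R ^ 2) ≤ 1) (x x' : E) :
    -(inner ℝ x (bar K x + δ • x)) - inner ℝ x' (bar K x' + δ • x')
        - 2 * ε * (inner ℝ x x' - inner ℝ (bar K x + δ • x) (bar K x' + δ • x'))
      ≤ 1 - 2 * Ff K ((1 / 2 : ℝ) • (x + x'))
        - Metric.infDist ((bar K x + δ • x) - (bar K x' + δ • x')) ((2 : ℝ) • K) ^ 2 / (4 * δ) := by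
  have a1 : inner ℝ x (bar K x + δ • x) = inner ℝ x (bar K x) + δ * ‖x‖ ^ 2 := by
    rw [inner_add_right, real_inner_smul_right, real_inner_self_eq_norm_sq]
  have a2 : inner ℝ x' (bar K x' + δ • x') = inner ℝ x' (bar K x') + δ * ‖x'‖ ^ 2 := by
    rw [inner_add_right, real_inner_smul_right, real_inner_self_eq_norm_sq]
  have b1 := h.F_le x
  have b2 := h.F_le x'
  have b3 := h.F_mid x x'
  have n1 : ∀ z : E, ‖bar K z + δ • z‖ ^ 2 ≤ 2 * R ^ 2 + 2 * ‖z‖ ^ 2 := by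
    intro z
    have h1 : ‖bar K z + δ • z‖ ≤ R + ‖z‖ := by
      refine (norm_add_le _ _).trans (add_le_add (hR _ (h.bar_mem z)) ?_)
      rw [norm_smul, Real.norm_eq_abs, abs_of_pos hδ]
      exact mul_le_of_le_one_left (norm_nonneg _) hδ1
    have := pow_le_pow_left₀ (norm_nonneg _) h1 2
    nlinarith [sq_nonneg (R - ‖z‖)]
  have c1 : -(2 * inner ℝ x x') ≤ ‖x‖ ^ 2 + ‖x'‖ ^ 2 := by
    have := norm_add_sq_real x x'
    nlinarith [sq_nonneg ‖x + x'‖]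
  have c2 : 2 * inner ℝ (bar K x + δ • x) (bar K x' + δ • x')
      ≤ ‖bar K x + δ • x‖ ^ 2 + ‖bar K x' + δ • x'‖ ^ 2 := by
    have := norm_sub_sq_real (bar K x + δ • x) (bar K x' + δ • x')
    nlinarith [sq_nonneg ‖bar K x + δ • x - (bar K x' + δ • x')‖]
  have c3 : -(2 * (inner ℝ x x' - inner ℝ (bar K x + δ • x) (bar K x' + δ • x')))
      ≤ 4 * R ^ 2 + 3 * (‖x‖ ^ 2 + ‖x'‖ ^ 2) := by
    have := n1 x
    have := n1 x'
    linarith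
  have c4 := mul_le_mul_of_nonneg_left c3 hε.le
  have c5 : ε * (3 * (‖x‖ ^ 2 + ‖x'‖ ^ 2)) ≤ δ / 6 * (3 * (‖x‖ ^ 2 + ‖x'‖ ^ 2)) :=
    mul_le_mul_of_nonneg_right hε3 (by positivity)
  have d1 : Metric.infDist ((bar K x + δ • x) - (bar K x' + δ • x')) ((2 : ℝ) • K)
      ≤ δ * ‖x - x'‖ := by
    refine (Metric.infDist_le_dist_of_mem
      (h.two_smul_mem _ _ (h.bar_mem x) (h.bar_mem x'))).trans (le_of_eq ?_)
    rw [dist_eq_norm]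
    have : bar K x + δ • x - (bar K x' + δ • x') - (bar K x - bar K x') = δ • (x - x') := by module
    rw [this, norm_smul, Real.norm_eq_abs, abs_of_pos hδ]
  have d2 := pow_le_pow_left₀ Metric.infDist_nonneg d1 2
  have d3 : ‖x - x'‖ ^ 2 ≤ 2 * (‖x‖ ^ 2 + ‖x'‖ ^ 2) := by
    have := norm_sub_sq_real x x'
    linarith
  have d4 : Metric.infDist ((bar K x + δ • x) - (bar K x' + δ • x')) ((2 : ℝ) • K) ^ 2 / (4 * δ)
      ≤ δ / 2 * (‖x‖ ^ 2 + ‖x'‖ ^ 2) := by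
    rw [div_le_iff₀ (by positivity)]
    rw [mul_pow] at d2
    have := mul_le_mul_of_nonneg_left d3 (sq_nonneg δ)
    nlinarith
  rw [a1, a2]
  linarith

/-- Bourgain–Milman type inequality for the log-Laplace transform. -/
theorem bm_K (h : SymBody K) :
    1 ≤ ENNReal.ofReal (2 * exp 1) * (volume K * ∫⁻ y, ENNReal.ofReal (exp (-(2 * Ff K y)))) := by
  obtain ⟨R, hR0, hR⟩ := h.bdd
  obtain ⟨δ, hδ, hδ1, hIntg⟩ := h.exists_delta
  have hg := h.goodMap hR hδ
  set T : E → E := fun x => bar K x + δ • x with hT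
  obtain ⟨ε, hε, e1, e2, e3, e4⟩ : ∃ ε : ℝ, 0 < ε ∧ ε ≤ 1 / 2 ∧ ε ≤ δ / (1 + (2 * R ^ 2 + δ) ^ 2)
      ∧ ε ≤ δ / 6 ∧ ε ≤ 1 / (4 * R ^ 2) := by
    refine ⟨min (min (1 / 2) (δ / (1 + (2 * R ^ 2 + δ) ^ 2))) (min (δ / 6) (1 / (4 * R ^ 2))),
      by positivity, ?_, ?_, ?_, ?_⟩ <;> simp
  have hb := bm_ineq hg ε hε e1 e2
  let H : E × E → ENNReal := fun q => ENNReal.ofReal (exp 1) *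
    (ENNReal.ofReal (exp (-(2 * Ff K ((1 / 2 : ℝ) • q.1))))
      * ENNReal.ofReal (exp (-(Metric.infDist q.2 ((2 : ℝ) • K) ^ 2 / (4 * δ)))))
  have hm1 : Measurable fun u : E => ENNReal.ofReal (exp (-(2 * Ff K u))) := by
    have := h.F_cont
    exact ENNReal.measurable_ofReal.comp (Continuous.measurable (by fun_prop))
  have hm2 : Measurable fun v : E =>
      ENNReal.ofReal (exp (-(Metric.infDist v ((2 : ℝ) • K) ^ 2 / (4 * δ)))) := by
    have := Metric.continuous_infDist_pt ((2 : ℝ) • K)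
    exact ENNReal.measurable_ofReal.comp (Continuous.measurable (by fun_prop))
  have hm1' : Measurable fun u : E => ENNReal.ofReal (exp (-(2 * Ff K ((1 / 2 : ℝ) • u)))) :=
    hm1.comp (g := fun u => ENNReal.ofReal (exp (-(2 * Ff K u)))) (measurable_const_smul _)
  have hH : Measurable H :=
    ((hm1'.comp measurable_fst).mul (hm2.comp measurable_snd)).const_mul _
  have hle := hb.trans (lintegral_mono (g := fun p => H ((1 : ℝ) • p.1 + (1 : ℝ) • p.2,
      (1 : ℝ) • T p.1 - (1 : ℝ) • T p.2)) fun p => ?_)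
  · have hHint : ∫⁻ p, H p = ENNReal.ofReal (exp 1) *
        ((∫⁻ u : E, ENNReal.ofReal (exp (-(2 * Ff K ((1 / 2 : ℝ) • u))))) *
        ∫⁻ v : E, ENNReal.ofReal (exp (-(Metric.infDist v ((2 : ℝ) • K) ^ 2 / (4 * δ))))) := by
      rw [Measure.volume_eq_prod, ← lintegral_prod_mul hm1'.aemeasurable hm2.aemeasurable]
      exact lintegral_const_mul _ ((hm1'.comp measurable_fst).mul (hm2.comp measurable_snd))
    rw [hg.lintegral_nu 1 1 one_pos one_pos (one_mul 1) H hH, hHint,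
      lintegral_smul_half (fun u => ENNReal.ofReal (exp (-(2 * Ff K u)))) hm1] at hle
    set I := ∫⁻ y, ENNReal.ofReal (exp (-(2 * Ff K y)))
    set c := ENNReal.ofReal ((2 : ℝ) ^ Module.finrank ℝ E) with hc
    have hc0 : c * c ≠ 0 := mul_ne_zero (by simp [hc]) (by simp [hc])
    have hct : c * c ≠ ⊤ := ENNReal.mul_ne_top ENNReal.ofReal_ne_top ENNReal.ofReal_ne_top
    have h4 : ENNReal.ofReal ((4 : ℝ) ^ Module.finrank ℝ E) = c * c := by
      rw [hc, ← ENNReal.ofReal_mul (by positivity), ← mul_pow]; norm_num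
    rw [h4] at hle
    have h5 : c * c * 1 ≤ c * c * (ENNReal.ofReal (2 * exp 1) * (volume K * I)) := by
      rw [mul_one]
      refine hle.trans ?_
      calc _ ≤ ENNReal.ofReal (exp 1) * (c * I * (2 * (c * volume K))) := by gcongr
        _ = _ := by
          rw [ENNReal.ofReal_mul (by norm_num), ENNReal.ofReal_ofNat]; ring
    exact (ENNReal.mul_le_mul_iff_right hc0 hct).1 h5
  · simp only [H, one_smul]
    rw [← ENNReal.ofReal_mul (exp_pos _).le, ← ENNReal.ofReal_mul (exp_pos _).le, ← exp_add,
      ← exp_add]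
    refine ENNReal.ofReal_le_ofReal (exp_le_exp.2 ?_)
    have := h.exponent_bound hR hδ hδ1 hε e3 ((le_div_iff₀ (by positivity)).1 e4) p.1 p.2
    simp only [hT]
    linarith

end SymBody
end P2
end MEll

set_option linter.unusedSectionVars false

namespace MEll

section P3
variable {E : Type*} [NormedAddCommGroup E] [InnerProductSpace ℝ E] [FiniteDimensional ℝ E]
  [MeasurableSpace E] [BorelSpace E]
variable {K : Set E}

namespace SymBody

theorem trunc (h : SymBody K) (hn : 1 ≤ Module.finrank ℝ E) (m : ℝ) :
    ∫⁻ y in Metric.closedBall 0 m, ENNReal.ofReal (exp (-(2 * Ff K y)))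
      ≤ 2 * volume {y : E | Ff K y ≤ 2 * Module.finrank ℝ E} := by
  set n := Module.finrank ℝ E with hn'
  set g : E → ENNReal := fun y => ENNReal.ofReal (exp (-(2 * Ff K y))) with hg
  have hFc := h.F_cont
  have hgm : Measurable g := ENNReal.measurable_ofReal.comp (Continuous.measurable (by fun_prop))
  have hbm : MeasurableSet (Metric.closedBall (0 : E) m) := Metric.isClosed_closedBall.measurableSet
  set I := ∫⁻ y in Metric.closedBall 0 m, g y with hI
  have hIfin : I ≠ ⊤ := by
    refine (lt_of_le_of_lt (setLIntegral_mono (g := fun _ => 1) measurable_const fun y _ => ?_) ?_).ne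
    · rw [hg]
      simpa using h.F_nonneg y
    · rw [setLIntegral_const, one_mul]; exact measure_closedBall_lt_top
  have hpt : ∀ y, g y ≤ Set.indicator {y : E | Ff K y ≤ 2 * n} 1 y
      + ENNReal.ofReal (exp (-(2 * n))) * g ((1 / 2 : ℝ) • y) := by
    intro y
    by_cases hy : Ff K y ≤ 2 * n
    · refine le_add_right ?_
      rw [Set.indicator_of_mem (show y ∈ {y : E | Ff K y ≤ 2 * n} from hy)]
      simpa [hg] using h.F_nonneg y
    · refine le_add_left ?_
      rw [hg, ← ENNReal.ofReal_mul (exp_pos _).le, ← exp_add]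
      refine ENNReal.ofReal_le_ofReal (exp_le_exp.2 ?_)
      have := h.F_mid y 0
      rw [h.F_zero, add_zero, add_zero] at this
      push Not at hy
      linarith
  have h2 : ∫⁻ y in Metric.closedBall 0 m, g ((1 / 2 : ℝ) • y) ≤ ENNReal.ofReal (2 ^ n) * I := by
    have e := lintegral_smul_half ((Metric.closedBall (0 : E) m).indicator g) (hgm.indicator hbm)
    rw [lintegral_indicator hbm] at e
    rw [hI, hn', ← e, ← lintegral_indicator hbm]
    refine lintegral_mono fun y => ?_
    by_cases hy : y ∈ Metric.closedBall (0 : E) m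
    · rw [Set.indicator_of_mem hy, Set.indicator_of_mem]
      rw [mem_closedBall_zero_iff] at hy ⊢
      rw [norm_smul]
      norm_num
      have := norm_nonneg y
      linarith
    · rw [Set.indicator_of_notMem hy]; exact zero_le
  have h3 : I ≤ volume {y : E | Ff K y ≤ 2 * n} + ENNReal.ofReal (exp (-(2 * n)) * 2 ^ n) * I := by
    have hSm : MeasurableSet {y : E | Ff K y ≤ 2 * n} := measurableSet_le hFc.measurable measurable_const
    calc I ≤ ∫⁻ y in Metric.closedBall 0 m, (Set.indicator {y : E | Ff K y ≤ 2 * n} 1 y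
            + ENNReal.ofReal (exp (-(2 * n))) * g ((1 / 2 : ℝ) • y)) := lintegral_mono fun y => hpt y
      _ = (∫⁻ y in Metric.closedBall 0 m, Set.indicator {y : E | Ff K y ≤ 2 * n} 1 y)
            + ENNReal.ofReal (exp (-(2 * n))) *
              ∫⁻ y in Metric.closedBall 0 m, g ((1 / 2 : ℝ) • y) := by
          rw [lintegral_add_left (measurable_one.indicator hSm), lintegral_const_mul]
          exact hgm.comp (measurable_const_smul _)
      _ ≤ volume {y : E | Ff K y ≤ 2 * n} + ENNReal.ofReal (exp (-(2 * n)))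
            * (ENNReal.ofReal (2 ^ n) * I) := by
          gcongr
          refine (setLIntegral_le_lintegral _ _).trans ?_
          rw [lintegral_indicator_one hSm]
      _ = _ := by
          rw [← mul_assoc, ← ENNReal.ofReal_mul (exp_pos _).le]
  have h4 : ENNReal.ofReal (exp (-(2 * n)) * 2 ^ n) ≤ 2⁻¹ := by
    have : exp (-(2 * n)) * 2 ^ n ≤ (2 : ℝ)⁻¹ := by
      have e1 : exp (-(2 * (n : ℝ))) * 2 ^ n = (exp (-2) * 2) ^ n := by
        rw [mul_pow, ← exp_nat_mul]; congr 2; ring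
      have e2 : exp (-2) * 2 ≤ (2 : ℝ)⁻¹ := by
        have h1 : (2 : ℝ) ≤ exp 1 := by linarith [add_one_le_exp (1 : ℝ)]
        have h2 : exp (-2) * exp 2 = 1 := by rw [← exp_add]; simp
        have h3 : exp 2 = exp 1 * exp 1 := by rw [← exp_add]; norm_num
        have h4 : (4 : ℝ) ≤ exp 2 := by nlinarith
        nlinarith [exp_pos (-2)]
      rw [e1]
      refine (pow_le_of_le_one (by positivity) (e2.trans (by norm_num)) (by omega)).trans e2
    rw [show (2⁻¹ : ENNReal) = ENNReal.ofReal 2⁻¹ by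
      rw [ENNReal.ofReal_inv_of_pos (by norm_num)]; norm_num]
    exact ENNReal.ofReal_le_ofReal this
  have h5 : I ≤ volume {y : E | Ff K y ≤ 2 * n} + 2⁻¹ * I := h3.trans (by gcongr)
  have h6 : I = 2⁻¹ * I + 2⁻¹ * I := by
    rw [← add_mul, ENNReal.inv_two_add_inv_two, one_mul]
  have h7 : 2⁻¹ * I ≤ volume {y : E | Ff K y ≤ 2 * n} := by
    rw [h6] at h5
    have hf : 2⁻¹ * I ≠ ⊤ := ENNReal.mul_ne_top (by simp) hIfin
    rw [← h6] at h5
    nth_rewrite 1 [h6] at h5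
    exact (ENNReal.add_le_add_iff_right hf).1 h5
  calc I = 2 * (2⁻¹ * I) := by
        rw [← mul_assoc, ENNReal.mul_inv_cancel (by simp) (by simp), one_mul]
    _ ≤ _ := by gcongr

theorem full (h : SymBody K) (hn : 1 ≤ Module.finrank ℝ E) :
    ∫⁻ y, ENNReal.ofReal (exp (-(2 * Ff K y)))
      ≤ 2 * volume {y : E | Ff K y ≤ 2 * Module.finrank ℝ E} := by
  have hFc := h.F_cont
  have hgm : Measurable (fun y => ENNReal.ofReal (exp (-(2 * Ff K y)))) :=
    ENNReal.measurable_ofReal.comp (Continuous.measurable (by fun_prop))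
  have := (aecover_closedBall (x := (0 : E)) (μ := volume)
    tendsto_natCast_atTop_atTop).lintegral_tendsto_of_countably_generated hgm.aemeasurable
  exact le_of_tendsto' this fun k => h.trunc hn _

theorem exists_y (h : SymBody K) (hn : 1 ≤ Module.finrank ℝ E) :
    ∃ y : E, Ff K ((2 : ℝ) • y) ≤ 2 * Module.finrank ℝ E ∧
      |(cov K y).det| ≤ 64 ^ Module.finrank ℝ E * (volume K).toReal ^ 2 := by
  set n := Module.finrank ℝ E with hn'
  have hFc := h.F_cont
  by_contra! hc
  set S : Set E := {y | Ff K ((2 : ℝ) • y) ≤ 2 * n} with hS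
  have hSm : MeasurableSet S :=
    measurableSet_le (hFc.measurable.comp (measurable_const_smul _)) measurable_const
  have hv : volume {y : E | Ff K y ≤ 2 * n} = ENNReal.ofReal (2 ^ n) * volume S := by
    have := lintegral_smul_half (S.indicator 1) (measurable_one.indicator hSm)
    rw [lintegral_indicator_one hSm] at this
    rw [← this, ← lintegral_indicator_one (measurableSet_le hFc.measurable measurable_const)]
    congr 1
    ext1 y
    simp [Set.indicator, hS, smul_smul]
  set a : ℝ := 64 ^ n * (volume K).toReal ^ 2 with ha
  have hvp := h.volpos
  have ha0 : 0 < a := by positivity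
  have h1 : ENNReal.ofReal a * volume S ≤ volume K := by
    rw [← setLIntegral_const]
    calc ∫⁻ _ in S, ENNReal.ofReal a ≤ ∫⁻ y in S, ENNReal.ofReal |(cov K y).det| :=
          setLIntegral_mono' hSm fun y hy => ENNReal.ofReal_le_ofReal (hc y hy).le
      _ = volume (bar K '' S) := lintegral_abs_det_fderiv_eq_addHaar_image volume hSm
          (fun y _ => (h.hasDeriv_bar y).hasFDerivWithinAt) h.bar_inj.injOn
      _ ≤ volume K := measure_mono (by rintro _ ⟨y, _, rfl⟩; exact h.bar_mem y)
  have h2 := h.bm_K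
  have h3 := h.full hn
  rw [← hn', hv] at h3
  have h4 : ENNReal.ofReal a ≤ ENNReal.ofReal (2 * exp 1 * 2 * 2 ^ n * (volume K).toReal ^ 2) := by
    calc ENNReal.ofReal a = ENNReal.ofReal a * 1 := (mul_one _).symm
      _ ≤ ENNReal.ofReal a * (ENNReal.ofReal (2 * exp 1) * (volume K *
            (2 * (ENNReal.ofReal (2 ^ n) * volume S)))) := by
          gcongr
          refine h2.trans ?_
          gcongr
      _ = ENNReal.ofReal (2 * exp 1) * 2 * ENNReal.ofReal (2 ^ n) * volume K
          * (ENNReal.ofReal a * volume S) := by ring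
      _ ≤ ENNReal.ofReal (2 * exp 1) * 2 * ENNReal.ofReal (2 ^ n) * volume K * volume K := by gcongr
      _ = _ := by
          rw [ENNReal.ofReal_mul (p := 2 * exp 1 * 2 * 2 ^ n) (by positivity),
            ENNReal.ofReal_mul (p := 2 * exp 1 * 2) (by positivity),
            ENNReal.ofReal_mul (p := 2 * exp 1) (by positivity), ENNReal.ofReal_pow hvp.le,
            ENNReal.ofReal_toReal h.fin, ENNReal.ofReal_ofNat]
          ring
  rw [ENNReal.ofReal_le_ofReal_iff (by positivity), ha] at h4
  have h5 := le_of_mul_le_mul_right h4 (by positivity)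
  have h6 : (64 : ℝ) ^ n = 32 ^ n * 2 ^ n := by rw [← mul_pow]; norm_num
  rw [h6] at h5
  have h7 := le_of_mul_le_mul_right h5 (by positivity)
  have h8 : (32 : ℝ) ≤ 32 ^ n := le_self_pow₀ (by norm_num) (by omega)
  have := exp_one_lt_d9
  linarith

end SymBody
end P3
end MEll

set_option linter.unusedSectionVars false

namespace MEll

section P4
variable {E : Type*} [NormedAddCommGroup E] [InnerProductSpace ℝ E] [FiniteDimensional ℝ E]
  [MeasurableSpace E] [BorelSpace E]
variable {K : Set E}

namespace SymBody

theorem exists_whiten (h : SymBody K) (hn : 1 ≤ Module.finrank ℝ E) (y : E) :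
    ∃ L : E →ₗ[ℝ] E, ∃ G : ℝ, 0 < G ∧ G ^ Module.finrank ℝ E = |(cov K y).det| ∧
      LinearMap.det L = 1 ∧
      ∫ z, ‖L (z - bar K y)‖ ^ 2 ∂tlt K y = Module.finrank ℝ E * G := by
  set n := Module.finrank ℝ E with hn'
  have hsym : (cov K y : E →ₗ[ℝ] E).IsSymmetric := fun v w => h.cov_symm y v w
  set e := hsym.eigenvectorBasis hn'.symm with he
  set lam := hsym.eigenvalues hn'.symm with hlam
  have hap : ∀ i, cov K y (e i) = lam i • e i := fun i => hsym.apply_eigenvectorBasis hn'.symm i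
  have hin : ∀ i, inner ℝ (cov K y (e i)) (e i) = lam i := by
    intro i
    rw [hap, real_inner_smul_left, real_inner_self_eq_norm_sq, e.norm_eq_one]; simp
  have hpos : ∀ i, 0 < lam i := by
    intro i
    rw [← hin]
    refine h.cov_pos y _ fun h0 => ?_
    have := e.norm_eq_one i
    rw [h0] at this; simp at this
  have hdet : (cov K y).det = ∏ i, lam i := hsym.det_eq_prod_eigenvalues hn'.symm
  have hd : 0 < ∏ i, lam i := Finset.prod_pos fun i _ => hpos i
  set d := ∏ i, lam i with hd'
  set G := d ^ ((n : ℝ)⁻¹) with hG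
  have hG0 : 0 < G := by positivity
  have hGn : G ^ n = d := Real.rpow_inv_natCast_pow hd.le (by omega)
  set c : Fin n → ℝ := fun i => √G / √(lam i) with hc
  set L : E →ₗ[ℝ] E := Matrix.toLin e.toBasis e.toBasis (Matrix.diagonal c) with hL
  have hLc : ∀ x i, inner ℝ (e i) (L x) = c i * inner ℝ (e i) x := by
    intro x i
    have := congrFun (Matrix.repr_toLin e.toBasis e.toBasis (Matrix.diagonal c) x) i
    rw [Matrix.mulVec_diagonal, e.coe_toBasis_repr_apply, e.coe_toBasis_repr_apply,
      e.repr_apply_apply, e.repr_apply_apply] at this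
    exact this
  refine ⟨L, G, hG0, ?_, ?_, ?_⟩
  · rw [hGn, hdet, abs_of_pos hd]
  · rw [hL, LinearMap.det_toLin, Matrix.det_diagonal, hc, Finset.prod_div_distrib]
    rw [Finset.prod_const, Finset.card_univ, Fintype.card_fin]
    have e1 : (∏ i, √(lam i)) = √d := by
      rw [hd', Real.sqrt_prod _ fun i _ => (hpos i).le]
    have e2 : √G ^ n = √d := by
      rw [← hGn]
      symm
      rw [Real.sqrt_eq_iff_mul_self_eq (by positivity) (by positivity), ← mul_pow,
        Real.mul_self_sqrt hG0.le]
    rw [e1, e2, div_self (Real.sqrt_pos.2 hd).ne']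
  · have hp : ∀ z, ‖L (z - bar K y)‖ ^ 2
        = ∑ i, G / lam i * (inner ℝ (z - bar K y) (e i) * inner ℝ (z - bar K y) (e i)) := by
      intro z
      rw [← e.sum_sq_norm_inner_right]
      refine Finset.sum_congr rfl fun i _ => ?_
      rw [hLc, Real.norm_eq_abs, sq_abs, mul_pow, hc, div_pow, Real.sq_sqrt hG0.le,
        Real.sq_sqrt (hpos i).le, real_inner_comm, sq]
    simp only [hp]
    rw [integral_finsetSum _ fun i _ => h.intT (by fun_prop) y]
    have : ∀ i, ∫ z, G / lam i * (inner ℝ (z - bar K y) (e i) * inner ℝ (z - bar K y) (e i)) ∂tlt K y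
        = G := by
      intro i
      rw [integral_const_mul, ← h.inner_cov, hin, div_mul_cancel₀ _ (hpos i).ne']
    simp [this]

theorem core (h : SymBody K) (hn : 1 ≤ Module.finrank ℝ E) :
    ∃ L : E →ₗ[ℝ] E, ∃ b : E, LinearMap.det L = 1 ∧
      exp (-(5 * Module.finrank ℝ E)) * (volume K).toReal ≤
        (volume (K ∩ {z | ‖L (z - b)‖ ^ 2 ≤ 256 * Module.finrank ℝ E *
          (volume K).toReal ^ (2 / (Module.finrank ℝ E : ℝ))})).toReal := by
  obtain ⟨y, hy, hdet⟩ := h.exists_y hn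
  obtain ⟨L, G, hG0, hGn, hL, hIntg⟩ := h.exists_whiten hn y
  set n := Module.finrank ℝ E with hn'
  have hn1 : (1 : ℝ) ≤ n := by exact_mod_cast hn
  have hvp := h.volpos
  set v := (volume K).toReal with hv
  have hP := h.prob y
  have hLc : Continuous L := L.continuous_of_finiteDimensional
  refine ⟨L, bar K y, hL, ?_⟩
  have hG : G ≤ 64 * v ^ (2 / (n : ℝ)) := by
    have h1 : G ^ n ≤ (64 * v ^ (2 / (n : ℝ))) ^ n := by
      rw [hGn, mul_pow, ← Real.rpow_natCast (v ^ (2 / (n : ℝ))), ← Real.rpow_mul hvp.le,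
        div_mul_cancel₀ _ (by positivity)]
      simpa using hdet
    exact (pow_le_pow_iff_left₀ hG0.le (by positivity) (by omega)).1 h1
  have m1 := mul_meas_ge_le_integral_of_nonneg (μ := tlt K y)
    (f := fun z => ‖L (z - bar K y)‖ ^ 2) (Filter.Eventually.of_forall fun z => by positivity)
    (h.intT (by fun_prop) y) (4 * n * G)
  rw [hIntg] at m1
  have m1' : (tlt K y).real {z | 4 * n * G ≤ ‖L (z - bar K y)‖ ^ 2} ≤ 1 / 4 := by
    have h0 : 0 < n * G := by positivity
    nlinarith
  have m2 := mul_meas_ge_le_integral_of_nonneg (μ := tlt K y)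
    (f := fun z => exp (inner ℝ z y)) (Filter.Eventually.of_forall fun z => (exp_pos _).le)
    (h.intT (by fun_prop) y) (exp (4 * n))
  have e1 := h.F_diff y ((2 : ℝ) • y)
  have e2 : (2 : ℝ) • y - y = y := by module
  rw [e2] at e1
  rw [← e1] at m2
  have e3 : exp (Ff K ((2 : ℝ) • y) - Ff K y) ≤ exp (2 * n) :=
    exp_le_exp.2 (by linarith [h.F_nonneg y])
  have e4 : (4 : ℝ) ≤ exp (2 * n) := by
    have h1 : (2 : ℝ) ≤ exp 1 := by linarith [add_one_le_exp (1 : ℝ)]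
    have h3 : exp 2 = exp 1 * exp 1 := by rw [← exp_add]; norm_num
    have h4 : exp 2 ≤ exp (2 * (n : ℝ)) := exp_le_exp.2 (by linarith)
    nlinarith
  have m2' : (tlt K y).real {z | exp (4 * n) ≤ exp (inner ℝ z y)} ≤ 1 / 4 := by
    have h3 : exp (4 * (n : ℝ)) = exp (2 * n) * exp (2 * n) := by rw [← exp_add]; congr 1; ring
    have h4 := m2.trans e3
    rw [h3, mul_assoc] at h4
    have h5 := le_of_mul_le_mul_left (h4.trans_eq (mul_one _).symm) (exp_pos _)
    rw [← h3] at h5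
    have := measureReal_nonneg (μ := tlt K y) (s := {z | exp (4 * n) ≤ exp (inner ℝ z y)})
    nlinarith
  set S : Set E := {z | 4 * n * G ≤ ‖L (z - bar K y)‖ ^ 2} ∪ {z | exp (4 * n) ≤ exp (inner ℝ z y)}
  have hSm : MeasurableSet S := by
    refine MeasurableSet.union (measurableSet_le measurable_const ?_) (measurableSet_le measurable_const ?_)
    all_goals exact Continuous.measurable (by fun_prop)
  have hS : (tlt K y).real S ≤ 1 / 2 := by
    have := measureReal_union_le (μ := tlt K y) {z | 4 * n * G ≤ ‖L (z - bar K y)‖ ^ 2}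
      {z | exp (4 * n) ≤ exp (inner ℝ z y)}
    linarith
  have hSc : 1 / 2 ≤ (tlt K y).real Sᶜ := by
    rw [measureReal_compl hSm]
    simp
    linarith
  have hZ : v ≤ Zf K y := by
    have := h.exp_F y
    rw [eq_div_iff hvp.ne'] at this
    rw [← this]
    exact le_mul_of_one_le_left hvp.le (one_le_exp (h.F_nonneg y))
  have hup : (tlt K y).real Sᶜ ≤ exp (4 * n) / v * (volume (K ∩ Sᶜ)).toReal := by
    have hle : tlt K y Sᶜ ≤ ENNReal.ofReal (exp (4 * n) / v) * volume (K ∩ Sᶜ) := by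
      rw [tlt, tilted_apply' _ _ hSm.compl]
      calc _ ≤ ∫⁻ _ in Sᶜ, ENNReal.ofReal (exp (4 * n) / v) ∂(volume.restrict K) := by
            refine setLIntegral_mono' hSm.compl fun z hz => ENNReal.ofReal_le_ofReal ?_
            simp only [S, Set.compl_union, Set.mem_inter_iff, Set.mem_compl_iff, Set.mem_ofPred_eq,
              not_le] at hz
            exact div_le_div₀ (exp_pos _).le hz.2.le hvp hZ
        _ = _ := by
            rw [setLIntegral_const, Measure.restrict_apply hSm.compl, Set.inter_comm]
    have hfin : volume (K ∩ Sᶜ) ≠ ⊤ := measure_ne_top_of_subset Set.inter_subset_left h.fin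
    have := ENNReal.toReal_mono (ENNReal.mul_ne_top ENNReal.ofReal_ne_top hfin) hle
    rwa [ENNReal.toReal_mul, ENNReal.toReal_ofReal (by positivity)] at this
  have hsub : (volume (K ∩ Sᶜ)).toReal ≤ (volume (K ∩ {z | ‖L (z - bar K y)‖ ^ 2 ≤ 256 * n *
          v ^ (2 / (n : ℝ))})).toReal := by
    refine ENNReal.toReal_mono (measure_ne_top_of_subset Set.inter_subset_left h.fin)
      (measure_mono (Set.inter_subset_inter_right _ fun z hz => ?_))
    simp only [S, Set.compl_union, Set.mem_inter_iff, Set.mem_compl_iff, Set.mem_ofPred_eq,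
              not_le] at hz ⊢
    refine hz.1.le.trans ?_
    nlinarith
  refine le_trans ?_ hsub
  have h1 := hSc.trans hup
  have h2 : exp (-(5 * (n : ℝ))) * exp (4 * n) ≤ 1 / 2 := by
    rw [← exp_add]
    have : exp (-(5 * (n : ℝ)) + 4 * n) ≤ exp (-1) := exp_le_exp.2 (by linarith)
    refine this.trans ?_
    have h1 : (2 : ℝ) ≤ exp 1 := by linarith [add_one_le_exp (1 : ℝ)]
    have h2 : exp (-1) * exp 1 = 1 := by rw [← exp_add]; simp
    nlinarith [exp_pos (-1)]
  have h3 := h2.trans h1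
  rw [div_mul_eq_mul_div, le_div_iff₀ hvp] at h3
  have : exp (4 * n) * (exp (-(5 * (n : ℝ))) * v) ≤ exp (4 * n) * (volume (K ∩ Sᶜ)).toReal := by
    linarith
  exact le_of_mul_le_mul_left this (exp_pos _)

end SymBody
end P4
end MEll

set_option linter.unusedSectionVars false

namespace MEll

section P6
variable {E : Type*} [NormedAddCommGroup E] [InnerProductSpace ℝ E] [FiniteDimensional ℝ E]
  [MeasurableSpace E] [BorelSpace E]

/-- Log-concavity on a general Euclidean space. -/
structure LC (f : E → ℝ) : Prop where
  nonneg : ∀ x, 0 ≤ f x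
  lc : ∀ x y : E, ∀ t : ℝ, 0 ≤ t → t ≤ 1 → f x ^ t * f y ^ (1 - t) ≤ f (t • x + (1 - t) • y)

theorem lintegral_half_shift (g : E → ENNReal) (x0 : E) :
    ∫⁻ x, g ((1 / 2 : ℝ) • x + x0) = ENNReal.ofReal (2 ^ Module.finrank ℝ E) * ∫⁻ x, g x := by
  have h := Measure.map_addHaar_smul (volume : Measure E) (r := (1 / 2 : ℝ)) (by norm_num)
  have e : MeasurableEmbedding (fun x : E => (1 / 2 : ℝ) • x) :=
    (Homeomorph.smulOfNeZero (1 / 2 : ℝ) (by norm_num)).measurableEmbedding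
  rw [← e.lintegral_map (fun x => g (x + x0)), h, lintegral_smul_measure, smul_eq_mul,
    lintegral_add_right_eq_self]
  congr 2
  rw [abs_of_pos (by positivity)]
  simp

namespace LC
variable {f : E → ℝ}

theorem convex (h : LC f) (s : ℝ) : Convex ℝ {x | s < f x} := by
  intro x hx y hy a b ha hb hab
  simp only [Set.mem_ofPred_eq] at *
  rcases lt_or_ge s 0 with hs | hs
  · exact hs.trans_le (h.nonneg _)
  have hm : s < min (f x) (f y) := lt_min hx hy
  have hb' : b = 1 - a := by linarith
  subst hb'
  refine hm.trans_le (le_trans ?_ (h.lc x y a ha (by linarith)))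
  have hm0 : 0 < min (f x) (f y) := hs.trans_lt hm
  calc min (f x) (f y) = min (f x) (f y) ^ a * min (f x) (f y) ^ (1 - a) := by
        rw [← Real.rpow_add hm0]; simp
    _ ≤ _ := by
        gcongr
        · exact Real.rpow_nonneg (h.nonneg x) _
        · exact min_le_left _ _
        · exact min_le_right _ _

theorem aemeas (h : LC f) : AEMeasurable f volume := by
  apply NullMeasurable.aemeasurable
  have : @Measurable (NullMeasurableSpace E volume) ℝ _ _ f := by
    apply measurable_of_Ioi
    intro s
    exact (h.convex s).nullMeasurableSet volume
  exact fun s hs => this hs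

theorem sqrt_mul_le (h : LC f) (x y : E) :
    √(f x) * √(f y) ≤ f ((1 / 2 : ℝ) • x + (1 / 2 : ℝ) • y) := by
  have := h.lc x y (1 / 2) (by norm_num) (by norm_num)
  rw [Real.sqrt_eq_rpow, Real.sqrt_eq_rpow]
  norm_num at this ⊢
  exact this

theorem int_sqrt_mul (h : LC f) (hf : ∫⁻ x, ENNReal.ofReal (f x) = 1) (x0 : E) :
    (∫⁻ x, ENNReal.ofReal (√(f x))) * ENNReal.ofReal (√(f x0)) ≤
      ENNReal.ofReal (2 ^ Module.finrank ℝ E) := by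
  rw [← lintegral_mul_const' _ _ ENNReal.ofReal_ne_top]
  calc _ ≤ ∫⁻ x, ENNReal.ofReal (f ((1 / 2 : ℝ) • x + (1 / 2 : ℝ) • x0)) := by
        apply lintegral_mono
        intro x
        beta_reduce
        rw [← ENNReal.ofReal_mul (Real.sqrt_nonneg _)]
        exact ENNReal.ofReal_le_ofReal (h.sqrt_mul_le x x0)
    _ = _ := by
        rw [lintegral_half_shift (fun x => ENNReal.ofReal (f x)), hf, mul_one]

theorem exists_pos (_ : LC f) (hf : ∫⁻ x, ENNReal.ofReal (f x) = 1) : ∃ x, 0 < f x := by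
  by_contra hc
  push Not at hc
  have : ∫⁻ x, ENNReal.ofReal (f x) = 0 := by
    simp [ENNReal.ofReal_of_nonpos (hc _)]
  rw [hf] at this
  exact one_ne_zero this

theorem int_sqrt_lt_top (h : LC f) (hf : ∫⁻ x, ENNReal.ofReal (f x) = 1) :
    ∫⁻ x, ENNReal.ofReal (√(f x)) < ⊤ := by
  obtain ⟨x0, hx0⟩ := h.exists_pos hf
  have := h.int_sqrt_mul hf x0
  by_contra hc
  rw [not_lt, top_le_iff] at hc
  rw [hc, ENNReal.top_mul (by simpa using hx0)] at this
  exact absurd this (by simp)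

theorem int_sqrt_pos (h : LC f) (hf : ∫⁻ x, ENNReal.ofReal (f x) = 1) :
    0 < ∫⁻ x, ENNReal.ofReal (√(f x)) := by
  rw [pos_iff_ne_zero]
  intro hc
  rw [lintegral_eq_zero_iff' (h.aemeas.sqrt.ennreal_ofReal)] at hc
  have : ∫⁻ x, ENNReal.ofReal (f x) = 0 := by
    rw [lintegral_eq_zero_iff' (h.aemeas.ennreal_ofReal)]
    filter_upwards [hc] with x hx
    have h2 : √(f x) ≤ 0 := by simpa using hx
    have h3 : f x ≤ 0 := Real.sqrt_eq_zero'.1 (le_antisymm h2 (Real.sqrt_nonneg _))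
    simpa using h3
  rw [hf] at this
  exact one_ne_zero this

theorem exists_sup (h : LC f) (hf : ∫⁻ x, ENNReal.ofReal (f x) = 1)
    (hs : 1 ≤ essSup (fun x => ENNReal.ofReal (f x)) volume) :
    ∃ M : ℝ, 1 ≤ M ∧ (∀ x, f x ≤ M) ∧ ∃ x0, M / 2 ≤ f x0 := by
  set J := ∫⁻ x, ENNReal.ofReal (√(f x))
  have hJ : J < ⊤ := h.int_sqrt_lt_top hf
  have hJ0 : 0 < J := h.int_sqrt_pos hf
  have hJr : 0 < J.toReal := ENNReal.toReal_pos hJ0.ne' hJ.ne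
  have hb : BddAbove (Set.range f) := by
    refine ⟨(2 ^ Module.finrank ℝ E / J.toReal) ^ 2, ?_⟩
    rintro _ ⟨x, rfl⟩
    have := ENNReal.toReal_mono ENNReal.ofReal_ne_top (h.int_sqrt_mul hf x)
    rw [ENNReal.toReal_mul, ENNReal.toReal_ofReal (by positivity),
      ENNReal.toReal_ofReal (by positivity)] at this
    rw [← Real.sqrt_le_left (by positivity), le_div_iff₀ hJr, mul_comm]
    exact this
  have h1 : ∀ x, f x ≤ sSup (Set.range f) := fun x => le_csSup hb ⟨x, rfl⟩
  have hM : 1 ≤ sSup (Set.range f) := by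
    have : essSup (fun x => ENNReal.ofReal (f x)) volume ≤ ENNReal.ofReal (sSup (Set.range f)) :=
      essSup_le_of_ae_le _ (Filter.Eventually.of_forall fun x => ENNReal.ofReal_le_ofReal (h1 x))
    simpa using hs.trans this
  refine ⟨_, hM, h1, ?_⟩
  obtain ⟨_, ⟨x, rfl⟩, hx⟩ := exists_lt_of_lt_csSup (Set.range_nonempty f)
    (show sSup (Set.range f) / 2 < sSup (Set.range f) by linarith)
  exact ⟨x, hx.le⟩

end LC
end P6
end MEll

set_option linter.unusedSectionVars false

namespace MEll

section P6
variable {E : Type*} [NormedAddCommGroup E] [InnerProductSpace ℝ E] [FiniteDimensional ℝ E]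
  [MeasurableSpace E] [BorelSpace E]

theorem exists_sym {L : Set E} (hc : IsCompact L) (hv : Convex ℝ L) (hp : 0 < volume L) :
    ∃ c : E, SymBody {z : E | c + z ∈ L ∧ c - z ∈ L} ∧
      volume L ≤ ENNReal.ofReal (2 ^ Module.finrank ℝ E) *
        volume {z : E | c + z ∈ L ∧ c - z ∈ L} := by
  set φ : E → ENNReal := fun c => volume {z : E | c + z ∈ L ∧ c - z ∈ L} with hφ
  have hLm : MeasurableSet L := hc.measurableSet
  have hLt : volume L < ⊤ := hc.measure_lt_top
  have hφ' : ∀ c, φ c = ∫⁻ x, L.indicator 1 x * L.indicator 1 ((2 : ℝ) • c - x) := by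
    intro c
    have h1 : MeasurableSet {z : E | c + z ∈ L ∧ c - z ∈ L} :=
      ((by fun_prop : Measurable fun z => c + z) hLm).inter
        ((by fun_prop : Measurable fun z => c - z) hLm)
    rw [hφ]
    beta_reduce
    rw [← lintegral_indicator_one h1,
      ← lintegral_add_left_eq_self (fun x => L.indicator 1 x * L.indicator 1 ((2 : ℝ) • c - x)) c]
    congr 1
    ext z
    have : (2 : ℝ) • c - (c + z) = c - z := by rw [two_smul]; abel
    rw [this]
    by_cases h2 : c + z ∈ L <;> by_cases h3 : c - z ∈ L <;> simp [h2, h3]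
  have hm : Measurable (fun p : E × E =>
      (L.indicator 1 p.2 * L.indicator 1 ((2 : ℝ) • p.1 - p.2) : ENNReal)) := by
    have h1 : Measurable (L.indicator (1 : E → ENNReal)) := measurable_one.indicator hLm
    exact (h1.comp measurable_snd).mul (h1.comp (by fun_prop))
  have hIntg : ENNReal.ofReal (2 ^ Module.finrank ℝ E) * ∫⁻ c, φ c = volume L * volume L := by
    simp_rw [hφ']
    rw [lintegral_lintegral_swap hm.aemeasurable]
    have h2 : ∀ x : E, ENNReal.ofReal (2 ^ Module.finrank ℝ E) *
        ∫⁻ c, L.indicator 1 x * L.indicator (1 : E → ENNReal) ((2 : ℝ) • c - x)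
        = L.indicator 1 x * volume L := by
      intro x
      rw [← lintegral_half_shift _ 0]
      have : ∀ y : E, (2 : ℝ) • ((1 / 2 : ℝ) • y + 0) - x = y - x := by
        intro y; rw [add_zero, smul_smul]; norm_num
      simp_rw [this]
      rw [lintegral_sub_right_eq_self (fun y => L.indicator 1 x * L.indicator (1 : E → ENNReal) y),
        lintegral_const_mul _ (measurable_one.indicator hLm), lintegral_indicator_one hLm]
    rw [← lintegral_const_mul' _ _ ENNReal.ofReal_ne_top]
    simp_rw [h2]
    rw [lintegral_mul_const _ (measurable_one.indicator hLm), lintegral_indicator_one hLm]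
  have hsupp : ∫⁻ c in L, φ c = ∫⁻ c, φ c := by
    apply setLIntegral_eq_of_support_subset
    intro c hcs
    have : ({z : E | c + z ∈ L ∧ c - z ∈ L}).Nonempty := nonempty_of_measure_ne_zero hcs
    obtain ⟨z, h1, h2⟩ := this
    have := hv h1 h2 (by norm_num : (0:ℝ) ≤ 1/2) (by norm_num : (0:ℝ) ≤ 1/2) (by norm_num)
    convert this using 1
    rw [← smul_add, add_add_sub_cancel, ← two_smul ℝ c, smul_smul]; norm_num
  have h2n : ENNReal.ofReal (2 ^ Module.finrank ℝ E) ≠ 0 := by simp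
  have hfin : ∫⁻ c in L, φ c ≠ ⊤ := by
    rw [hsupp]
    intro h
    rw [h, ENNReal.mul_top h2n] at hIntg
    exact (ENNReal.mul_lt_top hLt hLt).ne hIntg.symm
  obtain ⟨c, hcL, hcc⟩ := exists_setLAverage_le hp.ne' hLm.nullMeasurableSet hfin
  rw [setLAverage_eq, hsupp] at hcc
  have hmain : volume L ≤ ENNReal.ofReal (2 ^ Module.finrank ℝ E) * φ c := by
    calc volume L = volume L * volume L / volume L := by
          rw [mul_div_assoc, ENNReal.div_self hp.ne' hLt.ne, mul_one]
      _ = ENNReal.ofReal (2 ^ Module.finrank ℝ E) * ((∫⁻ c, φ c) / volume L) := by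
          rw [← hIntg, mul_div_assoc]
      _ ≤ _ := by gcongr
  refine ⟨c, ⟨?_, ?_, ?_, ?_⟩, hmain⟩
  · have e1 : {z : E | c + z ∈ L} = (Homeomorph.addLeft c) ⁻¹' L := rfl
    have e2 : IsClosed {z : E | c - z ∈ L} :=
      hc.isClosed.preimage (by fun_prop : Continuous fun z => c - z)
    have e3 : IsCompact {z : E | c + z ∈ L} := by
      rw [e1]; exact (Homeomorph.addLeft c).isCompact_preimage.2 hc
    exact e3.inter_right e2
  · intro x hx y hy a b ha hb hab
    have hcab : c = a • c + b • c := by rw [← add_smul, hab, one_smul]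
    constructor
    · have := hv hx.1 hy.1 ha hb hab
      convert this using 1
      nth_rw 1 [hcab]; simp only [smul_add]; abel
    · have := hv hx.2 hy.2 ha hb hab
      convert this using 1
      nth_rw 1 [hcab]; simp only [smul_sub]; abel
  · rintro x ⟨h1, h2⟩
    exact ⟨by rwa [← sub_eq_add_neg], by rwa [sub_neg_eq_add]⟩
  · rw [pos_iff_ne_zero]
    intro h0
    rw [show φ c = 0 from h0, mul_zero] at hmain
    exact hp.not_ge hmain

end P6
end MEll

set_option linter.unusedSectionVars false

namespace MEll

section P6
variable {E : Type*} [NormedAddCommGroup E] [InnerProductSpace ℝ E] [FiniteDimensional ℝ E]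
  [MeasurableSpace E] [BorelSpace E]

namespace LC
variable {f : E → ℝ}

theorem int_sqrt_le (h : LC f) (hf : ∫⁻ x, ENNReal.ofReal (f x) = 1) {M : ℝ} (hM : 1 ≤ M)
    {x0 : E} (hx0 : M / 2 ≤ f x0) :
    ∫⁻ x, ENNReal.ofReal (√(f x)) ≤ ENNReal.ofReal (2 ^ Module.finrank ℝ E / √(M / 2)) := by
  have h1 : 0 < √(M / 2) := Real.sqrt_pos.2 (by linarith)
  rw [ENNReal.ofReal_div_of_pos h1, ENNReal.le_div_iff_mul_le (by simp [h1]) (by simp)]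
  refine le_trans ?_ (h.int_sqrt_mul hf x0)
  gcongr

theorem level_bounds (h : LC f) (hf : ∫⁻ x, ENNReal.ofReal (f x) = 1) {M : ℝ} (hM : 1 ≤ M)
    (hfM : ∀ x, f x ≤ M) {x0 : E} (hx0 : M / 2 ≤ f x0) :
    volume {x | M / (8 * 4 ^ Module.finrank ℝ E) < f x} ≠ ⊤ ∧
    1 / (2 * M) ≤ (volume {x | M / (8 * 4 ^ Module.finrank ℝ E) < f x}).toReal ∧
    (volume {x | M / (8 * 4 ^ Module.finrank ℝ E) < f x}).toReal
      ≤ 8 * 4 ^ Module.finrank ℝ E / M := by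
  set n := Module.finrank ℝ E
  set s : ℝ := M / (8 * 4 ^ n) with hs
  have hs0 : 0 < s := by positivity
  set V := {x | s < f x} with hV
  have hVn : NullMeasurableSet V volume := (h.convex s).nullMeasurableSet volume
  have hup : ENNReal.ofReal s * volume V ≤ 1 := by
    rw [← hf]
    refine le_trans ?_ (mul_meas_ge_le_lintegral₀ h.aemeas.ennreal_ofReal (ENNReal.ofReal s))
    gcongr
    intro x hx
    exact ENNReal.ofReal_le_ofReal (le_of_lt hx)
  have hVt : volume V ≠ ⊤ := by
    intro ht
    rw [ht, ENNReal.mul_top (by simpa using hs0)] at hup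
    simp at hup
  have hlow : (1 : ENNReal) ≤ ENNReal.ofReal (1 / 2) + ENNReal.ofReal M * volume V := by
    calc (1 : ENNReal) = ∫⁻ x, ENNReal.ofReal (f x) := hf.symm
      _ ≤ ∫⁻ x, (ENNReal.ofReal √s * ENNReal.ofReal √(f x) +
            V.indicator (fun _ => ENNReal.ofReal M) x) := by
          apply lintegral_mono
          intro x
          beta_reduce
          by_cases hx : x ∈ V
          · rw [Set.indicator_of_mem hx]
            exact (ENNReal.ofReal_le_ofReal (hfM x)).trans le_add_self
          · rw [Set.indicator_of_notMem hx, add_zero, ← ENNReal.ofReal_mul (Real.sqrt_nonneg _)]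
            have hx' : f x ≤ s := not_lt.1 hx
            apply ENNReal.ofReal_le_ofReal
            calc f x = √(f x) * √(f x) := (Real.mul_self_sqrt (h.nonneg x)).symm
              _ ≤ _ := by gcongr
      _ = ENNReal.ofReal √s * (∫⁻ x, ENNReal.ofReal √(f x)) + ENNReal.ofReal M * volume V := by
          rw [lintegral_add_left' (h.aemeas.sqrt.ennreal_ofReal.const_mul _),
            lintegral_const_mul' _ _ ENNReal.ofReal_ne_top, lintegral_indicator_const₀ hVn]
      _ ≤ _ := by
          gcongr
          calc _ ≤ ENNReal.ofReal √s * ENNReal.ofReal (2 ^ n / √(M / 2)) := by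
                gcongr; exact h.int_sqrt_le hf hM hx0
            _ = ENNReal.ofReal (1 / 2) := by
                rw [← ENNReal.ofReal_mul (Real.sqrt_nonneg _)]
                congr 1
                have e : s = (M / 2) * (1 / (2 * 2 ^ n)) ^ 2 := by
                  rw [hs, show (4:ℝ) = 2 ^ 2 by norm_num, ← pow_mul, mul_comm 2 n, pow_mul]
                  field_simp; norm_num
                have h1 : 0 < √(M / 2) := Real.sqrt_pos.2 (by linarith)
                rw [e, Real.sqrt_mul (by linarith), Real.sqrt_sq (by positivity)]
                field_simp
  have hM0 : 0 < M := by linarith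
  refine ⟨hVt, ?_, ?_⟩
  · have := ENNReal.toReal_mono (by finiteness) hlow
    rw [ENNReal.toReal_add (by finiteness) (by finiteness), ENNReal.toReal_mul,
      ENNReal.toReal_ofReal (by norm_num), ENNReal.toReal_ofReal hM0.le, ENNReal.toReal_one] at this
    rw [div_le_iff₀ (by positivity)]
    linarith
  · have := ENNReal.toReal_mono (by finiteness) hup
    rw [ENNReal.toReal_mul, ENNReal.toReal_ofReal hs0.le, ENNReal.toReal_one] at this
    rw [le_div_iff₀ hM0]
    rw [hs, div_mul_eq_mul_div, div_le_one (by positivity)] at this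
    linarith

theorem position (h : LC f) (hf : ∫⁻ x, ENNReal.ofReal (f x) = 1)
    (hn : 1 ≤ Module.finrank ℝ E) {M : ℝ} (hM : 1 ≤ M)
    (hfM : ∀ x, f x ≤ M) {x0 : E} (hx0 : M / 2 ≤ f x0) :
    ∃ L : E →ₗ[ℝ] E, ∃ a : E, LinearMap.det L = 1 ∧
      ENNReal.ofReal (Real.exp (-(5 * Module.finrank ℝ E)) * (1 / 256) ^ Module.finrank ℝ E) ≤
        ∫⁻ x in {x | ‖L (x - a)‖ ≤ 512 * √(Module.finrank ℝ E)}, ENNReal.ofReal (f x) := by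
  obtain ⟨hVt, hV1, hV2⟩ := h.level_bounds hf hM hfM hx0
  set n := Module.finrank ℝ E with hnn
  have hn0 : (0 : ℝ) < n := by exact_mod_cast hn
  set s : ℝ := M / (8 * 4 ^ n) with hs
  have hM0 : 0 < M := by linarith
  have hs0 : 0 < s := by positivity
  set V := {x | s < f x} with hV
  have hVc : Convex ℝ V := h.convex s
  have hVp : 0 < (volume V).toReal := lt_of_lt_of_le (by positivity) hV1
  have hVp' : volume V ≠ 0 := fun h0 => by simp [h0] at hVp
  -- cut with a ball
  obtain ⟨k, hk⟩ : ∃ k : ℕ, volume V / 2 < volume (V ∩ Metric.ball 0 k) := by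
    have hmono : Monotone (fun k : ℕ => V ∩ Metric.ball (0 : E) k) := by
      intro i j hij
      exact Set.inter_subset_inter_right _ (Metric.ball_subset_ball (by exact_mod_cast hij))
    have ht := tendsto_measure_iUnion_atTop (μ := volume) hmono
    rw [← Set.inter_iUnion, Metric.iUnion_ball_nat, Set.inter_univ] at ht
    exact (ht.eventually (lt_mem_nhds (ENNReal.half_lt_self hVp' hVt))).exists
  set W := V ∩ Metric.ball (0 : E) k with hW
  have hWc : Convex ℝ W := hVc.inter (convex_ball _ _)
  have hfr : volume (frontier W) = 0 := hWc.addHaar_frontier volume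
  have hcl : (closure W : Set E) =ᵐ[volume] W := closure_ae_eq_of_null_frontier hfr
  have hclv : volume (closure W) = volume W := measure_congr hcl
  have hcpt : IsCompact (closure W) :=
    (Metric.isBounded_ball.subset Set.inter_subset_right).isCompact_closure
  have hpos : 0 < volume (closure W) := by
    rw [hclv]; exact lt_of_le_of_lt bot_le hk
  obtain ⟨c, hK, hKv⟩ := exists_sym hcpt hWc.closure hpos
  set K := {z : E | c + z ∈ closure W ∧ c - z ∈ closure W} with hKdef
  have hKt : volume K ≠ ⊤ := hK.cpt.measure_lt_top.ne
  obtain ⟨L, b, hL, hcore⟩ := hK.core hn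
  have hWV : volume W ≤ volume V := measure_mono Set.inter_subset_left
  have hWt : volume W ≠ ⊤ := ne_top_of_le_ne_top hVt hWV
  -- bounds on vol K
  have hKle : volume K ≤ volume W := by
    rw [← hclv, ← measure_preimage_add volume c (closure W)]
    exact measure_mono fun z hz => hz.1
  have hk1 : (volume K).toReal ≤ 8 * 4 ^ n / M :=
    (ENNReal.toReal_mono hVt (hKle.trans hWV)).trans hV2
  have hk2 : 1 / (4 * M) ≤ 2 ^ n * (volume K).toReal := by
    have h1 : volume V / 2 ≤ ENNReal.ofReal (2 ^ n) * volume K := by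
      rw [hclv] at hKv; exact hk.le.trans hKv
    have h2 := ENNReal.toReal_mono (by finiteness) h1
    rw [ENNReal.toReal_div, ENNReal.toReal_mul, ENNReal.toReal_ofReal (by positivity)] at h2
    have h3 : 1 / (4 * M) = 1 / (2 * M) / 2 := by field_simp; norm_num
    rw [h3]
    refine le_trans ?_ h2
    simp only [ENNReal.toReal_ofNat]
    linarith
  have hk3 : (volume K).toReal ^ (2 / (n : ℝ)) ≤ 1024 := by
    have h1 : (volume K).toReal ≤ 32 ^ n := by
      calc (volume K).toReal ≤ 8 * 4 ^ n / M := hk1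
        _ ≤ 8 * 4 ^ n := div_le_self (by positivity) hM
        _ ≤ 8 ^ n * 4 ^ n := by
            gcongr
            exact le_self_pow₀ (by norm_num) (by omega)
        _ = 32 ^ n := by rw [← mul_pow]; norm_num
    calc (volume K).toReal ^ (2 / (n : ℝ)) ≤ ((32 : ℝ) ^ n) ^ (2 / (n : ℝ)) := by
          gcongr
      _ = 1024 := by
          rw [← Real.rpow_natCast, ← Real.rpow_mul (by norm_num), mul_div_cancel₀ _ hn0.ne']
          norm_num
  refine ⟨L, c + b, hL, ?_⟩
  set S := {x : E | ‖L (x - (c + b))‖ ≤ 512 * √n} with hS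
  have hLm : Continuous L := L.continuous_of_finiteDimensional
  have hSm : MeasurableSet S :=
    (isClosed_le ((hLm.comp (by fun_prop)).norm) continuous_const).measurableSet
  set T := K ∩ {z | ‖L (z - b)‖ ^ 2 ≤ 256 * n * (volume K).toReal ^ (2 / (n : ℝ))} with hT
  have hTS : volume T ≤ volume (V ∩ S) := by
    calc volume T ≤ volume ((fun z => c + z) ⁻¹' (closure W ∩ S)) := by
          apply measure_mono
          rintro z ⟨hz1, hz2⟩
          refine ⟨hz1.1, ?_⟩
          simp only [hS, Set.mem_ofPred_eq] at hz2 ⊢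
          rw [add_sub_add_left_eq_sub]
          apply le_of_sq_le_sq _ (by positivity)
          rw [mul_pow, Real.sq_sqrt hn0.le]
          refine hz2.trans ?_
          calc _ ≤ 256 * (n : ℝ) * 1024 := by gcongr
            _ ≤ _ := by nlinarith
      _ = volume (closure W ∩ S) := measure_preimage_add volume c _
      _ = volume (W ∩ S) := measure_congr (hcl.inter (Filter.EventuallyEq.refl _ _))
      _ ≤ _ := measure_mono (Set.inter_subset_inter_left _ Set.inter_subset_left)
  have hVSt : volume (V ∩ S) ≠ ⊤ := ne_top_of_le_ne_top hVt (measure_mono Set.inter_subset_left)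
  have hfin : ENNReal.ofReal s * volume (V ∩ S) ≤ ∫⁻ x in S, ENNReal.ofReal (f x) := by
    refine le_trans ?_ (mul_meas_ge_le_lintegral₀ h.aemeas.ennreal_ofReal.restrict
      (ENNReal.ofReal s))
    rw [Measure.restrict_apply' hSm]
    gcongr
    intro x hx
    exact ENNReal.ofReal_le_ofReal (le_of_lt hx)
  refine le_trans ?_ hfin
  rw [← ENNReal.ofReal_toReal hVSt, ← ENNReal.ofReal_mul hs0.le]
  apply ENNReal.ofReal_le_ofReal
  have h5 : Real.exp (-(5 * n)) * (volume K).toReal ≤ (volume (V ∩ S)).toReal :=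
    hcore.trans (ENNReal.toReal_mono hVSt hTS)
  calc Real.exp (-(5 * n)) * (1 / 256) ^ n
      ≤ Real.exp (-(5 * n)) * (s * (1 / (4 * M) / 2 ^ n)) := by
        gcongr
        rw [hs]
        have : (M / (8 * 4 ^ n) * (1 / (4 * M) / 2 ^ n) : ℝ) = (1 / 32) * (1 / 8) ^ n := by
          have : (8 : ℝ) ^ n = 4 ^ n * 2 ^ n := by rw [← mul_pow]; norm_num
          rw [one_div_pow, this]
          field_simp; norm_num
        rw [this]
        have : (1 / 256 : ℝ) ^ n = (1 / 32) ^ n * (1 / 8) ^ n := by rw [← mul_pow]; norm_num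
        rw [this]
        gcongr
        exact pow_le_of_le_one (by norm_num) (by norm_num) (by omega)
    _ ≤ Real.exp (-(5 * n)) * (s * (volume K).toReal) := by
        gcongr
        rw [div_le_iff₀ (by positivity)]
        linarith
    _ = s * (Real.exp (-(5 * n)) * (volume K).toReal) := by ring
    _ ≤ _ := by gcongr

end LC
end P6
end MEll

set_option linter.unusedSectionVars false

namespace MEll

section P7
variable {E : Type*} [NormedAddCommGroup E] [InnerProductSpace ℝ E] [FiniteDimensional ℝ E]
  [MeasurableSpace E] [BorelSpace E]

theorem measurable_ballMeas (ν : Measure E) [SFinite ν] (R : ℝ) :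
    Measurable (fun z : E => ν (Metric.ball z R)) := by
  have hs : MeasurableSet {p : E × E | dist p.2 p.1 < R} :=
    (isOpen_lt (by fun_prop) continuous_const).measurableSet
  exact measurable_measure_prodMk_left hs

theorem lintegral_ballMeas (ν : Measure E) [SFinite ν] (R : ℝ) {s : Set E} (hsm : MeasurableSet s) :
    ∫⁻ z in s, ν (Metric.ball z R) = ∫⁻ y, volume (s ∩ Metric.ball y R) ∂ν := by
  have hs' : MeasurableSet {p : E × E | dist p.2 p.1 < R} :=
    (isOpen_lt (by fun_prop) continuous_const).measurableSet
  have hs : MeasurableSet {p : E × E | p.1 ∈ s ∧ dist p.2 p.1 < R} :=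
    (measurable_fst hsm).inter hs'
  have h1 := Measure.prod_apply (μ := (volume : Measure E)) (ν := ν) hs
  have h2 := Measure.prod_apply_symm (μ := (volume : Measure E)) (ν := ν) hs
  rw [h1] at h2
  rw [← lintegral_indicator hsm]
  have e1 : ∀ z, s.indicator (fun z => ν (Metric.ball z R)) z =
      ν (Prod.mk z ⁻¹' {p : E × E | p.1 ∈ s ∧ dist p.2 p.1 < R}) := by
    intro z
    by_cases hz : z ∈ s
    · rw [Set.indicator_of_mem hz]
      congr 1; ext y; simp [hz]
    · rw [Set.indicator_of_notMem hz]
      symm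
      convert measure_empty (μ := ν)
      ext y; simp [hz]
  have e2 : ∀ y, volume (s ∩ Metric.ball y R) =
      volume ((fun x => (x, y)) ⁻¹' {p : E × E | p.1 ∈ s ∧ dist p.2 p.1 < R}) := by
    intro y
    congr 1; ext z; simp [dist_comm]
  simp_rw [e1, e2]
  exact h2

theorem lintegral_ballMeas_univ (ν : Measure E) [SFinite ν] (R : ℝ) :
    ∫⁻ z, ν (Metric.ball z R) = volume (Metric.ball (0 : E) R) * ν Set.univ := by
  have := lintegral_ballMeas ν R MeasurableSet.univ
  simp only [Set.univ_inter, Measure.restrict_univ] at this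
  rw [this]
  simp only [Measure.addHaar_ball_center, lintegral_const]

theorem r_lower {r : ℝ} (_ : 0 < r) (hv : volume (Metric.ball (0 : E) r) = 1) :
    (Module.finrank ℝ E : ℝ) ≤ 25 * r ^ 2 := by
  set n := Module.finrank ℝ E with hn
  set b : ℝ := π * Real.exp 1 with hb
  have hb0 : 0 < b := by positivity
  have h1 := GaussianFourier.integral_rexp_neg_mul_sq_norm (V := E) hb0
  have h2 : ∫ v in Metric.ball (0 : E) r, Real.exp (-b * r ^ 2) ≤
      ∫ v : E, Real.exp (-b * ‖v‖ ^ 2) := by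
    have hi := integrable_gauss (E := E) b hb0
    calc _ ≤ ∫ v in Metric.ball (0 : E) r, Real.exp (-b * ‖v‖ ^ 2) := by
          apply setIntegral_mono_on _ hi.integrableOn measurableSet_ball
          · intro v hv
            have hv' : ‖v‖ < r := by simpa using hv
            rw [Real.exp_le_exp]
            have : ‖v‖ ^ 2 ≤ r ^ 2 := by gcongr
            nlinarith
          · exact integrableOn_const (by simp [hv]) 
      _ ≤ _ := setIntegral_le_integral hi (Filter.Eventually.of_forall fun v => (Real.exp_pos _).le)
  rw [h1] at h2
  have h3 : π / b = Real.exp (-1) := by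
    rw [hb, Real.exp_neg]; field_simp
  simp only [setIntegral_const, measureReal_def, hv, ENNReal.toReal_one, one_smul] at h2
  rw [h3, ← Real.exp_mul, Real.exp_le_exp] at h2
  have h4 : b ≤ 12.5 := by
    have := Real.exp_one_lt_d9
    have := Real.pi_lt_d2
    have := Real.exp_pos 1
    nlinarith [Real.pi_pos]
  nlinarith [sq_nonneg r]

end P7
end MEll

set_option linter.unusedSectionVars false

namespace MEll

section P7
variable {E : Type*} [NormedAddCommGroup E] [InnerProductSpace ℝ E] [FiniteDimensional ℝ E]
  [MeasurableSpace E] [BorelSpace E]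

namespace LC
variable {g : E → ℝ}

/-- mass of `g` in the ball `B(z, R)`. -/
noncomputable def bm (g : E → ℝ) (R : ℝ) (z : E) : ℝ :=
  (volume.withDensity (fun x => ENNReal.ofReal (g x)) (Metric.ball z R)).toReal

theorem bm_facts (g : E → ℝ) (hg : AEMeasurable g volume) (hg0 : ∀ x, 0 ≤ g x)
    (hfin : ∫⁻ x, ENNReal.ofReal (g x) ≠ ⊤) (R : ℝ) :
    Integrable g volume ∧
    (∀ z, bm g R z = ∫ y in Metric.ball z R, g y) ∧ Integrable (bm g R) volume ∧
    ∫ z, bm g R z = (volume (Metric.ball (0 : E) R)).toReal * (∫⁻ x, ENNReal.ofReal (g x)).toReal := by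
  have hi : Integrable g volume := by
    refine ⟨hg.aestronglyMeasurable, ?_⟩
    rw [hasFiniteIntegral_iff_ofReal (Filter.Eventually.of_forall hg0)]
    exact hfin.lt_top
  set ν := volume.withDensity (fun x => ENNReal.ofReal (g x)) with hν
  have hνu : ν Set.univ = ∫⁻ x, ENNReal.ofReal (g x) := by
    rw [hν, withDensity_apply _ MeasurableSet.univ, Measure.restrict_univ]
  have : IsFiniteMeasure ν := ⟨by rw [hνu]; exact hfin.lt_top⟩
  have hm := measurable_ballMeas ν R
  have hl := lintegral_ballMeas_univ ν R
  have hlt : ∫⁻ z, ν (Metric.ball z R) ≠ ⊤ := by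
    rw [hl]; exact ENNReal.mul_ne_top measure_ball_lt_top.ne (measure_ne_top _ _)
  refine ⟨hi, ?_, integrable_toReal_of_lintegral_ne_top hm.aemeasurable hlt, ?_⟩
  · intro z
    rw [integral_eq_lintegral_of_nonneg_ae (Filter.Eventually.of_forall hg0)
      hg.aestronglyMeasurable.restrict]
    unfold bm
    rw [withDensity_apply _ measurableSet_ball]
  · have : ∫ z, bm g R z = (∫⁻ z, ν (Metric.ball z R)).toReal :=
      integral_toReal hm.aemeasurable (Filter.Eventually.of_forall fun z => measure_lt_top _ _)
    rw [this, hl, ENNReal.toReal_mul, hνu]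

/-- The doubled-ball function. -/
theorem bm_half (g : E → ℝ) (hg : AEMeasurable g volume) (hg0 : ∀ x, 0 ≤ g x)
    (hfin : ∫⁻ x, ENNReal.ofReal (g x) = 1) (R : ℝ) :
    Integrable (fun z => bm g R ((1 / 2 : ℝ) • z)) volume ∧
    ∫ z, bm g R ((1 / 2 : ℝ) • z)
      = 2 ^ Module.finrank ℝ E * (volume (Metric.ball (0 : E) R)).toReal := by
  obtain ⟨-, -, h3, h4⟩ := bm_facts g hg hg0 (by rw [hfin]; simp) R
  refine ⟨h3.comp_smul (by norm_num), ?_⟩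
  rw [Measure.integral_comp_smul, h4, hfin, ENNReal.toReal_one, mul_one, smul_eq_mul]
  congr 1
  rw [abs_of_pos (by positivity)]
  simp

/-- Pointwise comparison of `√g` with the doubled-ball function. -/
theorem sqrt_le_q (h : LC g) (hf : ∫⁻ x, ENNReal.ofReal (g x) = 1) {M : ℝ} (hM : 1 ≤ M)
    (hgM : ∀ x, g x ≤ M) {c0 ρ r : ℝ} (hc0 : 0 < c0)
    (hA : ENNReal.ofReal c0 ≤ ∫⁻ x in Metric.closedBall (0 : E) ρ, ENNReal.ofReal (g x))
    {y z : E} (hy : y ∈ Metric.ball z r) :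
    √(g y) ≤ 2 ^ Module.finrank ℝ E * √M / c0 * bm g ((ρ + r) / 2) ((1 / 2 : ℝ) • z) := by
  have hM0 : 0 < M := by linarith
  have hsM : 0 < √M := Real.sqrt_pos.2 hM0
  set ν := volume.withDensity (fun x => ENNReal.ofReal (g x)) with hν
  have hνu : ν Set.univ = 1 := by
    rw [hν, withDensity_apply _ MeasurableSet.univ, Measure.restrict_univ, hf]
  have : IsFiniteMeasure ν := ⟨by rw [hνu]; simp⟩
  set B := Metric.ball ((1 / 2 : ℝ) • z) ((ρ + r) / 2) with hB
  have key : ENNReal.ofReal √(g y) * (ENNReal.ofReal c0) ≤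
      ENNReal.ofReal √M * (ENNReal.ofReal (2 ^ Module.finrank ℝ E) * ν B) := by
    calc ENNReal.ofReal √(g y) * (ENNReal.ofReal c0)
        ≤ ENNReal.ofReal √(g y) * ∫⁻ x in Metric.closedBall (0 : E) ρ, ENNReal.ofReal (g x) := by
          gcongr
      _ = ∫⁻ x in Metric.closedBall (0 : E) ρ, ENNReal.ofReal √(g y) * ENNReal.ofReal (g x) := by
          rw [lintegral_const_mul' _ _ ENNReal.ofReal_ne_top]
      _ ≤ ∫⁻ x in Metric.closedBall (0 : E) ρ, ENNReal.ofReal √M *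
            B.indicator (fun x => ENNReal.ofReal (g x)) ((1 / 2 : ℝ) • x + (1 / 2 : ℝ) • y) := by
          apply setLIntegral_mono' measurableSet_closedBall
          intro x hx
          have hxB : (1 / 2 : ℝ) • x + (1 / 2 : ℝ) • y ∈ B := by
            rw [hB, mem_ball_iff_norm]
            rw [mem_ball_iff_norm] at hy
            have hx' : ‖x‖ ≤ ρ := by simpa using hx
            have : (1 / 2 : ℝ) • x + (1 / 2 : ℝ) • y - (1 / 2 : ℝ) • z
                = (1 / 2 : ℝ) • (x + (y - z)) := by
              simp only [smul_add, smul_sub]; abel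
            rw [this, norm_smul]
            have h2 := norm_add_le x (y - z)
            norm_num
            linarith
          rw [Set.indicator_of_mem hxB, ← ENNReal.ofReal_mul (Real.sqrt_nonneg _),
            ← ENNReal.ofReal_mul (Real.sqrt_nonneg _)]
          apply ENNReal.ofReal_le_ofReal
          calc √(g y) * g x = √(g x) * (√(g x) * √(g y)) := by
                rw [← mul_assoc, Real.mul_self_sqrt (h.nonneg x), mul_comm]
            _ ≤ √M * g ((1 / 2 : ℝ) • x + (1 / 2 : ℝ) • y) := by
                gcongr
                · exact hgM x
                · exact h.sqrt_mul_le x y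
      _ ≤ ∫⁻ x, ENNReal.ofReal √M *
            B.indicator (fun x => ENNReal.ofReal (g x)) ((1 / 2 : ℝ) • x + (1 / 2 : ℝ) • y) :=
          setLIntegral_le_lintegral _ _
      _ = _ := by
          rw [lintegral_const_mul' _ _ ENNReal.ofReal_ne_top,
            lintegral_half_shift (B.indicator (fun x => ENNReal.ofReal (g x))),
            lintegral_indicator measurableSet_ball, hν, withDensity_apply _ measurableSet_ball]
  have h2 := ENNReal.toReal_mono (by finiteness) key
  simp only [ENNReal.toReal_mul] at h2
  rw [ENNReal.toReal_ofReal (by positivity), ENNReal.toReal_ofReal (by positivity),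
    ENNReal.toReal_ofReal (by positivity), ENNReal.toReal_ofReal (by positivity)] at h2
  rw [div_mul_eq_mul_div, le_div_iff₀ hc0]
  have h3 : bm g ((ρ + r) / 2) ((1 / 2 : ℝ) • z) = (ν B).toReal := rfl
  rw [h3]
  linarith

theorem entropy_le (h : LC g) (hf : ∫⁻ x, ENNReal.ofReal (g x) = 1) {M : ℝ} (hM : 1 ≤ M)
    (hgM : ∀ x, g x ≤ M) {c0 ρ r : ℝ} (hc0 : 0 < c0) (hρ : 0 ≤ ρ) (hr : 0 < r)
    (hA : ENNReal.ofReal c0 ≤ ∫⁻ x in Metric.closedBall (0 : E) ρ, ENNReal.ofReal (g x))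
    (hv : volume (Metric.ball (0 : E) r) = 1)
    (hIntg : Integrable (fun z => bm g r z * Real.log (bm g r z)) volume) :
    -∫ z, bm g r z * Real.log (bm g r z) ≤
      Real.log ((1 + ρ / r) ^ Module.finrank ℝ E * (2 ^ Module.finrank ℝ E * √M / c0) *
        (∫⁻ x, ENNReal.ofReal √(g x)).toReal) := by
  set n := Module.finrank ℝ E with hn
  set J := (∫⁻ x, ENNReal.ofReal √(g x)).toReal with hJ
  have hJlt := (h.int_sqrt_lt_top hf).ne
  have hJ0 : 0 < J := ENNReal.toReal_pos (h.int_sqrt_pos hf).ne' hJlt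
  have hsM : 0 < √M := Real.sqrt_pos.2 (by linarith)
  set κ := 2 ^ n * √M / c0 with hκ
  have hκ0 : 0 < κ := by positivity
  set Q := (1 + ρ / r) ^ n with hQ
  have hQ0 : 0 < Q := by positivity
  set B := Real.log (Q * κ * J) with hB
  set R := (ρ + r) / 2 with hR
  set q := fun z : E => bm g R ((1 / 2 : ℝ) • z) with hq
  obtain ⟨ig, pe, ip, pint⟩ := bm_facts g h.aemeas h.nonneg (by rw [hf]; simp) r
  obtain ⟨isg, ke, ik, kint⟩ := bm_facts (fun x => √(g x)) h.aemeas.sqrt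
    (fun x => Real.sqrt_nonneg _) hJlt r
  obtain ⟨iq, qint⟩ := bm_half g h.aemeas h.nonneg hf R
  have hqQ : ∫ z, q z = Q := by
    rw [hq, qint, hQ]
    have h1 : volume (Metric.ball (0 : E) R) = ENNReal.ofReal ((R / r) ^ n) := by
      have h2 := Measure.addHaar_ball_mul_of_pos (volume : Measure E) (0 : E)
        (show 0 < R / r by positivity) r
      rw [div_mul_cancel₀ _ hr.ne', hv, mul_one] at h2
      exact h2
    rw [h1, ENNReal.toReal_ofReal (by positivity), ← mul_pow, hR]
    congr 1
    field_simp
    ring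
  rw [hv, hf, ENNReal.toReal_one, mul_one] at pint
  rw [hv, ENNReal.toReal_one, one_mul] at kint
  have hp0 : ∀ z, 0 ≤ bm g r z := fun z => ENNReal.toReal_nonneg
  have hq0 : ∀ z, 0 ≤ q z := fun z => ENNReal.toReal_nonneg
  have hk0 : ∀ z, 0 ≤ bm (fun x => √(g x)) r z := fun z => ENNReal.toReal_nonneg
  have point : ∀ z, -(bm g r z * Real.log (bm g r z)) ≤
      q z / Q - bm g r z + ((B - 1) * bm g r z + bm (fun x => √(g x)) r z / J) := by
    intro z
    rcases (hp0 z).eq_or_lt with hz | hz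
    · rw [← hz]
      have := hq0 z
      have := hk0 z
      simp only [zero_mul, neg_zero, sub_zero, mul_zero, zero_add]
      positivity
    -- q z > 0
    have hqz : 0 < q z := by
      by_contra hc
      have hc' : q z = 0 := le_antisymm (not_lt.1 hc) (hq0 z)
      have h0 : ∀ y ∈ Metric.ball z r, g y = 0 := by
        intro y hy
        have h1 : √(g y) ≤ κ * q z := h.sqrt_le_q hf hM hgM hc0 hA hy
        rw [hc', mul_zero] at h1
        exact le_antisymm (Real.sqrt_eq_zero'.1 (le_antisymm h1 (Real.sqrt_nonneg _))) (h.nonneg y)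
      rw [pe, setIntegral_congr_fun measurableSet_ball h0] at hz
      simp at hz
    have step1 : -(bm g r z * Real.log (bm g r z)) ≤
        q z / Q - bm g r z + bm g r z * (-Real.log (q z / Q)) := by
      have h1 := Real.log_le_sub_one_of_pos (show 0 < (q z / Q) / bm g r z by positivity)
      rw [Real.log_div (by positivity) hz.ne'] at h1
      have h2 := mul_le_mul_of_nonneg_left h1 hz.le
      have h3 : bm g r z * (q z / Q / bm g r z - 1) = q z / Q - bm g r z := by field_simp
      rw [h3] at h2
      linarith
    have step2 : bm g r z * (-Real.log (q z / Q)) ≤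
        (B - 1) * bm g r z + bm (fun x => √(g x)) r z / J := by
      rw [pe, ke, ← integral_mul_const, ← integral_const_mul, ← integral_div,
        ← integral_add (ig.integrableOn.const_mul _) (isg.integrableOn.div_const _)]
      apply setIntegral_mono_on (ig.integrableOn.mul_const _)
        ((ig.integrableOn.const_mul _).add (isg.integrableOn.div_const _)) measurableSet_ball
      intro y hy
      rcases (h.nonneg y).eq_or_lt with hgy | hgy
      · simp [← hgy]
      have h1 : √(g y) ≤ κ * q z := h.sqrt_le_q hf hM hgM hc0 hA hy
      have hs : 0 < √(g y) := Real.sqrt_pos.2 hgy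
      have h2 : -Real.log (q z / Q) ≤ B + Real.log (1 / (J * √(g y))) := by
        rw [hB, ← Real.log_inv, ← Real.log_mul (by positivity) (by positivity)]
        apply Real.log_le_log (by positivity)
        rw [inv_div, div_le_iff₀ hqz]
        have : Q * κ * J * (1 / (J * √(g y))) * q z = Q * (κ * q z / √(g y)) := by
          field_simp
        rw [this]
        apply le_mul_of_one_le_right hQ0.le
        rwa [one_le_div hs]
      have h3 := Real.log_le_sub_one_of_pos (show 0 < 1 / (J * √(g y)) by positivity)
      have h4 := mul_le_mul_of_nonneg_left (h2.trans (add_le_add_right h3 B)) hgy.le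
      refine h4.trans (le_of_eq ?_)
      have h5 : g y * (1 / (J * √(g y))) = √(g y) / J := by
        nth_rw 1 [← Real.mul_self_sqrt hgy.le]
        field_simp
      rw [mul_add, mul_sub, h5, Pi.add_apply]
      ring
    linarith
  have i1 : Integrable (fun z => q z / Q - bm g r z) volume := (iq.div_const _).sub ip
  have i2 : Integrable (fun z => (B - 1) * bm g r z + bm (fun x => √(g x)) r z / J) volume :=
    (ip.const_mul _).add (ik.div_const _)
  have hfinal := integral_mono hIntg.neg (i1.add i2) point
  simp only [Pi.add_apply, Pi.neg_apply] at hfinal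
  rw [integral_neg, integral_add i1 i2, integral_sub (iq.div_const _) ip,
    integral_add (ip.const_mul _) (ik.div_const _), integral_div, integral_div,
    integral_const_mul, pint, kint] at hfinal
  rw [show ∫ z, q z = Q from hqQ, div_self hQ0.ne', div_self hJ0.ne'] at hfinal
  linarith

end LC
end P7
end MEll

set_option linter.unusedSectionVars false

namespace MEll

section P8
variable {E : Type*} [NormedAddCommGroup E] [InnerProductSpace ℝ E] [FiniteDimensional ℝ E]
  [MeasurableSpace E] [BorelSpace E]

theorem map_sum_ball {Ω : Type*} [MeasurableSpace Ω] (P : Measure Ω) [IsProbabilityMeasure P]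
    (Y Z : Ω → E) (hY : Measurable Y) (hZ : Measurable Z) (hI : IndepFun Y Z P) {r : ℝ}
    (hZm : P.map Z = volume.restrict (Metric.ball (0 : E) r)) :
    P.map (fun ω => Y ω + Z ω) = volume.withDensity (fun z => (P.map Y) (Metric.ball z r)) := by
  have hYp : IsProbabilityMeasure (P.map Y) := Measure.isProbabilityMeasure_map hY.aemeasurable
  have hZp : IsProbabilityMeasure (P.map Z) := Measure.isProbabilityMeasure_map hZ.aemeasurable
  have hprod := (indepFun_iff_map_prod_eq_prod_map_map hY.aemeasurable hZ.aemeasurable).1 hI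
  ext s hs
  rw [withDensity_apply _ hs, lintegral_ballMeas _ _ hs]
  have hs2 : MeasurableSet {p : E × E | p.1 + p.2 ∈ s} :=
    (by fun_prop : Measurable fun p : E × E => p.1 + p.2) hs
  have e1 : P.map (fun ω => Y ω + Z ω) s = (P.map (fun ω => (Y ω, Z ω))) {p | p.1 + p.2 ∈ s} := by
    rw [Measure.map_apply (by fun_prop) hs, Measure.map_apply (by fun_prop) hs2]
    rfl
  rw [e1, hprod, Measure.prod_apply hs2]
  congr 1
  ext y
  rw [hZm, Measure.restrict_apply' measurableSet_ball, ← measure_preimage_add volume y (s ∩ _)]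
  congr 1
  ext z
  simp

theorem exists_homeo (L : E →ₗ[ℝ] E) (hL : LinearMap.det L = 1) (a : E) :
    ∃ (U : E ≃ₜ E) (u : E →ᵃ[ℝ] E), (∀ x, U x = L (x - a)) ∧ (∀ x, u x = L (x - a)) ∧
      MeasurePreserving U volume volume ∧
      (∀ (x y : E) (t : ℝ), U.symm (t • x + (1 - t) • y) = t • U.symm x + (1 - t) • U.symm y) := by
  let e : E ≃L[ℝ] E :=
    (LinearMap.equivOfDetNeZero L (by rw [hL]; exact one_ne_zero)).toContinuousLinearEquiv
  have he : ∀ x, e x = L x := fun x => rfl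
  let U : E ≃ₜ E := (Homeomorph.addRight (-a)).trans e.toHomeomorph
  have hU : ∀ x, U x = L (x - a) := by
    intro x
    rw [sub_eq_add_neg]; rfl
  refine ⟨U, L.toAffineMap + AffineMap.const ℝ E (-(L a)), hU, ?_, ?_, ?_⟩
  · intro x
    simp [sub_eq_add_neg]
  · have h1 : MeasurePreserving (fun x : E => x + -a) volume volume :=
      measurePreserving_add_right volume (-a)
    have h2 : MeasurePreserving (L : E → E) volume volume := by
      refine ⟨L.continuous_of_finiteDimensional.measurable, ?_⟩
      rw [Measure.map_linearMap_addHaar_eq_smul_addHaar volume (by rw [hL]; exact one_ne_zero), hL]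
      simp
    exact h2.comp h1
  · intro x y t
    apply U.injective
    rw [U.apply_symm_apply, hU]
    have hx := U.apply_symm_apply x
    have hy := U.apply_symm_apply y
    rw [hU] at hx hy
    nth_rw 1 [← hx]
    nth_rw 1 [← hy]
    rw [← map_smul, ← map_smul, ← map_add]
    congr 1
    module

theorem const_bound {n : ℕ} (hn : 1 ≤ n) {M r J : ℝ} (hM : 1 ≤ M) (hr : 0 < r)
    (hr2 : (n : ℝ) ≤ 25 * r ^ 2) (hJ0 : 0 < J) (hJ : J ≤ 2 ^ n / √(M / 2)) :
    2 * Real.log ((1 + 512 * √n / r) ^ n *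
      (2 ^ n * √M / (Real.exp (-(5 * n)) * (1 / 256) ^ n)) * J) / n
      ≤ 2 * Real.log (2561 * 2048 * Real.exp 5) := by
  have hn0 : (0 : ℝ) < n := by exact_mod_cast hn
  have hsM : 0 < √M := Real.sqrt_pos.2 (by linarith)
  have h1 : √n / r ≤ 5 := by
    rw [div_le_iff₀ hr]
    apply Real.sqrt_le_iff.2 ⟨by positivity, ?_⟩
    nlinarith
  have h2 : (1 + 512 * √n / r) ≤ 2561 := by
    rw [mul_div_assoc]; linarith
  have h3 : √M * J ≤ 2 ^ n * 2 ^ n := by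
    have h4 : √(M / 2) = √M / √2 := Real.sqrt_div (by linarith) _
    have h5 : √2 ≤ (2 : ℝ) ^ n := by
      calc √2 ≤ 2 := by rw [Real.sqrt_le_left (by norm_num)]; norm_num
        _ ≤ 2 ^ n := le_self_pow₀ (by norm_num) (by omega)
    calc √M * J ≤ √M * (2 ^ n / √(M / 2)) := by gcongr
      _ = 2 ^ n * √2 := by rw [h4]; field_simp
      _ ≤ _ := by gcongr
  have hexp : Real.exp (-(5 * n)) = (Real.exp 5)⁻¹ ^ n := by
    rw [← Real.exp_neg, ← Real.exp_nat_mul]; congr 1; ring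
  have h6 : (1 + 512 * √n / r) ^ n *
      (2 ^ n * √M / (Real.exp (-(5 * n)) * (1 / 256) ^ n)) * J
      ≤ (2561 * 2048 * Real.exp 5) ^ n := by
    calc _ = (1 + 512 * √n / r) ^ n * (2 ^ n / (Real.exp (-(5 * n)) * (1 / 256) ^ n)) * (√M * J) := by
          ring
      _ ≤ 2561 ^ n * (2 ^ n / (Real.exp (-(5 * n)) * (1 / 256) ^ n)) * (2 ^ n * 2 ^ n) := by
          gcongr
      _ = (2561 * 2048 * Real.exp 5) ^ n := by
          rw [hexp, ← mul_pow, ← div_pow, ← mul_pow, ← mul_pow, ← mul_pow]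
          congr 1
          field_simp
          norm_num
  rw [mul_div_assoc]
  gcongr
  rw [div_le_iff₀ hn0, mul_comm (Real.log _) (n : ℝ), ← Real.log_pow]
  apply Real.log_le_log (by positivity) h6

end P8
end MEll

namespace MEll

theorem LC_of {n : ℕ} {f : EuclideanSpace ℝ (Fin n) → ℝ} (h : IsLogConcave f) : LC f :=
  ⟨h.1, h.2⟩

end MEll

open MEll

theorem entropy_power_of_sum_with_ball_bounded :
    ∃ C : ℝ, 0 < C ∧
    ∀ (n : ℕ), 1 ≤ n →
    ∀ (Ω : Type) [MeasureSpace Ω], IsProbabilityMeasure (ℙ : Measure Ω) →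
    ∀ (X Z : Ω → EuclideanSpace ℝ (Fin n))
      (f : EuclideanSpace ℝ (Fin n) → ℝ) (r : ℝ),
      Measurable X → Measurable Z →
      IsLogConcave f →
      Measure.map X (ℙ : Measure Ω)
        = volume.withDensity (fun x => ENNReal.ofReal (f x)) →
      1 ≤ essSup (fun x => ENNReal.ofReal (f x)) volume →
      0 < r →
      volume (Metric.ball (0 : EuclideanSpace ℝ (Fin n)) r) = 1 →
      Measure.map Z (ℙ : Measure Ω)
        = volume.restrict (Metric.ball (0 : EuclideanSpace ℝ (Fin n)) r) →
      ProbabilityTheory.IndepFun X Z (ℙ : Measure Ω) →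
      ∃ (u : EuclideanSpace ℝ (Fin n) →ᵃ[ℝ] EuclideanSpace ℝ (Fin n)),
        MeasurePreserving u volume volume ∧
        entPow (Measure.map (fun ω => u (X ω) + Z ω) (ℙ : Measure Ω)) ≤ C := by
  refine ⟨Real.exp (2 * Real.log (2561 * 2048 * Real.exp 5)), Real.exp_pos _, ?_⟩
  intro n hn Ω _ hP X Z f r hX hZ hlc hXm hess hr hv hZm hI
  have hn' : Module.finrank ℝ (EuclideanSpace ℝ (Fin n)) = n := by simp
  have h : LC f := LC_of hlc
  have hXp : IsProbabilityMeasure (Measure.map X (ℙ : Measure Ω)) :=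
    Measure.isProbabilityMeasure_map hX.aemeasurable
  have hf : ∫⁻ x, ENNReal.ofReal (f x) = 1 := by
    have := hXp.measure_univ
    rwa [hXm, withDensity_apply _ MeasurableSet.univ, Measure.restrict_univ] at this
  obtain ⟨M, hM, hfM, x0, hx0⟩ := h.exists_sup hf hess
  obtain ⟨L, a, hL, hA⟩ := h.position hf (by rw [hn']; exact hn) hM hfM hx0
  obtain ⟨U, u, hU, hu, hUm, haff⟩ := exists_homeo L hL a
  have huU : (u : EuclideanSpace ℝ (Fin n) → EuclideanSpace ℝ (Fin n)) = U := by
    ext1 x; rw [hU, hu]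
  refine ⟨u, by rw [huU]; exact hUm, ?_⟩
  rw [huU]
  have hUe : MeasurableEmbedding U := U.measurableEmbedding
  set g : EuclideanSpace ℝ (Fin n) → ℝ := fun y => f (U.symm y) with hg
  have hgU : ∀ x, g (U x) = f x := fun x => by simp [hg]
  have hgl : LC g := by
    refine ⟨fun x => h.nonneg _, fun x y t ht0 ht1 => ?_⟩
    simp only [hg]
    rw [haff]
    exact h.lc _ _ t ht0 ht1
  have hset : ∀ s, ∫⁻ x in U ⁻¹' s, ENNReal.ofReal (f x) = ∫⁻ y in s, ENNReal.ofReal (g y) := by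
    intro s
    rw [← hUm.setLIntegral_comp_preimage_emb hUe (fun y => ENNReal.ofReal (g y)) s]
    simp_rw [hgU]
  have hg1 : ∫⁻ x, ENNReal.ofReal (g x) = 1 := by
    rw [← hf]
    have := hset Set.univ
    simpa using this.symm
  have hA' : ENNReal.ofReal (Real.exp (-(5 * n)) * (1 / 256) ^ n) ≤
      ∫⁻ x in Metric.closedBall (0 : EuclideanSpace ℝ (Fin n)) (512 * √n),
        ENNReal.ofReal (g x) := by
    rw [← hset]
    rw [hn'] at hA
    convert hA using 3
    ext x
    simp [hU]
  have hmapY : Measure.map (fun ω => U (X ω)) (ℙ : Measure Ω)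
      = volume.withDensity (fun x => ENNReal.ofReal (g x)) := by
    ext s hs
    rw [← Function.comp_def, ← Measure.map_map U.measurable hX, Measure.map_apply U.measurable hs,
      hXm, withDensity_apply _ (U.measurable hs), withDensity_apply _ hs, hset]
  have hsum := map_sum_ball (ℙ : Measure Ω) (fun ω => U (X ω)) Z (U.measurable.comp hX) hZ
    (hI.comp U.measurable measurable_id) hZm
  rw [hmapY] at hsum
  have hfinν : SFinite (volume.withDensity (fun x => ENNReal.ofReal (g x))) := by
    rw [← hmapY]; infer_instance
  have hrn := Measure.rnDeriv_withDensity (volume : Measure (EuclideanSpace ℝ (Fin n)))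
    (measurable_ballMeas (volume.withDensity (fun x => ENNReal.ofReal (g x))) r)
  have hd : dEnt (Measure.map (fun ω => U (X ω) + Z ω) (ℙ : Measure Ω))
      = -∫ z, LC.bm g r z * Real.log (LC.bm g r z) := by
    unfold dEnt
    rw [hsum]
    congr 1
    apply integral_congr_ae
    filter_upwards [hrn] with z hz
    rw [hz]
    rfl
  unfold entPow
  rw [Real.exp_le_exp, hd]
  by_cases hIntg : Integrable (fun z => LC.bm g r z * Real.log (LC.bm g r z)) volume
  · have hgM : ∀ x, g x ≤ M := fun x => hfM _
    have hent := hgl.entropy_le hg1 hM hgM (by positivity) (by positivity) hr hA' hv hIntg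
    rw [hn'] at hent
    have hJ0 := hgl.int_sqrt_pos hg1
    have hJt := hgl.int_sqrt_lt_top hg1
    have hJ : (∫⁻ x, ENNReal.ofReal √(g x)).toReal ≤ 2 ^ n / √(M / 2) := by
      have := hgl.int_sqrt_le hg1 hM (x0 := U x0) (by rw [hgU]; exact hx0)
      rw [hn'] at this
      exact ENNReal.toReal_le_of_le_ofReal (by positivity) this
    have hr2 := r_lower hr hv
    rw [hn'] at hr2
    refine le_trans ?_ (const_bound hn hM hr hr2 (ENNReal.toReal_pos hJ0.ne' hJt.ne) hJ)
    gcongr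
  · rw [integral_undef hIntg]
    simp only [neg_zero, mul_zero, zero_div]
    have : 0 ≤ Real.log (2561 * 2048 * Real.exp 5) := by
      apply Real.log_nonneg
      have := Real.add_one_le_exp 5
      linarith
    linarith
end

section
/- Let X be a random vector in ℝⁿ with log-concave density f, and let Z be a Gaussian random vector in ℝⁿ whose density g satisfies ‖g‖_∞ = ‖f‖_∞. Then h(Z)/n − 1/2 ≤ h(X)/n ≤ h(Z)/n + 1/2; that is, |h(X) − h(Z)| ≤ n/2. -/
open MeasureTheory ProbabilityTheory Real Pointwise

/-- The Shannon differential entropy `h(f) = -∫ f log f` of a density `f` on ℝⁿ. -/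
noncomputable def hEnt {n : ℕ} (f : EuclideanSpace ℝ (Fin n) → ℝ) : ℝ :=
  -∫ x, f x * Real.log (f x)

/-- The density of the Gaussian `N(m, S)` on ℝⁿ:
`g(x) = ((2π)ⁿ det S)^{-1/2} exp(-(1/2) (x-m)ᵀ S⁻¹ (x-m))`. -/
noncomputable def gaussianDensity {n : ℕ} (m : EuclideanSpace ℝ (Fin n))
    (S : Matrix (Fin n) (Fin n) ℝ) (x : EuclideanSpace ℝ (Fin n)) : ℝ :=
  (Real.sqrt ((2 * Real.pi) ^ n * S.det))⁻¹ *
    Real.exp (-(1 / 2) * ∑ i, ∑ j, S⁻¹ i j * (x i - m i) * (x j - m j))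

lemma aux_density {n : ℕ} {Ω : Type} [MeasureSpace Ω] (hP : IsProbabilityMeasure (ℙ : Measure Ω))
    (X : Ω → EuclideanSpace ℝ (Fin n)) (hX : Measurable X)
    (f : EuclideanSpace ℝ (Fin n) → ℝ) (h0 : ∀ x, 0 ≤ f x) (hm : AEMeasurable f volume)
    (hXf : Measure.map X (ℙ : Measure Ω)
      = volume.withDensity (fun x => ENNReal.ofReal (f x))) :
    Integrable f ∧ ∫ x, f x = 1 := by
  have h1 : ∫⁻ x, ENNReal.ofReal (f x) = 1 := by
    have := congrArg (fun μ : Measure _ => μ Set.univ) hXf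
    simp only [withDensity_apply _ MeasurableSet.univ, Measure.restrict_univ] at this
    rw [← this, Measure.map_apply hX MeasurableSet.univ]
    simp
  constructor
  · refine ⟨hm.aestronglyMeasurable, ?_⟩
    rw [hasFiniteIntegral_iff_ofReal (Filter.Eventually.of_forall h0), h1]
    exact ENNReal.one_lt_top
  · rw [integral_eq_lintegral_of_nonneg_ae (Filter.Eventually.of_forall h0)
      hm.aestronglyMeasurable, h1]
    simp

lemma aux_meas {n : ℕ} (f : EuclideanSpace ℝ (Fin n) → ℝ) (hf : IsLogConcave f) :
    AEMeasurable f volume := by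
  have key : NullMeasurable f (volume : Measure (EuclideanSpace ℝ (Fin n))) := by
    have : @Measurable (NullMeasurableSpace (EuclideanSpace ℝ (Fin n)) volume) ℝ _ _ f := by
      apply measurable_of_Ioi
      intro a
      have hc : Convex ℝ (f ⁻¹' Set.Ioi a) := by
        intro x hx y hy s t hs ht hst
        simp only [Set.mem_preimage, Set.mem_Ioi] at hx hy ⊢
        obtain rfl : t = 1 - s := by linarith
        by_cases ha : a < 0
        · exact ha.trans_le (hf.1 _)
        push Not at ha
        refine lt_of_lt_of_le ?_ (hf.2 x y s hs (by linarith))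
        have hmin : a < min (f x) (f y) := lt_min hx hy
        have hp : 0 < min (f x) (f y) := ha.trans_lt hmin
        calc a < min (f x) (f y) := hmin
          _ = min (f x) (f y) ^ s * min (f x) (f y) ^ (1 - s) := by
            rw [← Real.rpow_add hp]; simp
          _ ≤ _ := by
            exact mul_le_mul (Real.rpow_le_rpow hp.le (min_le_left _ _) hs)
              (Real.rpow_le_rpow hp.le (min_le_right _ _) ht)
              (Real.rpow_nonneg hp.le _) (Real.rpow_nonneg (hf.1 _) _)
      exact hc.nullMeasurableSet volume
    exact this
  exact key.aemeasurable

lemma aux_scale {n : ℕ} (f : EuclideanSpace ℝ (Fin n) → ℝ) (hi : Integrable f)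
    (h1 : ∫ x, f x = 1) (a : EuclideanSpace ℝ (Fin n)) (t : ℝ) (ht : 0 < t) :
    Integrable (fun x => f (t • x + a)) ∧ ∫ x, f (t • x + a) = (t ^ n)⁻¹ := by
  constructor
  · exact (hi.comp_add_right a).comp_smul ht.ne'
  · rw [Measure.integral_comp_smul volume (fun x => f (x + a)) t, integral_add_right_eq_self, h1]
    simp [abs_of_pos ht]

/-- Log-concave part. -/
lemma aux_lc {n : ℕ} (f : EuclideanSpace ℝ (Fin n) → ℝ) (hf : IsLogConcave f)
    (hi : Integrable f) (h1 : ∫ x, f x = 1) (c : ℝ) (hc : 0 < c) (hle : ∀ᵐ x, f x ≤ c) :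
    Integrable (fun x => f x * Real.log (f x)) ∧
    -Real.log c ≤ hEnt f ∧ ∀ x, 0 < f x → hEnt f ≤ n - Real.log (f x) := by
  have hm := aux_meas f hf
  have hft : ∀ x₀, 0 < f x₀ → ∀ t : ℝ, 0 < t → t < 1 →
      Integrable (fun x => f x ^ t) ∧ ∫ x, f x ^ t ≤ (t ^ n)⁻¹ * f x₀ ^ (t - 1) := by
    intro x₀ hx₀ t ht ht1
    obtain ⟨i1, i2⟩ := aux_scale f hi h1 ((1 - t) • x₀) t ht
    have hb : ∀ x, f x ^ t ≤ f (t • x + (1 - t) • x₀) * f x₀ ^ (t - 1) := by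
      intro x
      have h := hf.2 x x₀ t ht.le ht1.le
      have h2 : f x ^ t = f x ^ t * f x₀ ^ (1 - t) * f x₀ ^ (t - 1) := by
        rw [mul_assoc, ← Real.rpow_add hx₀]; simp
      rw [h2]
      gcongr
    have i3 := i1.mul_const (f x₀ ^ (t - 1))
    have i4 : Integrable (fun x => f x ^ t) := by
      refine i3.mono' (hm.pow_const t).aestronglyMeasurable (Filter.Eventually.of_forall fun x => ?_)
      rw [Real.norm_of_nonneg (Real.rpow_nonneg (hf.1 x) t)]
      exact hb x
    refine ⟨i4, ?_⟩
    rw [← i2, ← integral_mul_const]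
    exact integral_mono i4 i3 hb
  have hpt : ∀ t : ℝ, 0 < t → t < 1 → ∀ x, -(f x * Real.log (f x)) * (1 - t) ≤ f x ^ t - f x := by
    intro t ht ht1 x
    rcases (hf.1 x).eq_or_lt with h | h
    · rw [← h]; simp [Real.zero_rpow ht.ne']
    · have e : f x ^ t = f x * Real.exp (Real.log (f x) * (t - 1)) := by
        rw [← Real.rpow_def_of_pos h, Real.rpow_sub_one h.ne']
        field_simp
      rw [e]
      have := mul_le_mul_of_nonneg_left (Real.add_one_le_exp (Real.log (f x) * (t - 1))) h.le
      linarith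
  have hlow : ∀ᵐ x, f x * Real.log (f x) ≤ f x * Real.log c := by
    filter_upwards [hle] with x hx
    rcases (hf.1 x).eq_or_lt with h | h
    · rw [← h]; simp
    · exact mul_le_mul_of_nonneg_left (Real.log_le_log h hx) h.le
  have hex : ∃ x₀, 0 < f x₀ := by
    by_contra hcon
    push Not at hcon
    have : ∫ x, f x = 0 := by
      rw [← integral_zero (EuclideanSpace ℝ (Fin n)) ℝ (μ := volume)]
      congr 1; ext x; exact le_antisymm (hcon x) (hf.1 x)
    linarith
  have hint : Integrable (fun x => f x * Real.log (f x)) := by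
    obtain ⟨x₀, hx₀⟩ := hex
    have j := (hft x₀ hx₀ (1/2) (by norm_num) (by norm_num)).1
    have j1 : Integrable (fun x => 2 * (f x ^ (1/2 : ℝ) - f x)) := (j.sub hi).const_mul 2
    have j2 : Integrable (fun x => |2 * (f x ^ (1/2 : ℝ) - f x)| + |f x * Real.log c|) :=
      j1.abs.add (hi.mul_const _).abs
    refine j2.mono' (hm.mul hm.log).aestronglyMeasurable ?_
    filter_upwards [hlow] with x hx
    rw [Real.norm_eq_abs, abs_le]
    have := hpt (1/2) (by norm_num) (by norm_num) x
    constructor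
    · have := le_abs_self (2 * (f x ^ (1/2 : ℝ) - f x))
      have := abs_nonneg (f x * Real.log c)
      linarith
    · have := abs_nonneg (2 * (f x ^ (1/2 : ℝ) - f x))
      have := le_abs_self (f x * Real.log c)
      linarith
  refine ⟨hint, ?_, ?_⟩
  · have := integral_mono_ae hint (hi.mul_const (Real.log c)) hlow
    rw [integral_mul_const, h1] at this
    unfold hEnt
    linarith
  · intro x₀ hx₀
    set H := hEnt f with hH
    have hφ : ∀ t : ℝ, 0 < t → t < 1 → 0 ≤ (t ^ n)⁻¹ * f x₀ ^ (t - 1) - 1 - (1 - t) * H := by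
      intro t ht ht1
      obtain ⟨k1, k2⟩ := hft x₀ hx₀ t ht ht1
      have := integral_mono (hint.neg.mul_const (1 - t)) (k1.sub hi) (hpt t ht ht1)
      simp only [Pi.neg_apply, Pi.sub_apply] at this
      rw [integral_mul_const, integral_neg, integral_sub k1 hi, h1] at this
      have e : H = -∫ x, f x * Real.log (f x) := rfl
      rw [← e] at this
      linarith
    have hd : HasDerivAt (fun t : ℝ => (t ^ n)⁻¹ * f x₀ ^ (t - 1) - 1 - (1 - t) * H)
        (-n + Real.log (f x₀) + H) 1 := by
      have d1 : HasDerivAt (fun t : ℝ => (t ^ n)⁻¹) (-n) 1 := by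
        exact ((hasDerivAt_pow n (1:ℝ)).inv (by simp)).congr_deriv (by simp)
      have d2 : HasDerivAt (fun t : ℝ => f x₀ ^ (t - 1)) (Real.log (f x₀)) 1 := by
        have := ((hasDerivAt_id (1:ℝ)).sub_const 1).const_rpow hx₀
        simpa using this
      have d3 : HasDerivAt (fun t : ℝ => (1 - t) * H) (-H) 1 := by
        simpa using ((hasDerivAt_id (1:ℝ)).const_sub 1).mul_const H
      have := ((d1.mul d2).sub_const 1).sub d3
      refine this.congr_deriv ?_
      simp
    have hs := (hasDerivAt_iff_tendsto_slope.1 hd).mono_left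
      (nhdsWithin_mono (1:ℝ) (show Set.Iio (1:ℝ) ⊆ {1}ᶜ from fun x hx => ne_of_lt hx))
    have : -(n:ℝ) + Real.log (f x₀) + H ≤ 0 := by
      refine le_of_tendsto hs ?_
      have : Set.Ioo (0:ℝ) 1 ∈ nhdsWithin (1:ℝ) (Set.Iio 1) := Ioo_mem_nhdsLT (by norm_num)
      filter_upwards [this] with t ht
      rw [slope_def_field]
      have := hφ t ht.1 ht.2
      apply div_nonpos_of_nonneg_of_nonpos
      · simpa using this
      · linarith [ht.2]
    linarith

/-- Gaussian part. -/
lemma aux_gauss {n : ℕ} (q : EuclideanSpace ℝ (Fin n) → ℝ) (m : EuclideanSpace ℝ (Fin n))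
    (hq0 : ∀ x, 0 ≤ q x) (hqc : Continuous q)
    (hqs : ∀ (s : ℝ) x, q (s • x + (1 - s) • m) = s ^ 2 * q x) (c : ℝ) (hc : 0 < c)
    (hi : Integrable (fun x => c * Real.exp (-q x)))
    (h1 : ∫ x, c * Real.exp (-q x) = 1) :
    hEnt (fun x => c * Real.exp (-q x)) = n / 2 - Real.log c := by
  have hs : ∀ s : ℝ, 0 < s → Integrable (fun x => c * Real.exp (-(s ^ 2 * q x))) ∧
      ∫ x, c * Real.exp (-(s ^ 2 * q x)) = (s ^ n)⁻¹ := by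
    intro s h
    have := aux_scale _ hi h1 ((1 - s) • m) s h
    simpa only [hqs] using this
  have hqi : Integrable (fun x => (c * Real.exp (-q x)) * q x) := by
    obtain ⟨k, -⟩ := hs (Real.sqrt (1/2)) (by positivity)
    rw [Real.sq_sqrt (by norm_num)] at k
    refine (k.const_mul 2).mono' (by fun_prop) (Filter.Eventually.of_forall fun x => ?_)
    have hn := hq0 x
    rw [Real.norm_of_nonneg (by positivity)]
    have e : Real.exp (-q x) * Real.exp (1/2 * q x) = Real.exp (-(1/2 * q x)) := by
      rw [← Real.exp_add]; ring_nf
    have := Real.add_one_le_exp (1/2 * q x)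
    calc c * Real.exp (-q x) * q x ≤ c * Real.exp (-q x) * (2 * Real.exp (1/2 * q x)) := by
          gcongr; linarith
      _ = 2 * (c * (Real.exp (-q x) * Real.exp (1/2 * q x))) := by ring
      _ = _ := by rw [e]
  set A := ∫ x, (c * Real.exp (-q x)) * q x with hA
  have hφ : ∀ s : ℝ, 0 < s → 0 ≤ (s ^ n)⁻¹ - 1 + (s ^ 2 - 1) * A := by
    intro s h
    obtain ⟨k1, k2⟩ := hs s h
    have : ∫ x, (c * Real.exp (-q x) - (c * Real.exp (-q x)) * q x * (s ^ 2 - 1)) ≤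
        ∫ x, c * Real.exp (-(s ^ 2 * q x)) := by
      refine integral_mono (hi.sub (hqi.mul_const _)) k1 fun x => ?_
      have e : Real.exp (-(s ^ 2 * q x)) = Real.exp (-q x) * Real.exp (-((s ^ 2 - 1) * q x)) := by
        rw [← Real.exp_add]; ring_nf
      have := mul_le_mul_of_nonneg_left (Real.add_one_le_exp (-((s ^ 2 - 1) * q x)))
        (show 0 ≤ c * Real.exp (-q x) by positivity)
      simp only
      rw [e]
      linarith
    rw [integral_sub hi (hqi.mul_const _), integral_mul_const, h1, k2] at this
    linarith
  have hd : HasDerivAt (fun s : ℝ => (s ^ n)⁻¹ - 1 + (s ^ 2 - 1) * A) (-n + 2 * A) 1 := by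
    have d1 : HasDerivAt (fun t : ℝ => (t ^ n)⁻¹) (-n) 1 := by
      exact ((hasDerivAt_pow n (1:ℝ)).inv (by simp)).congr_deriv (by simp)
    have d2 : HasDerivAt (fun s : ℝ => (s ^ 2 - 1) * A) (2 * A) 1 := by
      simpa using ((hasDerivAt_pow 2 (1:ℝ)).sub_const 1).mul_const A
    exact (d1.sub_const 1).add d2
  have hmin : IsLocalMin (fun s : ℝ => (s ^ n)⁻¹ - 1 + (s ^ 2 - 1) * A) 1 := by
    filter_upwards [lt_mem_nhds (show (0:ℝ) < 1 by norm_num)] with s h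
    simpa using hφ s h
  have hz := hmin.hasDerivAt_eq_zero hd
  have e : ∀ x, c * Real.exp (-q x) * Real.log (c * Real.exp (-q x)) =
      c * Real.exp (-q x) * Real.log c - c * Real.exp (-q x) * q x := by
    intro x
    rw [Real.log_mul hc.ne' (Real.exp_pos _).ne', Real.log_exp]; ring
  unfold hEnt
  simp only [e]
  rw [integral_sub (hi.mul_const _) hqi, integral_mul_const, h1, ← hA]
  linarith

theorem entropy_gaussian_comparison
    {n : ℕ} (hn : 1 ≤ n)
    {Ω : Type} [MeasureSpace Ω] (hP : IsProbabilityMeasure (ℙ : Measure Ω))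
    (X Z : Ω → EuclideanSpace ℝ (Fin n)) (hX : Measurable X) (hZ : Measurable Z)
    (f : EuclideanSpace ℝ (Fin n) → ℝ) (hf : IsLogConcave f)
    (hXf : Measure.map X (ℙ : Measure Ω)
      = volume.withDensity (fun x => ENNReal.ofReal (f x)))
    (m : EuclideanSpace ℝ (Fin n)) (S : Matrix (Fin n) (Fin n) ℝ) (hS : S.PosDef)
    (hZg : Measure.map Z (ℙ : Measure Ω)
      = volume.withDensity (fun x => ENNReal.ofReal (gaussianDensity m S x)))
    (hmax : essSup (fun x => ENNReal.ofReal (gaussianDensity m S x)) volume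
      = essSup (fun x => ENNReal.ofReal (f x)) volume) :
    |hEnt f - hEnt (gaussianDensity m S)| ≤ n / 2 := by
  obtain ⟨c, hcdef⟩ : ∃ c, c = (Real.sqrt ((2 * Real.pi) ^ n * S.det))⁻¹ := ⟨_, rfl⟩
  have hc : 0 < c := by
    have := hS.det_pos
    rw [hcdef]; positivity
  obtain ⟨q, hqdef⟩ : ∃ q : EuclideanSpace ℝ (Fin n) → ℝ,
    q = fun x => (1 / 2) * ∑ i, ∑ j, S⁻¹ i j * (x i - m i) * (x j - m j) := ⟨_, rfl⟩
  have hg : gaussianDensity m S = fun x => c * Real.exp (-q x) := by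
    ext x
    simp only [gaussianDensity, hcdef, hqdef]
    ring_nf
  have hq0 : ∀ x, 0 ≤ q x := by
    intro x
    have h := hS.inv.posSemidef.dotProduct_mulVec_nonneg (fun i => x i - m i)
    rw [hqdef]
    have e : ∑ i, ∑ j, S⁻¹ i j * (x i - m i) * (x j - m j) =
        star (fun i => x i - m i) ⬝ᵥ (S⁻¹.mulVec (fun i => x i - m i)) := by
      simp only [dotProduct, Matrix.mulVec, Finset.mul_sum, Pi.star_apply, star_trivial]
      refine Finset.sum_congr rfl fun i _ => Finset.sum_congr rfl fun j _ => by ring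
    simp only
    rw [e]
    positivity
  have hqc : Continuous q := by rw [hqdef]; fun_prop
  have hqs : ∀ (s : ℝ) x, q (s • x + (1 - s) • m) = s ^ 2 * q x := by
    intro s x
    simp only [hqdef, Finset.mul_sum, PiLp.add_apply, PiLp.smul_apply, smul_eq_mul]
    refine Finset.sum_congr rfl fun i _ => Finset.sum_congr rfl fun j _ => by ring
  have hqm : q m = 0 := by simp [hqdef]
  rw [hg] at hZg hmax ⊢
  have hgc : Continuous (fun x => c * Real.exp (-q x)) := by fun_prop
  obtain ⟨gi, g1⟩ := aux_density hP Z hZ _ (fun x => by positivity)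
    hgc.measurable.aemeasurable hZg
  have hG := aux_gauss q m hq0 hqc hqs c hc gi g1
  obtain ⟨fi, f1⟩ := aux_density hP X hX f hf.1 (aux_meas f hf) hXf
  have hup : essSup (fun x => ENNReal.ofReal (c * Real.exp (-q x))) volume ≤ ENNReal.ofReal c := by
    refine essSup_le_of_ae_le _ (Filter.Eventually.of_forall fun x => ?_)
    refine ENNReal.ofReal_le_ofReal ?_
    have : Real.exp (-q x) ≤ 1 := Real.exp_le_one_iff.2 (by linarith [hq0 x])
    nlinarith
  have hle : ∀ᵐ x, f x ≤ c := by
    filter_upwards [ENNReal.ae_le_essSup (μ := volume) (fun x => ENNReal.ofReal (f x))] with x hx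
    rw [← hmax] at hx
    exact (ENNReal.ofReal_le_ofReal_iff hc.le).1 (hx.trans hup)
  obtain ⟨-, l1, l2⟩ := aux_lc f hf fi f1 c hc hle
  have hce : c ≤ Real.exp (n - hEnt f) := by
    set K := Real.exp (n - hEnt f) with hK
    have hfK : ∀ x, f x ≤ K := by
      intro x
      rcases (hf.1 x).eq_or_lt with h | h
      · rw [← h]; positivity
      · rw [hK, ← Real.log_le_iff_le_exp h]; linarith [l2 x h]
    have hsK : essSup (fun x => ENNReal.ofReal (c * Real.exp (-q x))) volume
        ≤ ENNReal.ofReal K := by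
      rw [hmax]
      exact essSup_le_of_ae_le _ (Filter.Eventually.of_forall fun x =>
        ENNReal.ofReal_le_ofReal (hfK x))
    by_contra hcon
    push Not at hcon
    have hae : ∀ᵐ x, c * Real.exp (-q x) ≤ K := by
      filter_upwards [ENNReal.ae_le_essSup (μ := volume)
        (fun x => ENNReal.ofReal (c * Real.exp (-q x)))] with x hx
      exact (ENNReal.ofReal_le_ofReal_iff (Real.exp_pos _).le).1 (hx.trans hsK)
    have hopen : IsOpen {x | K < c * Real.exp (-q x)} := isOpen_lt continuous_const hgc
    have hne := hopen.measure_ne_zero (volume : Measure (EuclideanSpace ℝ (Fin n)))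
      ⟨m, by simpa [hqm] using hcon⟩
    apply hne
    rw [ae_iff] at hae
    simpa only [not_le] using hae
  have h3 : Real.log c ≤ n - hEnt f := (Real.log_le_iff_le_exp hc).2 hce
  rw [hG, abs_le]
  constructor <;> linarith
end
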